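/- arXiv:1210.7426 — 3 statements merged into one kernel-verified Lean document; each statement's English description precedes it below -/
import Mathlib

section
/- Let p be a driving function from the Carathéodory class, C² on 𝔻̄ for each t, continuous in t, with p, p' = ∂p/∂z, p'' = ∂²p/∂z² bounded on 𝔻̄ × [0,T). Let f(z,t) solve the Löwner–Kufarev PDE ∂f/∂t = -z·(∂f/∂z)·p(z,t), f(z,0) = z, each f(·,t) univalent on 𝔻, with f' = ∂f/∂z and f'' = ∂²f/∂z². Then there exist constants c₅, c₆ > 0 and t₀ > 0 such that for all 0 < t < t₀ and all z ∈ 𝔻: 1 - c₅·t < Re(z·f'(z,t)/f(z,t)) < 1 + c₅·t and |Re(z·f''(z,t)/f'(z,t))| < c₆·t; moreover f'(z,t) is bounded on 𝔻 × [0,t₀]. -/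
section

open Set Filter Topology Metric

/-- A family of functions of `z` indexed by `t` is bounded near each point of `U × S`. -/
def LocallyBoundedFamily (U : Set ℂ) (S : Set ℝ) (F : ℂ → ℝ → ℂ) : Prop :=
  ∀ z ∈ U, ∀ t ∈ S, ∃ r > 0, ∃ C, ball z r ⊆ U ∧
    ∀ τ ∈ S, |τ - t| < r → ∀ w ∈ ball z r, ‖F w τ‖ ≤ C

/-- A locally bounded family of holomorphic functions whose time derivative is
again such a family. -/
structure HolomorphicEvolution (U : Set ℂ) (S : Set ℝ) (F G : ℂ → ℝ → ℂ) : Prop where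
  hol : ∀ t ∈ S, DifferentiableOn ℂ (fun z => F z t) U
  hol_dt : ∀ t ∈ S, DifferentiableOn ℂ (fun z => G z t) U
  bdd : LocallyBoundedFamily U S F
  bdd_dt : LocallyBoundedFamily U S G
  hasDeriv : ∀ z ∈ U, ∀ t ∈ S, HasDerivWithinAt (fun u => F z u) (G z t) S t

section

variable {U : Set ℂ} {S : Set ℝ} {F G : ℂ → ℝ → ℂ}

theorem LocallyBoundedFamily.mul (hF : LocallyBoundedFamily U S F)
    (hG : LocallyBoundedFamily U S G) :
    LocallyBoundedFamily U S (fun z t => F z t * G z t) := by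
  intro z hz t ht
  obtain ⟨r, hr, C, hU, hC⟩ := hF z hz t ht
  obtain ⟨r', hr', C', hU', hC'⟩ := hG z hz t ht
  refine ⟨min r r', lt_min hr hr', C * C', (ball_subset_ball (min_le_left _ _)).trans hU, ?_⟩
  intro τ hτ h w hw
  have h1 := hC τ hτ (h.trans_le (min_le_left _ _)) w (ball_subset_ball (min_le_left _ _) hw)
  have h2 := hC' τ hτ (h.trans_le (min_le_right _ _)) w (ball_subset_ball (min_le_right _ _) hw)
  rw [norm_mul]
  exact mul_le_mul h1 h2 (norm_nonneg _) ((norm_nonneg _).trans h1)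

theorem LocallyBoundedFamily.neg (hF : LocallyBoundedFamily U S F) :
    LocallyBoundedFamily U S (fun z t => -F z t) := by
  simpa [LocallyBoundedFamily] using hF

theorem LocallyBoundedFamily.of_bound (hU : IsOpen U) {C : ℝ}
    (h : ∀ z ∈ U, ∀ t ∈ S, ‖F z t‖ ≤ C) : LocallyBoundedFamily U S F := by
  intro z hz t _
  obtain ⟨r, hr, hrU⟩ := Metric.isOpen_iff.1 hU z hz
  exact ⟨r, hr, C, hrU, fun τ hτ _ w hw => h w (hrU hw) τ hτ⟩

theorem LocallyBoundedFamily.congr (hF : LocallyBoundedFamily U S F)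
    (h : ∀ z ∈ U, ∀ t ∈ S, F z t = G z t) : LocallyBoundedFamily U S G := by
  intro z hz t ht
  obtain ⟨r, hr, C, hU, hC⟩ := hF z hz t ht
  exact ⟨r, hr, C, hU, fun τ hτ ha w hw => h w (hU hw) τ hτ ▸ hC τ hτ ha w hw⟩

theorem LocallyBoundedFamily.deriv (hF : LocallyBoundedFamily U S F)
    (hol : ∀ t ∈ S, DifferentiableOn ℂ (fun z => F z t) U) :
    LocallyBoundedFamily U S (fun z t => deriv (fun x => F x t) z) := by
  intro z hz t ht
  obtain ⟨r, hr, C, hU, hC⟩ := hF z hz t ht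
  refine ⟨r / 2, by positivity, C / (r / 4), (ball_subset_ball (by linarith)).trans hU, ?_⟩
  intro τ hτ ha w hw
  have hsub : closedBall w (r / 4) ⊆ ball z r := by
    intro x hx
    rw [mem_ball] at *
    rw [mem_closedBall] at hx
    linarith [dist_triangle x w z]
  refine Complex.norm_deriv_le_of_forall_mem_sphere_norm_le (by positivity) ?_ ?_
  · exact ((hol τ hτ).mono hU).diffContOnCl_ball hsub
  · intro x hx
    exact hC τ hτ (by linarith) x (hsub (sphere_subset_closedBall hx))

/-- Derivatives of a bounded family of holomorphic functions converge when the functions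
converge pointwise. -/
theorem tendsto_deriv_of_tendsto_of_bounded {ι : Type*} {l : Filter ι} [l.IsCountablyGenerated]
    {g : ι → ℂ → ℂ} {g₀ : ℂ → ℂ} {z : ℂ} {r C : ℝ} (hr : 0 < r)
    (hol : ∀ᶠ i in l, DifferentiableOn ℂ (g i) (ball z r))
    (hol₀ : DifferentiableOn ℂ g₀ (ball z r))
    (hC : ∀ᶠ i in l, ∀ w ∈ ball z r, ‖g i w‖ ≤ C)
    (hlim : ∀ w ∈ ball z r, Tendsto (fun i => g i w) l (𝓝 (g₀ w))) :
    Tendsto (fun i => _root_.deriv (g i) z) l (𝓝 (_root_.deriv g₀ z)) := by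
  have hsub : closedBall z (r / 2) ⊆ ball z r := closedBall_subset_ball (by linarith)
  have key : ∀ h : ℂ → ℂ, DifferentiableOn ℂ h (ball z r) →
      ((2 * Real.pi * Complex.I : ℂ)⁻¹ • ∮ x in C(z, r / 2), ((x - z) ^ 2)⁻¹ • h x)
        = _root_.deriv h z := fun h hh =>
    Complex.two_pi_I_inv_smul_circleIntegral_sub_sq_inv_smul_of_differentiable isOpen_ball hsub hh
      (mem_ball_self (by positivity))
  rw [← key g₀ hol₀]
  refine Tendsto.congr' (hol.mono fun i hi => key (g i) hi) ?_
  refine Tendsto.const_smul ?_ _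
  have hmem : ∀ θ, circleMap z (r / 2) θ ∈ ball z r := fun θ =>
    hsub (circleMap_mem_closedBall z (by positivity) θ)
  have hne : ∀ θ, circleMap z (r / 2) θ - z ≠ 0 := fun θ =>
    sub_ne_zero.2 (circleMap_ne_center (by positivity))
  refine intervalIntegral.tendsto_integral_filter_of_dominated_convergence
    (fun _ => (r / 2) * (((r / 2) ^ 2)⁻¹ * C)) ?_ ?_ (by simp) ?_
  · filter_upwards [hol] with i hi
    apply Continuous.aestronglyMeasurable
    have h1 : Continuous fun θ => g i (circleMap z (r / 2) θ) :=
      hi.continuousOn.comp_continuous (continuous_circleMap _ _) hmem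
    have h2 : Continuous fun θ => ((circleMap z (r / 2) θ - z) ^ 2)⁻¹ :=
      (((continuous_circleMap _ _).sub continuous_const).pow 2).inv₀
        (fun θ => pow_ne_zero 2 (hne θ))
    simp only [deriv_circleMap]
    exact ((continuous_circleMap _ _).mul continuous_const).smul (h2.smul h1)
  · filter_upwards [hC] with i hi
    refine Eventually.of_forall fun θ _ => ?_
    have := hi _ (hmem θ)
    rw [norm_smul, norm_smul, deriv_circleMap, norm_mul, norm_inv, norm_pow, circleMap_sub_center]
    simp only [norm_circleMap_zero, Complex.norm_I, mul_one, abs_of_pos (half_pos hr)]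
    gcongr
  · refine Eventually.of_forall fun θ _ => ?_
    exact ((hlim _ (hmem θ)).const_smul _).const_smul _

theorem HolomorphicEvolution.deriv (hU : IsOpen U) (hS : Convex ℝ S)
    (h : HolomorphicEvolution U S F G) :
    HolomorphicEvolution U S (fun z t => deriv (fun x => F x t) z)
      (fun z t => deriv (fun x => G x t) z) where
  hol t ht := (h.hol t ht).deriv hU
  hol_dt t ht := (h.hol_dt t ht).deriv hU
  bdd := h.bdd.deriv h.hol
  bdd_dt := h.bdd_dt.deriv h.hol_dt
  hasDeriv := by
    intro z hz t ht
    obtain ⟨r, hr, C, hrU, hC⟩ := h.bdd_dt z hz t ht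
    have hev : ∀ᶠ τ in 𝓝[S \ {t}] t, τ ∈ S ∧ τ ≠ t ∧ |τ - t| < r := by
      have h1 : ∀ᶠ τ in 𝓝[S \ {t}] t, τ ∈ S \ {t} := self_mem_nhdsWithin
      have h2 : ∀ᶠ τ in 𝓝[S \ {t}] t, τ ∈ ball t r :=
        mem_nhdsWithin_of_mem_nhds (ball_mem_nhds t hr)
      filter_upwards [h1, h2] with τ h1 h2
      exact ⟨h1.1, h1.2, by simpa [Real.dist_eq] using h2⟩
    rw [hasDerivWithinAt_iff_tendsto_slope]
    have key : Tendsto (fun τ => _root_.deriv (fun x => slope (fun u => F x u) t τ) z)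
        (𝓝[S \ {t}] t) (𝓝 (_root_.deriv (fun x => G x t) z)) := by
      refine tendsto_deriv_of_tendsto_of_bounded (C := C) hr ?_ ((h.hol_dt t ht).mono hrU) ?_ ?_
      · filter_upwards [hev] with τ hτ
        simp only [slope_def_module]
        exact (((h.hol τ hτ.1).sub (h.hol t ht)).mono hrU).const_smul _
      · filter_upwards [hev] with τ hτ w hw
        have := (hS.inter (convex_ball t r)).norm_image_sub_le_of_norm_hasDerivWithin_le
          (f := fun u => F w u) (f' := fun u => G w u) (C := C) (x := t) (y := τ)
          (fun x hx => (h.hasDeriv w (hrU hw) x hx.1).mono inter_subset_left)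
          (fun x hx => hC x hx.1 (by simpa [Real.dist_eq] using hx.2) w hw)
          ⟨ht, mem_ball_self hr⟩ ⟨hτ.1, by simpa [Real.dist_eq] using hτ.2.2⟩
        rw [slope_def_module, norm_smul, norm_inv]
        rw [inv_mul_le_iff₀ (norm_pos_iff.2 (sub_ne_zero.2 hτ.2.1)), mul_comm]
        exact this
      · intro w hw
        exact hasDerivWithinAt_iff_tendsto_slope.1 (h.hasDeriv w (hrU hw) t ht)
    refine key.congr' ?_
    filter_upwards [hev] with τ hτ
    simp only [slope_def_module]
    have h1 := ((h.hol τ hτ.1).differentiableAt (hU.mem_nhds hz))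
    have h2 := ((h.hol t ht).differentiableAt (hU.mem_nhds hz))
    have := ((h1.hasDerivAt.sub h2.hasDerivAt).const_smul ((τ - t)⁻¹ : ℝ)).deriv
    exact this

theorem HolomorphicEvolution.hasDerivWithinAt_comp (hU : IsOpen U) (hS : Convex ℝ S)
    (h : HolomorphicEvolution U S F G) {S' : Set ℝ} (hS' : S' ⊆ S) {ζ : ℝ → ℂ} {v : ℂ} {s : ℝ}
    (hs : s ∈ S') (hζU : ζ s ∈ U) (hζ : HasDerivWithinAt ζ v S' s) :
    HasDerivWithinAt (fun u => F (ζ u) u)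
      (G (ζ s) s + _root_.deriv (fun x => F x s) (ζ s) * v) S' s := by
  set z := ζ s with hz
  have hd := h.deriv hU hS
  have hdd := hd.bdd.deriv hd.hol
  obtain ⟨r, hr, C, hrU, hC⟩ := hdd z hζU s (hS' hs)
  have hev : ∀ᶠ τ in 𝓝[S'] s, τ ∈ S ∧ |τ - s| < r ∧ ζ τ ∈ ball z r := by
    have h1 : ∀ᶠ τ in 𝓝[S'] s, τ ∈ S' := self_mem_nhdsWithin
    have h2 : ∀ᶠ τ in 𝓝[S'] s, τ ∈ ball s r := mem_nhdsWithin_of_mem_nhds (ball_mem_nhds s hr)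
    have h3 := hζ.continuousWithinAt.eventually (ball_mem_nhds (ζ s) hr)
    filter_upwards [h1, h2, h3] with τ h1 h2 h3
    exact ⟨hS' h1, by simpa [Real.dist_eq] using h2, h3⟩
  set D : ℝ → ℂ := fun τ => _root_.deriv (fun x => F x τ) z with hD
  have hDc : ContinuousWithinAt D S' s :=
    ((hd.hasDeriv z hζU s (hS' hs)).continuousWithinAt).mono hS'
  have hlin : HasDerivWithinAt (fun τ => D τ * (ζ τ - z)) (D s * v) S' s := by
    rw [hasDerivWithinAt_iff_tendsto_slope] at hζ ⊢
    have h1 : Tendsto D (𝓝[S' \ {s}] s) (𝓝 (D s)) :=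
      hDc.tendsto.mono_left (nhdsWithin_mono _ sdiff_subset)
    refine (h1.mul hζ).congr fun τ => ?_
    simp only [slope_def_module, ← hz, sub_self, mul_zero, sub_zero, Complex.real_smul]
    ring
  have hquad : HasDerivWithinAt (fun τ => F (ζ τ) τ - F z τ - D τ * (ζ τ - z)) 0 S' s := by
    rw [hasDerivWithinAt_iff_isLittleO]
    have h1 : (fun τ => ζ τ - z) =O[𝓝[S'] s] fun τ => τ - s :=
      hζ.isBigO_sub.comp_tendsto (tendsto_id.prodMk (tendsto_pure.2 (Eventually.of_forall fun _ => rfl)))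
    have h0 : (fun τ => ζ τ - z) =o[𝓝[S'] s] fun _ => (1 : ℝ) := by
      rw [Asymptotics.isLittleO_one_iff]
      simpa [hz] using hζ.continuousWithinAt.tendsto.sub_const (ζ s)
    have h2 : (fun τ => (ζ τ - z) * (ζ τ - z)) =o[𝓝[S'] s] fun τ => (τ - s) := by
      simpa using h0.mul_isBigO h1
    refine Asymptotics.IsBigO.trans_isLittleO (Asymptotics.IsBigO.of_bound C ?_) h2
    filter_upwards [hev] with τ ⟨hτ, hτr, hζτ⟩
    simp only [← hz, sub_self, mul_zero, sub_zero, smul_zero]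
    rw [norm_mul, ← mul_assoc]
    set R := ‖ζ τ - z‖ with hR
    have hRr : R < r := by simpa [hR, dist_eq_norm] using hζτ
    have hsub : closedBall z R ⊆ ball z r := closedBall_subset_ball hRr
    have hzm : z ∈ closedBall z R := mem_closedBall_self (norm_nonneg _)
    have hζm : ζ τ ∈ closedBall z R := by simp [dist_eq_norm, hR]
    have hdF : ∀ x ∈ closedBall z R, HasDerivAt (fun x => F x τ)
        (_root_.deriv (fun x => F x τ) x) x := fun x hx =>
      ((h.hol τ hτ).differentiableAt (hU.mem_nhds (hrU (hsub hx)))).hasDerivAt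
    have hb : ∀ x ∈ closedBall z R, ‖_root_.deriv (fun x => F x τ) x - D τ‖ ≤ C * R := by
      intro x hx
      have := (convex_closedBall z R).norm_image_sub_le_of_norm_hasDerivWithin_le
        (f := fun x => _root_.deriv (fun x => F x τ) x) (C := C) (x := z) (y := x)
        (fun y hy => ((hd.hol τ hτ).differentiableAt
          (hU.mem_nhds (hrU (hsub hy)))).hasDerivAt.hasDerivWithinAt)
        (fun y hy => hC τ hτ hτr y (hsub hy)) hzm hx
      refine this.trans ?_
      have hC0 : 0 ≤ C := (norm_nonneg _).trans (hC τ hτ hτr z (mem_ball_self hr))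
      gcongr
      simpa [dist_eq_norm] using hx
    have := (convex_closedBall z R).norm_image_sub_le_of_norm_hasDerivWithin_le
        (f := fun x => F x τ - D τ * x)
        (f' := fun x => _root_.deriv (fun x => F x τ) x - D τ * 1) (C := C * R) (x := z) (y := ζ τ)
        (fun x hx => ((hdF x hx).sub ((hasDerivAt_id x).const_mul (D τ))).hasDerivWithinAt)
        (fun x hx => by simpa using hb x hx) hzm hζm
    refine le_trans (le_of_eq ?_) this
    congr 1
    ring
  have := (hquad.add (((h.hasDeriv z hζU s (hS' hs)).mono hS').add hlin))
  convert! this using 1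
  · ext τ
    simp
  · simp [hD]

end

/-- A pointwise bounded family of continuous functions on an open set is uniformly bounded
on some ball. -/
theorem exists_closedBall_forall_norm_le {U : Set ℂ} (hU : IsOpen U) (hne : U.Nonempty)
    {I : Set ℝ} {F : ℂ → ℝ → ℂ} (hF : ∀ t ∈ I, ContinuousOn (fun z => F z t) U)
    (hb : ∀ z ∈ U, ∃ C : ℝ, ∀ t ∈ I, ‖F z t‖ ≤ C) :
    ∃ a, ∃ ρ > 0, closedBall a ρ ⊆ U ∧ ∃ N : ℝ, ∀ z ∈ closedBall a ρ, ∀ t ∈ I, ‖F z t‖ ≤ N := by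
  obtain ⟨c, hc⟩ := hne
  obtain ⟨R, hR, hRU⟩ := Metric.isOpen_iff.1 hU c hc
  have hsub : closedBall c (R / 2) ⊆ U := (closedBall_subset_ball (by linarith)).trans hRU
  let E : ℕ → Set ℂ := fun n =>
    (ball c (R / 2))ᶜ ∪ ⋂ t ∈ I, {z ∈ closedBall c (R / 2) | ‖F z t‖ ≤ n}
  have hclosed : ∀ n, IsClosed (E n) := by
    intro n
    refine isOpen_ball.isClosed_compl.union (isClosed_biInter fun t ht => ?_)
    exact ((hF t ht).mono hsub).norm.preimage_isClosed_of_isClosed isClosed_closedBall isClosed_Iic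
  have huniv : ⋃ n, E n = univ := by
    refine eq_univ_of_forall fun z => ?_
    by_cases hz : z ∈ ball c (R / 2)
    · obtain ⟨C, hC⟩ := hb z (hsub (ball_subset_closedBall hz))
      obtain ⟨n, hn⟩ := exists_nat_ge C
      refine mem_iUnion.2 ⟨n, Or.inr (mem_iInter₂.2 fun t ht => ?_)⟩
      exact ⟨ball_subset_closedBall hz, (hC t ht).trans hn⟩
    · exact mem_iUnion.2 ⟨0, Or.inl hz⟩
  obtain ⟨a, ha, haE⟩ := (dense_iUnion_interior_of_closed hclosed huniv).exists_mem_open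
    isOpen_ball ⟨c, mem_ball_self (half_pos hR)⟩
  obtain ⟨n, hn⟩ := mem_iUnion.1 ha
  have hopen : IsOpen (interior (E n) ∩ ball c (R / 2)) := isOpen_interior.inter isOpen_ball
  obtain ⟨ρ, hρ, hρE⟩ := Metric.nhds_basis_closedBall.mem_iff.1 (hopen.mem_nhds ⟨hn, haE⟩)
  refine ⟨a, ρ, hρ, fun z hz => hsub (ball_subset_closedBall (hρE hz).2), n, fun z hz t ht => ?_⟩
  rcases interior_subset (hρE hz).1 with h | h
  · exact absurd (hρE hz).2 h
  · exact (mem_iInter₂.1 h t ht).2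

/-- Injective holomorphic functions omit on the complement of a disk a neighbourhood of the value
at its centre, of size controlled by the oscillation on the bounding circle. -/
theorem le_norm_sub_of_injOn {U : Set ℂ} {g : ℂ → ℂ} {a : ℂ} {ρ ε : ℝ}
    (hρ : 0 < ρ) (hsub : closedBall a ρ ⊆ U) (hg : DifferentiableOn ℂ g U) (hinj : InjOn g U)
    (hε : ∀ w ∈ sphere a ρ, ε ≤ ‖g w - g a‖) {z : ℂ} (hz : z ∈ U) (hza : z ∉ closedBall a ρ) :
    ε / 2 ≤ ‖g z - g a‖ := by
  by_contra! hlt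
  have ha : a ∈ ball a ρ := mem_ball_self hρ
  have hne : ∃ᶠ x in 𝓝 a, g x ≠ g a := by
    have h1 : ∀ᶠ x in 𝓝[≠] a, x ∈ ball a ρ :=
      mem_nhdsWithin_of_mem_nhds (ball_mem_nhds a hρ)
    have h2 : ∀ᶠ x in 𝓝[≠] a, x ≠ a := self_mem_nhdsWithin
    have h3 : ∀ᶠ x in 𝓝[≠] a, g x ≠ g a := by
      filter_upwards [h1, h2] with x h1 h2 h
      exact h2 (hinj (hsub (ball_subset_closedBall h1)) (hsub (ball_subset_closedBall ha)) h)
    exact h3.frequently.filter_mono nhdsWithin_le_nhds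
  have hd : DiffContOnCl ℂ g (ball a ρ) := by
    refine DifferentiableOn.diffContOnCl ?_
    rw [closure_ball a hρ.ne']
    exact hg.mono hsub
  obtain ⟨w, hw, hwz⟩ := hd.ball_subset_image_closedBall hρ hε hne
    (show g z ∈ ball (g a) (ε / 2) by simpa [dist_eq_norm] using hlt)
  exact hza (hinj (hsub hw) hz hwz ▸ hw)

/-- If a family of nonvanishing holomorphic functions is bounded below, and bounded above at the
centre, then it is bounded above near the centre. -/
theorem norm_le_of_le_norm {g : ℂ → ℂ} {z : ℂ} {r δ B : ℝ} (hr : 0 < r) (hδ : 0 < δ) (hB : 0 < B)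
    (hg : DifferentiableOn ℂ g (ball z r)) (hlow : ∀ w ∈ ball z r, δ ≤ ‖g w‖)
    (hz : ‖g z‖ ≤ B) {w : ℂ} (hw : w ∈ ball z (min r (r * δ / (4 * B)))) : ‖g w‖ ≤ 2 * B := by
  have hwr : w ∈ ball z r := ball_subset_ball (min_le_left _ _) hw
  have hne : ∀ x ∈ ball z r, g x ≠ 0 := fun x hx =>
    norm_pos_iff.1 (hδ.trans_le (hlow x hx))
  have hle : ∀ x ∈ ball z r, ‖(g x)⁻¹‖ ≤ δ⁻¹ := fun x hx => by
    rw [norm_inv]; exact inv_anti₀ hδ (hlow x hx)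
  have hzr : z ∈ ball z r := mem_ball_self hr
  have := Complex.dist_le_div_mul_dist_of_mapsTo_ball (f := fun x => (g x)⁻¹) (R₂ := 2 * δ⁻¹)
    (hg.inv hne) (fun x hx => by
      rw [mem_closedBall, dist_eq_norm]
      linarith [norm_sub_le (g x)⁻¹ (g z)⁻¹, hle x hx, hle z hzr]) hwr
  have hwd : dist w z ≤ r * δ / (4 * B) :=
    (mem_ball.1 hw).le.trans (min_le_right _ _)
  have h1 : dist (g w)⁻¹ (g z)⁻¹ ≤ B⁻¹ / 2 := by
    refine this.trans ((mul_le_mul_of_nonneg_left hwd (by positivity)).trans (le_of_eq ?_))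
    field_simp
    norm_num
  have h2 : B⁻¹ ≤ ‖(g z)⁻¹‖ := by
    rw [norm_inv]; exact inv_anti₀ (norm_pos_iff.2 (hne z hzr)) hz
  have h3 : B⁻¹ / 2 ≤ ‖(g w)⁻¹‖ := by
    rw [dist_eq_norm, norm_sub_rev] at h1
    linarith [norm_sub_norm_le (g z)⁻¹ (g w)⁻¹]
  rw [norm_inv] at h3
  have h4 := inv_anti₀ (by positivity) h3
  rw [inv_inv] at h4
  refine h4.trans (le_of_eq ?_)
  field_simp

/-- A family of injective holomorphic functions whose time derivative is controlled by its space
derivative is locally bounded. -/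
theorem locallyBoundedFamily_of_injOn {U : Set ℂ} (hU : IsOpen U) {T K : ℝ}
    {F G : ℂ → ℝ → ℂ} (hol : ∀ t ∈ Ico 0 T, DifferentiableOn ℂ (fun z => F z t) U)
    (hinj : ∀ t ∈ Ico 0 T, InjOn (fun z => F z t) U)
    (hG : ∀ z ∈ U, ∀ t ∈ Ico 0 T, HasDerivWithinAt (fun u => F z u) (G z t) (Ico 0 T) t)
    (hK : 0 ≤ K)
    (hGK : ∀ z ∈ U, ∀ t ∈ Ico 0 T, ‖G z t‖ ≤ K * ‖deriv (fun x => F x t) z‖) :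
    LocallyBoundedFamily U (Ico 0 T) F := by
  intro z hz t ht
  obtain ⟨β, htβ, hβT⟩ := exists_between ht.2
  have hIS : Icc 0 β ⊆ Ico 0 T := fun x hx => ⟨hx.1, hx.2.trans_lt hβT⟩
  have htI : t ∈ Icc 0 β := ⟨ht.1, htβ.le⟩
  have hb : ∀ x ∈ U, ∃ C : ℝ, ∀ τ ∈ Icc 0 β, ‖F x τ‖ ≤ C := fun x hx =>
    isCompact_Icc.exists_bound_of_continuousOn
      fun τ hτ => (hG x hx τ (hIS hτ)).continuousWithinAt.mono hIS
  obtain ⟨a, ρ, hρ, haU, N, hN⟩ := exists_closedBall_forall_norm_le hU ⟨z, hz⟩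
    (fun τ hτ => (hol τ (hIS hτ)).continuousOn) hb
  have hτI : ∀ τ ∈ Ico 0 T, |τ - t| < β - t → τ ∈ Icc 0 β := fun τ hτ h =>
    ⟨hτ.1, by linarith [(abs_lt.1 h).2]⟩
  by_cases hza : z ∈ closedBall a (ρ / 2)
  · have hsub : ball z (min (ρ / 2) (β - t)) ⊆ closedBall a ρ := by
      intro x hx
      have := (mem_ball.1 hx).trans_le (min_le_left _ _)
      rw [mem_closedBall] at *
      linarith [dist_triangle x z a]
    exact ⟨_, lt_min (half_pos hρ) (sub_pos.2 htβ), N, hsub.trans haU, fun τ hτ h w hw =>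
      hN w (hsub hw) τ (hτI τ hτ (h.trans_le (min_le_right _ _)))⟩
  have haa : a ∈ closedBall a ρ := mem_closedBall_self hρ.le
  have hsubρ : closedBall a (ρ / 2) ⊆ U := (closedBall_subset_closedBall (by linarith)).trans haU
  have hN0 : 0 ≤ N := (norm_nonneg _).trans (hN a haa t htI)
  set L := K * (N / (ρ / 2)) with hL
  have hL0 : 0 ≤ L := by positivity
  have hlip : ∀ w ∈ closedBall a (ρ / 2), ∀ τ ∈ Icc 0 β, ‖F w τ - F w t‖ ≤ L * |τ - t| := by
    intro w hw τ hτ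
    have hwρ : closedBall w (ρ / 2) ⊆ closedBall a ρ := by
      intro x hx
      rw [mem_closedBall] at *
      linarith [dist_triangle x w a]
    refine (convex_Icc 0 β).norm_image_sub_le_of_norm_hasDerivWithin_le
      (f := fun u => F w u) (f' := fun u => G w u)
      (fun x hx => (hG w (hsubρ hw) x (hIS hx)).mono hIS) (fun x hx => ?_) htI hτ
    refine (hGK w (hsubρ hw) x (hIS hx)).trans (mul_le_mul_of_nonneg_left ?_ hK)
    refine Complex.norm_deriv_le_of_forall_mem_sphere_norm_le (half_pos hρ) ?_ ?_
    · refine DifferentiableOn.diffContOnCl ?_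
      rw [closure_ball w (half_pos hρ).ne']
      exact (hol x (hIS hx)).mono (hwρ.trans haU)
    · exact fun y hy => hN y (hwρ (sphere_subset_closedBall hy)) x hx
  obtain ⟨m, hm, hmle⟩ : ∃ m > 0, ∀ w ∈ sphere a (ρ / 2), m ≤ ‖F w t - F a t‖ := by
    have hcont : ContinuousOn (fun w => ‖F w t - F a t‖) (sphere a (ρ / 2)) :=
      (((hol t ht).continuousOn.mono (sphere_subset_closedBall.trans hsubρ)).sub
        continuousOn_const).norm
    obtain ⟨w₀, hw₀, hmin⟩ := (isCompact_sphere a (ρ / 2)).exists_isMinOn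
      (NormedSpace.sphere_nonempty.2 (half_pos hρ).le) hcont
    refine ⟨_, ?_, fun w hw => hmin hw⟩
    refine norm_pos_iff.2 (sub_ne_zero.2 fun h => ?_)
    have : w₀ = a := hinj t ht (hsubρ (sphere_subset_closedBall hw₀)) (haU haa) h
    rw [this, mem_sphere, dist_self] at hw₀
    linarith
  obtain ⟨r, hr, hrU⟩ := Metric.isOpen_iff.1 (hU.sdiff isClosed_closedBall) z ⟨hz, hza⟩
  obtain ⟨B, hB⟩ := hb z hz
  have hB0 : 0 ≤ B := (norm_nonneg _).trans (hB t htI)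
  set b := F a t with hbdef
  set B' := B + ‖b‖ + 1 with hB'
  have hB'0 : 0 < B' := by positivity
  refine ⟨min (min r (r * (m / 8) / (4 * B'))) (min (β - t) (m / 8 / (L + 1))),
    lt_min (lt_min hr (by positivity)) (lt_min (sub_pos.2 htβ) (by positivity)),
    2 * B' + ‖b‖, fun x hx => (hrU (ball_subset_ball
      ((min_le_left _ _).trans (min_le_left _ _)) hx)).1, ?_⟩
  intro τ hτ hτt w hw
  have hτβ : τ ∈ Icc 0 β := hτI τ hτ
    (hτt.trans_le ((min_le_right _ _).trans (min_le_left _ _)))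
  have hLτ : L * |τ - t| ≤ m / 8 := by
    have h1 : |τ - t| ≤ m / 8 / (L + 1) :=
      (hτt.trans_le ((min_le_right _ _).trans (min_le_right _ _))).le
    rw [le_div_iff₀ (by positivity)] at h1
    nlinarith [abs_nonneg (τ - t)]
  have ha' : ‖F a τ - b‖ ≤ m / 8 :=
    (hlip a (mem_closedBall_self (half_pos hρ).le) τ hτβ).trans hLτ
  have hsphere : ∀ x ∈ sphere a (ρ / 2), m / 2 ≤ ‖F x τ - F a τ‖ := by
    intro x hx
    have h1 := (hlip x (sphere_subset_closedBall hx) τ hτβ).trans hLτ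
    have h2 := hmle x hx
    have h3 : F x t - F a t = (F x τ - F a τ) - (F x τ - F x t) + (F a τ - b) := by
      rw [hbdef]; ring
    rw [h3] at h2
    linarith [norm_add_le ((F x τ - F a τ) - (F x τ - F x t)) (F a τ - b),
      norm_sub_le (F x τ - F a τ) (F x τ - F x t)]
  have hlow : ∀ x ∈ ball z r, m / 8 ≤ ‖F x τ - b‖ := by
    intro x hx
    have h1 := le_norm_sub_of_injOn (half_pos hρ) hsubρ (hol τ hτ) (hinj τ hτ) hsphere
      (hrU hx).1 (hrU hx).2
    have h2 := norm_sub_le (F x τ - b) (F a τ - b)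
    rw [sub_sub_sub_cancel_right] at h2
    linarith
  have := norm_le_of_le_norm (g := fun x => F x τ - b) hr (by positivity : 0 < m / 8) hB'0
    (((hol τ hτ).mono fun x hx => (hrU hx).1).sub_const b) hlow
    (by linarith [norm_sub_le (F z τ) b, hB τ hτβ])
    (ball_subset_ball (min_le_left _ _) hw)
  linarith [norm_sub_norm_le (F w τ) b]

/-- The radial retraction onto the closed ball of radius `ρ` is `2`-Lipschitz. -/
theorem norm_radial_retraction_sub_le {E : Type*} [NormedAddCommGroup E] [NormedSpace ℝ E]
    {ρ : ℝ} (hρ : 0 < ρ) (x y : E) :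
    ‖(ρ / max ρ ‖x‖) • x - (ρ / max ρ ‖y‖) • y‖ ≤ 2 * ‖x - y‖ := by
  set a := max ρ ‖x‖ with ha
  set b := max ρ ‖y‖ with hb
  have ha0 : 0 < a := hρ.trans_le (le_max_left _ _)
  have hb0 : 0 < b := hρ.trans_le (le_max_left _ _)
  have hab : |b - a| ≤ ‖x - y‖ := by
    rw [ha, hb, abs_sub_comm]
    have := abs_max_sub_max_le_abs ‖x‖ ‖y‖ ρ
    rw [max_comm ρ, max_comm ρ]
    exact this.trans (abs_norm_sub_norm_le x y)
  have h1 : (ρ / a) • x - (ρ / b) • y = (ρ / a) • (x - y) + ((ρ / a) * ((b - a) / b)) • y := by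
    rw [smul_sub, sub_add_eq_add_sub, sub_eq_sub_iff_add_eq_add, add_assoc]
    congr 1
    rw [← add_smul]
    congr 1
    field_simp
    ring
  have hρa : ρ / a ≤ 1 := (div_le_one ha0).2 (le_max_left _ _)
  have hρa0 : 0 ≤ ρ / a := by positivity
  have hy : ‖y‖ ≤ b := le_max_right _ _
  have h2 : ‖(ρ / a) • (x - y)‖ ≤ ‖x - y‖ := by
    rw [norm_smul, Real.norm_of_nonneg hρa0]
    exact mul_le_of_le_one_left (norm_nonneg _) hρa
  have h3 : ‖((ρ / a) * ((b - a) / b)) • y‖ ≤ ‖x - y‖ := by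
    rw [norm_smul, norm_mul, Real.norm_of_nonneg hρa0, norm_div, Real.norm_of_nonneg hb0.le,
      mul_assoc]
    refine (mul_le_of_le_one_left (by positivity) hρa).trans ?_
    rw [div_mul_eq_mul_div, div_le_iff₀ hb0]
    exact mul_le_mul hab hy (norm_nonneg _) (norm_nonneg _)
  rw [h1]
  linarith [norm_add_le ((ρ / a) • (x - y)) (((ρ / a) * ((b - a) / b)) • y)]

/-- Backward characteristics of the Löwner–Kufarev equation exist on short time intervals. -/
theorem exists_loewnerKufarev_characteristic {T M M' : ℝ} {p p' : ℂ → ℝ → ℂ}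
    (hp_re : ∀ t ∈ Ico 0 T, ∀ z ∈ ball (0:ℂ) 1, 0 < (p z t).re)
    (hp' : ∀ t ∈ Ico 0 T, ∀ z ∈ ball (0:ℂ) 1, HasDerivAt (fun x => p x t) (p' z t) z)
    (hp_t : ∀ z ∈ ball (0:ℂ) 1, ContinuousOn (fun t => p z t) (Ico 0 T))
    (hM : 0 ≤ M) (hM' : 0 ≤ M')
    (hp_bdd : ∀ z ∈ ball (0:ℂ) 1, ∀ t ∈ Ico 0 T, ‖p z t‖ ≤ M)
    (hp'_bdd : ∀ z ∈ ball (0:ℂ) 1, ∀ t ∈ Ico 0 T, ‖p' z t‖ ≤ M')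
    {z : ℂ} (hz : z ∈ ball (0:ℂ) 1) {t : ℝ} (ht : t ∈ Ico 0 T) (htM : 2 * M * t ≤ 1) :
    ∃ ζ : ℝ → ℂ, ζ t = z ∧ ∀ s ∈ Icc 0 t, ζ s ∈ ball (0:ℂ) 1 ∧
      HasDerivWithinAt ζ (ζ s * p (ζ s) s) (Icc 0 t) s := by
  have hz1 : ‖z‖ < 1 := by simpa using hz
  obtain ⟨ρ, hzρ, hρ1⟩ := exists_between hz1
  have hρ : 0 < ρ := (norm_nonneg z).trans_lt hzρ
  have hIS : Icc 0 t ⊆ Ico 0 T := fun x hx => ⟨hx.1, hx.2.trans_lt ht.2⟩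
  let π : ℂ → ℂ := fun x => (ρ / max ρ ‖x‖) • x
  have hπ_mem : ∀ x, π x ∈ ball (0:ℂ) 1 := by
    intro x
    have h0 : 0 < max ρ ‖x‖ := hρ.trans_le (le_max_left _ _)
    rw [mem_ball_zero_iff, norm_smul, Real.norm_of_nonneg (by positivity), div_mul_eq_mul_div,
      div_lt_one h0]
    calc ρ * ‖x‖ ≤ ρ * max ρ ‖x‖ := by gcongr; exact le_max_right _ _
      _ < 1 * max ρ ‖x‖ := by gcongr
      _ = _ := one_mul _
  have hlip : ∀ s ∈ Icc 0 t, ∀ x y, ‖p (π x) s - p (π y) s‖ ≤ M' * (2 * ‖x - y‖) := by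
    intro s hs x y
    have := (convex_ball (0:ℂ) 1).norm_image_sub_le_of_norm_hasDerivWithin_le
      (fun w hw => (hp' s (hIS hs) w hw).hasDerivWithinAt)
      (fun w hw => hp'_bdd w hw s (hIS hs)) (hπ_mem y) (hπ_mem x)
    refine this.trans ?_
    gcongr
    exact norm_radial_retraction_sub_le hρ x y
  have hnorm : ∀ x ∈ closedBall z 1, ‖x‖ ≤ 2 := by
    intro x hx
    rw [mem_closedBall, dist_eq_norm] at hx
    linarith [norm_sub_norm_le x z]
  have hPL : IsPicardLindelof (fun s x => x * p (π x) s) (⟨t, ht.1, le_rfl⟩ : Icc 0 t) z 1 0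
      ⟨2 * M, by positivity⟩ ⟨M + 4 * M', by positivity⟩ := by
    refine ⟨fun s hs => ?_, fun x _ => ?_, fun s hs x hx => ?_, ?_⟩
    · refine LipschitzOnWith.of_dist_le_mul fun x hx y hy => ?_
      simp only [dist_eq_norm]
      have h1 : x * p (π x) s - y * p (π y) s
          = (x - y) * p (π x) s + y * (p (π x) s - p (π y) s) := by ring
      have h2 : ‖(x - y) * p (π x) s‖ ≤ ‖x - y‖ * M := by
        rw [norm_mul]; gcongr; exact hp_bdd _ (hπ_mem x) s (hIS hs)
      have h3 : ‖y * (p (π x) s - p (π y) s)‖ ≤ 2 * (M' * (2 * ‖x - y‖)) := by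
        rw [norm_mul]
        exact mul_le_mul (hnorm y (by simpa using hy)) (hlip s hs x y) (norm_nonneg _) (by norm_num)
      rw [h1]
      have h4 := norm_add_le ((x - y) * p (π x) s) (y * (p (π x) s - p (π y) s))
      show _ ≤ (M + 4 * M') * ‖x - y‖
      linarith
    · exact continuousOn_const.mul ((hp_t _ (hπ_mem x)).mono hIS)
    · rw [norm_mul]
      exact mul_le_mul (hnorm x (by simpa using hx)) (hp_bdd _ (hπ_mem x) s (hIS hs))
        (norm_nonneg _) (by norm_num)
    · show 2 * M * max (t - t) (t - 0) ≤ 1 - 0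
      rw [max_eq_right (by linarith [ht.1])]
      simpa using htM
  obtain ⟨ζ, hζt, hζ⟩ := hPL.exists_eq_forall_mem_Icc_hasDerivWithinAt₀
  have hmono : MonotoneOn (fun s => ‖ζ s‖ ^ 2) (Icc 0 t) := by
    have hd : ∀ s ∈ Icc 0 t, HasDerivWithinAt (fun s => ‖ζ s‖ ^ 2)
        (2 * inner ℝ (ζ s) (ζ s * p (π (ζ s)) s)) (Icc 0 t) s := fun s hs => (hζ s hs).norm_sq
    refine monotoneOn_of_hasDerivWithinAt_nonneg (convex_Icc 0 t)
      (fun s hs => (hd s hs).continuousWithinAt)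
      (fun s hs => (hd s (interior_subset hs)).mono interior_subset) fun s hs => ?_
    have h1 := hp_re s (hIS (interior_subset hs)) _ (hπ_mem (ζ s))
    have h2 : inner ℝ (ζ s) (ζ s * p (π (ζ s)) s) = ‖ζ s‖ ^ 2 * (p (π (ζ s)) s).re := by
      rw [Complex.inner, mul_right_comm, Complex.mul_conj, Complex.re_ofReal_mul,
        Complex.normSq_eq_norm_sq]
    rw [h2]
    positivity
  have hζt' : ζ t = z := hζt
  have hle : ∀ s ∈ Icc 0 t, ‖ζ s‖ ≤ ‖z‖ := by
    intro s hs
    have := hmono hs ⟨ht.1, le_rfl⟩ hs.2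
    simp only [hζt'] at this
    exact le_of_sq_le_sq this (norm_nonneg _)
  refine ⟨ζ, hζt', fun s hs => ⟨by simpa using (hle s hs).trans_lt hz1, ?_⟩⟩
  have hπ : π (ζ s) = ζ s := by
    simp only [π]
    rw [max_eq_left ((hle s hs).trans hzρ.le), div_self hρ.ne', one_smul]
  simpa only [hπ] using hζ s hs

/-- Solutions of `‖u'‖ ≤ A ‖u‖ + B` move by at most a multiple of the elapsed time. -/
theorem exists_norm_sub_le_of_norm_deriv_le (δ A B : ℝ) (hδ : 0 ≤ δ) (hA : 0 ≤ A) (hB : 0 ≤ B) :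
    ∃ R ≥ (0:ℝ), ∀ t ∈ Icc (0:ℝ) 1, ∀ u u' : ℝ → ℂ, ‖u 0‖ ≤ δ →
      (∀ s ∈ Icc 0 t, HasDerivWithinAt u (u' s) (Icc 0 t) s) →
      (∀ s ∈ Icc 0 t, ‖u' s‖ ≤ A * ‖u s‖ + B) →
      ∀ s ∈ Icc 0 t, ‖u s‖ ≤ R ∧ ‖u s - u 0‖ ≤ R * s := by
  set R₀ := gronwallBound δ A B 1 with hR₀
  have hmono := gronwallBound_mono hδ hB hA
  have hR₀0 : 0 ≤ R₀ := by
    have := hmono (zero_le_one (α := ℝ))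
    rw [gronwallBound_x0] at this
    exact hδ.trans this
  refine ⟨max R₀ (A * R₀ + B), le_max_of_le_left hR₀0, fun t ht u u' h0 hu hb => ?_⟩
  have h1 : ∀ s ∈ Icc 0 t, ‖u s‖ ≤ R₀ := by
    intro s hs
    refine (norm_le_gronwallBound_of_norm_deriv_right_le
      (fun x hx => (hu x hx).continuousWithinAt)
      (fun x hx => (hu x (Ico_subset_Icc_self hx)).mono_of_mem_nhdsWithin
        (Icc_mem_nhdsGE_of_mem hx)) h0
      (fun x hx => hb x (Ico_subset_Icc_self hx)) s hs).trans ?_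
    exact hmono (by linarith [hs.2, ht.2])
  intro s hs
  refine ⟨(h1 s hs).trans (le_max_left _ _), ?_⟩
  have := norm_image_sub_le_of_norm_deriv_le_segment' hu (C := A * R₀ + B)
    (fun x hx => (hb x (Ico_subset_Icc_self hx)).trans (by
      gcongr; exact h1 x (Ico_subset_Icc_self hx))) s hs
  rw [sub_zero] at this
  exact this.trans (mul_le_mul_of_nonneg_right (le_max_right _ _) hs.1)

end

/- STATEMENT 12: Under C² hypotheses on the Carathéodory driving function `p`
(with `p`, `p'`, `p''` bounded), there are constants c₅, c₆ > 0 and t₀ > 0 such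
that for 0 < t < t₀ and z ∈ 𝔻:
`1 - c₅·t < Re(z·f'(z,t)/f(z,t)) < 1 + c₅·t` and
`|Re(z·f''(z,t)/f'(z,t))| < c₆·t`; moreover f' is bounded on 𝔻 × [0,t₀]. -/
theorem loewner_kufarev_ratio_estimates
    (T : ℝ) (hT : 0 < T) (p p' p'' : ℂ → ℝ → ℂ)
    -- Carathéodory class driving function
    (hp_hol : ∀ t ∈ Set.Ico (0:ℝ) T,
      DifferentiableOn ℂ (fun z => p z t) (Metric.ball (0:ℂ) 1))
    (hp_cont : ∀ t ∈ Set.Ico (0:ℝ) T,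
      ContinuousOn (fun z => p z t) (Metric.closedBall (0:ℂ) 1))
    (hp_one : ∀ t ∈ Set.Ico (0:ℝ) T, p 0 t = 1)
    (hp_re : ∀ t ∈ Set.Ico (0:ℝ) T, ∀ z ∈ Metric.ball (0:ℂ) 1, 0 < (p z t).re)
    -- p(·,t) is C² on 𝔻̄, continuous in t, with p, p', p'' bounded
    (hp' : ∀ t ∈ Set.Ico (0:ℝ) T, ∀ z ∈ Metric.ball (0:ℂ) 1,
      HasDerivAt (fun x => p x t) (p' z t) z)
    (hp'' : ∀ t ∈ Set.Ico (0:ℝ) T, ∀ z ∈ Metric.ball (0:ℂ) 1,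
      HasDerivAt (fun x => p' x t) (p'' z t) z)
    (hp'_cont : ∀ t ∈ Set.Ico (0:ℝ) T,
      ContinuousOn (fun z => p' z t) (Metric.closedBall (0:ℂ) 1))
    (hp''_cont : ∀ t ∈ Set.Ico (0:ℝ) T,
      ContinuousOn (fun z => p'' z t) (Metric.closedBall (0:ℂ) 1))
    (hp_t : ∀ z ∈ Metric.closedBall (0:ℂ) 1, ContinuousOn (fun t => p z t) (Set.Ico 0 T))
    (M M' M'' : ℝ)
    (hp_bdd : ∀ z ∈ Metric.closedBall (0:ℂ) 1, ∀ t ∈ Set.Ico (0:ℝ) T, ‖p z t‖ ≤ M)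
    (hp'_bdd : ∀ z ∈ Metric.closedBall (0:ℂ) 1, ∀ t ∈ Set.Ico (0:ℝ) T, ‖p' z t‖ ≤ M')
    (hp''_bdd : ∀ z ∈ Metric.closedBall (0:ℂ) 1, ∀ t ∈ Set.Ico (0:ℝ) T, ‖p'' z t‖ ≤ M'')
    -- f solves the Löwner–Kufarev PDE, with spatial derivatives fz, fzz,
    -- f(z,0) = z, each f(·,t) univalent on 𝔻
    (f fz fzz : ℂ → ℝ → ℂ)
    (hf_init : ∀ z ∈ Metric.ball (0:ℂ) 1, f z 0 = z)
    (hf_hol : ∀ t ∈ Set.Ico (0:ℝ) T,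
      DifferentiableOn ℂ (fun z => f z t) (Metric.ball (0:ℂ) 1))
    (hf_inj : ∀ t ∈ Set.Ico (0:ℝ) T,
      Set.InjOn (fun z => f z t) (Metric.ball (0:ℂ) 1))
    (hfz : ∀ t ∈ Set.Ico (0:ℝ) T, ∀ z ∈ Metric.ball (0:ℂ) 1,
      HasDerivAt (fun x => f x t) (fz z t) z)
    (hfzz : ∀ t ∈ Set.Ico (0:ℝ) T, ∀ z ∈ Metric.ball (0:ℂ) 1,
      HasDerivAt (fun x => fz x t) (fzz z t) z)
    (hf_pde : ∀ z ∈ Metric.ball (0:ℂ) 1, ∀ t ∈ Set.Ico (0:ℝ) T,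
      HasDerivWithinAt (fun u => f z u) (-(z * fz z t * p z t)) (Set.Ico 0 T) t) :
    ∃ c₅ > (0:ℝ), ∃ c₆ > (0:ℝ), ∃ t₀ > (0:ℝ), t₀ ≤ T ∧
      (∀ t, 0 < t → t < t₀ → ∀ z ∈ Metric.ball (0:ℂ) 1, z ≠ 0 →
        (1 - c₅ * t < (z * fz z t / f z t).re ∧
         (z * fz z t / f z t).re < 1 + c₅ * t ∧
         |(z * fzz z t / fz z t).re| < c₆ * t)) ∧
      ∃ C : ℝ, ∀ z ∈ Metric.ball (0:ℂ) 1, ∀ t, 0 ≤ t → t < t₀ →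
        ‖fz z t‖ ≤ C := by
  have hsub : Metric.ball (0:ℂ) 1 ⊆ Metric.closedBall 0 1 := Metric.ball_subset_closedBall
  have h0T : (0:ℝ) ∈ Set.Ico (0:ℝ) T := ⟨le_rfl, hT⟩
  have h0b : (0:ℂ) ∈ Metric.ball (0:ℂ) 1 := Metric.mem_ball_self one_pos
  have hM : 0 < M := by
    have := hp_bdd 0 (hsub h0b) 0 h0T
    rw [hp_one 0 h0T, norm_one] at this
    linarith
  have hM' : 0 ≤ M' := (norm_nonneg _).trans (hp'_bdd 0 (hsub h0b) 0 h0T)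
  have hM'' : 0 ≤ M'' := (norm_nonneg _).trans (hp''_bdd 0 (hsub h0b) 0 h0T)
  have hUo : IsOpen (Metric.ball (0:ℂ) 1) := Metric.isOpen_ball
  have hnorm : ∀ z ∈ Metric.ball (0:ℂ) 1, ‖z‖ ≤ 1 := fun z hz => by
    simpa using hsub hz
  have hfz_eq : ∀ z ∈ Metric.ball (0:ℂ) 1, ∀ t ∈ Set.Ico (0:ℝ) T,
      deriv (fun x => f x t) z = fz z t := fun z hz t ht => (hfz t ht z hz).deriv
  have hfzz_eq : ∀ z ∈ Metric.ball (0:ℂ) 1, ∀ t ∈ Set.Ico (0:ℝ) T,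
      deriv (fun x => deriv (fun y => f y t) x) z = fzz z t := fun z hz t ht => by
    refine ((hfzz t ht z hz).congr_of_eventuallyEq ?_).deriv
    filter_upwards [hUo.mem_nhds hz] with x hx using hfz_eq x hx t ht
  -- the first and second space derivatives of the right-hand side of the equation
  have hG1 : ∀ z ∈ Metric.ball (0:ℂ) 1, ∀ t ∈ Set.Ico (0:ℝ) T,
      HasDerivAt (fun x => -(x * fz x t * p x t))
        (-((fz z t + z * fzz z t) * p z t + z * fz z t * p' z t)) z := fun z hz t ht => by
    have := (((hasDerivAt_id z).mul (hfzz t ht z hz)).mul (hp' t ht z hz)).neg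
    simpa using! this
  have hfzz_hol : ∀ z ∈ Metric.ball (0:ℂ) 1, ∀ t ∈ Set.Ico (0:ℝ) T,
      DifferentiableAt ℂ (fun x => fzz x t) z := fun z hz t ht => by
    have h1 : DifferentiableOn ℂ (fun x => fz x t) (Metric.ball (0:ℂ) 1) := fun x hx =>
      (hfzz t ht x hx).differentiableAt.differentiableWithinAt
    refine ((h1.deriv hUo).congr fun x hx => ?_).differentiableAt (hUo.mem_nhds hz)
    exact (hfzz t ht x hx).deriv.symm
  have hG2 : ∀ z ∈ Metric.ball (0:ℂ) 1, ∀ t ∈ Set.Ico (0:ℝ) T,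
      deriv (fun x => deriv (fun y => -(y * fz y t * p y t)) x) z =
        -((2 * fzz z t + z * deriv (fun x => fzz x t) z) * p z t
          + 2 * (fz z t + z * fzz z t) * p' z t + z * fz z t * p'' z t) := fun z hz t ht => by
    have h1 := ((((hfzz t ht z hz).add ((hasDerivAt_id z).mul (hfzz_hol z hz t ht).hasDerivAt)).mul
      (hp' t ht z hz)).add
      (((hasDerivAt_id z).mul (hfzz t ht z hz)).mul (hp'' t ht z hz))).neg
    refine (h1.congr_of_eventuallyEq ?_).deriv.trans ?_
    · filter_upwards [hUo.mem_nhds hz] with x hx using (hG1 x hx t ht).deriv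
    · simp only [id, Pi.add_apply, Pi.mul_apply]
      ring
  -- `f`, `f'` and `f''` may be differentiated in time
  have hf_bdd : LocallyBoundedFamily (Metric.ball (0:ℂ) 1) (Set.Ico 0 T) f := by
    refine locallyBoundedFamily_of_injOn hUo hf_hol hf_inj hf_pde hM.le fun z hz t ht => ?_
    rw [hfz_eq z hz t ht, norm_neg, norm_mul, norm_mul, mul_comm]
    refine mul_le_mul (hp_bdd z (hsub hz) t ht) ?_ (by positivity) hM.le
    exact mul_le_of_le_one_left (norm_nonneg _) (hnorm z hz)
  have hev0 : HolomorphicEvolution (Metric.ball (0:ℂ) 1) (Set.Ico 0 T) f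
      (fun z t => -(z * fz z t * p z t)) := by
    refine ⟨hf_hol, fun t ht z hz => (hG1 z hz t ht).differentiableAt.differentiableWithinAt,
      hf_bdd, ?_, hf_pde⟩
    have h1 : LocallyBoundedFamily (Metric.ball (0:ℂ) 1) (Set.Ico 0 T) fz :=
      (hf_bdd.deriv hf_hol).congr hfz_eq
    have h2 : LocallyBoundedFamily (Metric.ball (0:ℂ) 1) (Set.Ico 0 T) (fun z _ => z) :=
      .of_bound hUo fun z hz _ _ => hnorm z hz
    have h3 : LocallyBoundedFamily (Metric.ball (0:ℂ) 1) (Set.Ico 0 T) p :=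
      .of_bound hUo fun z hz t ht => hp_bdd z (hsub hz) t ht
    exact ((h2.mul h1).mul h3).neg
  have hev1 := hev0.deriv hUo (convex_Ico 0 T)
  have hev2 := hev1.deriv hUo (convex_Ico 0 T)
  -- the initial values of the derivatives
  have hfz0 : ∀ z ∈ Metric.ball (0:ℂ) 1, fz z 0 = 1 := fun z hz => by
    refine (hfz 0 h0T z hz).unique ((hasDerivAt_id z).congr_of_eventuallyEq ?_)
    filter_upwards [hUo.mem_nhds hz] with x hx using hf_init x hx
  have hfzz0 : ∀ z ∈ Metric.ball (0:ℂ) 1, fzz z 0 = 0 := fun z hz => by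
    refine (hfzz 0 h0T z hz).unique ((hasDerivAt_const z (1:ℂ)).congr_of_eventuallyEq ?_)
    filter_upwards [hUo.mem_nhds hz] with x hx using hfz0 x hx
  have hf_zero : ∀ t ∈ Set.Ico (0:ℝ) T, f 0 t = 0 := fun t ht => by
    have := (convex_Ico 0 T).norm_image_sub_le_of_norm_hasDerivWithin_le (C := 0)
      (fun x hx => hf_pde 0 h0b x hx) (fun x _ => by simp) h0T ht
    rw [zero_mul, hf_init 0 h0b, sub_zero] at this
    simpa using this
  -- the constants
  obtain ⟨R₁, hR₁, H₁⟩ := exists_norm_sub_le_of_norm_deriv_le 1 (M + M') 0 zero_le_one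
    (by positivity) le_rfl
  obtain ⟨R₂, hR₂, H₂⟩ := exists_norm_sub_le_of_norm_deriv_le 0 (2 * (M + M'))
    ((2 * M' + M'') * R₁) le_rfl (by positivity) (by positivity)
  obtain ⟨R₃, hR₃, H₃⟩ := exists_norm_sub_le_of_norm_deriv_le 1 M' 0 zero_le_one hM' le_rfl
  set t₀ : ℝ := min (min T 1) (min (1 / (2 * M)) (1 / (2 * (R₁ + 1)))) with ht₀
  have ht₀T : t₀ ≤ T := (min_le_left _ _).trans (min_le_left _ _)
  have ht₀1 : t₀ ≤ 1 := (min_le_left _ _).trans (min_le_right _ _)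
  have ht₀M : t₀ ≤ 1 / (2 * M) := (min_le_right _ _).trans (min_le_left _ _)
  have ht₀R : t₀ ≤ 1 / (2 * (R₁ + 1)) := (min_le_right _ _).trans (min_le_right _ _)
  have ht₀pos : 0 < t₀ := by positivity
  have key : ∀ t, 0 ≤ t → t < t₀ → ∀ z ∈ Metric.ball (0:ℂ) 1,
      ‖fz z t‖ ≤ R₁ ∧ 1 / 2 ≤ ‖fz z t‖ ∧ ‖fzz z t‖ ≤ R₂ * t ∧
        (z ≠ 0 → ‖z * fz z t / f z t - 1‖ ≤ R₃ * t) := by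
    intro t ht0 htt₀ z hz
    have htT : t ∈ Set.Ico (0:ℝ) T := ⟨ht0, htt₀.trans_le ht₀T⟩
    have ht1 : t ∈ Set.Icc (0:ℝ) 1 := ⟨ht0, htt₀.le.trans ht₀1⟩
    have htM : 2 * M * t ≤ 1 := by
      have := htt₀.le.trans ht₀M
      rw [le_div_iff₀ (by positivity)] at this
      linarith
    have htR : R₁ * t ≤ 1 / 2 := by
      have := htt₀.le.trans ht₀R
      rw [le_div_iff₀ (by positivity)] at this
      linarith
    have h0t : (0:ℝ) ∈ Set.Icc 0 t := ⟨le_rfl, ht0⟩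
    have htt : t ∈ Set.Icc 0 t := ⟨ht0, le_rfl⟩
    have hIS : Set.Icc 0 t ⊆ Set.Ico 0 T := fun x hx => ⟨hx.1, hx.2.trans_lt htT.2⟩
    obtain ⟨ζ, hζt, hζ⟩ := exists_loewnerKufarev_characteristic hp_re hp'
      (fun x hx => hp_t x (hsub hx)) hM.le hM' (fun x hx => hp_bdd x (hsub hx))
      (fun x hx => hp'_bdd x (hsub hx)) hz htT htM
    have hu : ∀ s ∈ Set.Icc 0 t, HasDerivWithinAt (fun s => f (ζ s) s) 0 (Set.Icc 0 t) s := by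
      intro s hs
      have := hev0.hasDerivWithinAt_comp hUo (convex_Ico 0 T) hIS hs (hζ s hs).1 (hζ s hs).2
      convert! this using 1
      rw [hfz_eq _ (hζ s hs).1 s (hIS hs)]
      ring
    have hq : ∀ s ∈ Set.Icc 0 t, HasDerivWithinAt (fun s => fz (ζ s) s)
        (-(p (ζ s) s + ζ s * p' (ζ s) s) * fz (ζ s) s) (Set.Icc 0 t) s := by
      intro s hs
      have := hev1.hasDerivWithinAt_comp hUo (convex_Ico 0 T) hIS hs (hζ s hs).1 (hζ s hs).2
      refine (this.congr_of_mem (fun x hx => (hfz_eq _ (hζ x hx).1 x (hIS hx)).symm) hs).congr_deriv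
        ?_
      rw [hfzz_eq _ (hζ s hs).1 s (hIS hs), (hG1 _ (hζ s hs).1 s (hIS hs)).deriv]
      ring
    have hr : ∀ s ∈ Set.Icc 0 t, HasDerivWithinAt (fun s => fzz (ζ s) s)
        (-(2 * p' (ζ s) s + ζ s * p'' (ζ s) s) * fz (ζ s) s
          - 2 * (p (ζ s) s + ζ s * p' (ζ s) s) * fzz (ζ s) s) (Set.Icc 0 t) s := by
      intro s hs
      have := hev2.hasDerivWithinAt_comp hUo (convex_Ico 0 T) hIS hs (hζ s hs).1 (hζ s hs).2
      refine (this.congr_of_mem (fun x hx => (hfzz_eq _ (hζ x hx).1 x (hIS hx)).symm)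
        hs).congr_deriv ?_
      have h3 : deriv (fun x => deriv (fun x => deriv (fun x => f x s) x) x) (ζ s)
          = deriv (fun x => fzz x s) (ζ s) := by
        refine Filter.EventuallyEq.deriv_eq ?_
        filter_upwards [hUo.mem_nhds (hζ s hs).1] with x hx using hfzz_eq x hx s (hIS hs)
      rw [h3, hG2 _ (hζ s hs).1 s (hIS hs)]
      ring
    have hcoef : ∀ s ∈ Set.Icc 0 t, ‖p (ζ s) s + ζ s * p' (ζ s) s‖ ≤ M + M' := by
      intro s hs
      refine (norm_add_le _ _).trans (add_le_add (hp_bdd _ (hsub (hζ s hs).1) s (hIS hs)) ?_)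
      rw [norm_mul]
      exact (mul_le_of_le_one_left (norm_nonneg _) (hnorm _ (hζ s hs).1)).trans
        (hp'_bdd _ (hsub (hζ s hs).1) s (hIS hs))
    have hcoef2 : ∀ s ∈ Set.Icc 0 t, ‖2 * p' (ζ s) s + ζ s * p'' (ζ s) s‖ ≤ 2 * M' + M'' := by
      intro s hs
      refine (norm_add_le _ _).trans (add_le_add ?_ ?_)
      · rw [norm_mul, Complex.norm_ofNat]
        gcongr
        exact hp'_bdd _ (hsub (hζ s hs).1) s (hIS hs)
      · rw [norm_mul]
        exact (mul_le_of_le_one_left (norm_nonneg _) (hnorm _ (hζ s hs).1)).trans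
          (hp''_bdd _ (hsub (hζ s hs).1) s (hIS hs))
    have hq0 : fz (ζ 0) 0 = 1 := hfz0 _ (hζ 0 h0t).1
    have hr0 : fzz (ζ 0) 0 = 0 := hfzz0 _ (hζ 0 h0t).1
    have E₁ := H₁ t ht1 (fun s => fz (ζ s) s) _ (by simp [hq0]) hq (fun s hs => by
      rw [norm_mul, norm_neg, add_zero]
      gcongr
      exact hcoef s hs)
    have E₂ := H₂ t ht1 (fun s => fzz (ζ s) s) _ (by simp [hr0]) hr (fun s hs => by
      refine (norm_sub_le _ _).trans ?_
      rw [norm_mul, norm_mul, norm_mul, norm_neg, Complex.norm_ofNat, add_comm]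
      have h1 := hcoef s hs
      have h2 := hcoef2 s hs
      have h3 := (E₁ s hs).1
      gcongr)
    have e₁ := E₁ t htt
    have e₂ := E₂ t htt
    simp only [hζt, hq0, hr0, sub_zero] at e₁ e₂
    refine ⟨e₁.1, ?_, e₂.2, fun hz0 => ?_⟩
    · have := norm_sub_norm_le (1:ℂ) (fz z t)
      rw [norm_one, norm_sub_rev] at this
      linarith [e₁.2]
    have hfζ : f z t = ζ 0 := by
      have := (convex_Icc 0 t).norm_image_sub_le_of_norm_hasDerivWithin_le (C := 0)
        hu (fun x _ => by simp) h0t htt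
      rw [zero_mul, hζt, hf_init _ (hζ 0 h0t).1] at this
      exact sub_eq_zero.1 (norm_le_zero_iff.1 this)
    have hζ0 : ζ 0 ≠ 0 := by
      rw [← hfζ]
      intro h
      exact hz0 (hf_inj t htT hz h0b (h.trans (hf_zero t htT).symm))
    have hh : ∀ s ∈ Set.Icc 0 t, HasDerivWithinAt (fun s => ζ s * fz (ζ s) s / ζ 0)
        (-(ζ s * p' (ζ s) s) * (ζ s * fz (ζ s) s / ζ 0)) (Set.Icc 0 t) s := by
      intro s hs
      refine (((hζ s hs).2.mul (hq s hs)).div_const (ζ 0)).congr_deriv ?_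
      ring
    have e₃ := (H₃ t ht1 (fun s => ζ s * fz (ζ s) s / ζ 0) _ (by simp [hq0, hζ0]) hh (fun s hs => by
      rw [norm_mul, norm_neg, norm_mul, add_zero]
      gcongr
      exact (mul_le_of_le_one_left (norm_nonneg _) (hnorm _ (hζ s hs).1)).trans
        (hp'_bdd _ (hsub (hζ s hs).1) s (hIS hs))) t htt).2
    simp only [hζt, hq0, mul_one, div_self hζ0] at e₃
    rwa [hfζ]
  refine ⟨R₃ + 1, by positivity, 2 * R₂ + 1, by positivity, t₀, ht₀pos, ht₀T, ?_,
    R₁, fun z hz t ht htt₀ => (key t ht htt₀ z hz).1⟩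
  intro t ht htt₀ z hz hz0
  obtain ⟨-, h2, h3, h4⟩ := key t ht.le htt₀ z hz
  have h5 := (Complex.abs_re_le_norm _).trans (h4 hz0)
  rw [Complex.sub_re, Complex.one_re, abs_le] at h5
  refine ⟨by linarith [h5.1], by linarith [h5.2], ?_⟩
  refine (Complex.abs_re_le_norm _).trans_lt ?_
  rw [norm_div, norm_mul, div_lt_iff₀ (by linarith)]
  calc ‖z‖ * ‖fzz z t‖ ≤ 1 * (R₂ * t) :=
        mul_le_mul (hnorm z hz) h3 (norm_nonneg _) zero_le_one
    _ < (2 * R₂ + 1) * t * (1 / 2) := by linarith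
    _ ≤ (2 * R₂ + 1) * t * ‖fz z t‖ := by gcongr
end

section
/- (Lemma 6) Let p be a driving function from the Carathéodory class, C² on 𝔻̄ for each t, continuous in t, with p, p' = ∂p/∂z, p'' = ∂²p/∂z² bounded on 𝔻̄ × [0,T). Let f(z,t) solve the Löwner–Kufarev PDE ∂f/∂t = -z·(∂f/∂z)·p(z,t), f(z,0) = z, each f(·,t) univalent on 𝔻, with f, f' = ∂f/∂z, f'' = ∂²f/∂z² extended continuously to 𝔻̄. Suppose for a given small t > 0 the boundary curve Γ(t) = f(∂𝔻,t) has polar equation r = 1 - δ_t(ψ): there are functions ψ_t, δ_t with f(e^{iφ},t) = (1 - δ_t(ψ_t(φ)))·e^{iψ_t(φ)}, where ψ_t(φ) = arg f(e^{iφ},t) (continuous increasing branch) and δ_t is twice differentiable. Then there exist c₄ > 0 and t₀ > 0 such that for all 0 < t < t₀ and all ψ, |δ_t''(ψ)| < c₄·t. -/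
open Filter Topology in
/-- The derivative of an injective holomorphic function does not vanish. -/
theorem deriv_ne_zero_of_injOn {f : ℂ → ℂ} {U : Set ℂ} (hU : IsOpen U)
    (hf : DifferentiableOn ℂ f U) (hinj : Set.InjOn f U) {z : ℂ} (hz : z ∈ U) :
    deriv f z ≠ 0 := by
  have hnc : ∀ x ∈ U, ¬ ∀ᶠ y in 𝓝 x, f y = f x := by
    intro x hx h
    have h1 : ∀ᶠ y in 𝓝[≠] x, f y = f x ∧ y ∈ U ∧ y ≠ x := by
      filter_upwards [mem_nhdsWithin_of_mem_nhds h,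
        mem_nhdsWithin_of_mem_nhds (hU.mem_nhds hx), self_mem_nhdsWithin] with y h1 h2 h3
      exact ⟨h1, h2, h3⟩
    obtain ⟨y, h2, h3, h4⟩ := h1.exists
    exact h4 (hinj h3 hx h2)
  have hopen : ∀ x ∈ U, 𝓝 (f x) ≤ map f (𝓝 x) := fun x hx =>
    ((hf.analyticAt (hU.mem_nhds hx)).eventually_constant_or_nhds_le_map_nhds).resolve_left
      (hnc x hx)
  set g := Function.invFunOn f U with hg
  have hgf : ∀ x ∈ U, g (f x) = x := fun x hx => hinj.leftInvOn_invFunOn hx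
  have hgc : ∀ x ∈ U, ContinuousAt g (f x) := by
    intro x hx
    have h1 : Tendsto (g ∘ f) (𝓝 x) (𝓝 x) :=
      tendsto_id.congr' (by
        filter_upwards [hU.mem_nhds hx] with y hy
        exact (hgf y hy).symm)
    rw [ContinuousAt, hgf x hx]
    exact (tendsto_map'_iff.2 h1).mono_left (hopen x hx)
  have hfg : ∀ x ∈ U, ∀ᶠ v in 𝓝 (f x), g v ∈ U ∧ f (g v) = v := by
    intro x hx
    refine hopen x hx (eventually_map.2 ?_)
    filter_upwards [hU.mem_nhds hx] with y hy
    simp [hgf y hy, hy]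
  have hgd : ∀ x ∈ U, deriv f x ≠ 0 → DifferentiableAt ℂ g (f x) := by
    intro x hx hne
    refine (HasDerivAt.of_local_left_inverse (f := f) (f' := deriv f x) (hgc x hx) ?_ hne
      ((hfg x hx).mono fun v hv => hv.2)).differentiableAt
    rw [hgf x hx]
    exact (hf.differentiableAt (hU.mem_nhds hx)).hasDerivAt
  have hcrit : ∀ᶠ x in 𝓝[≠] z, deriv f x ≠ 0 := by
    refine ((hf.analyticAt (hU.mem_nhds hz)).deriv.eventually_eq_zero_or_eventually_ne_zero
      ).resolve_left fun h => hnc z hz ?_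
    obtain ⟨ε, hε, hball⟩ := Metric.eventually_nhds_iff_ball.1 (h.and (hU.mem_nhds hz))
    filter_upwards [Metric.ball_mem_nhds z hε] with y hy
    refine Metric.isOpen_ball.is_const_of_deriv_eq_zero (convex_ball z ε).isPreconnected
      (hf.mono fun w hw => (hball w hw).2) (fun w hw => (hball w hw).1) hy
      (Metric.mem_ball_self hε)
  have hgp : ∀ᶠ v in 𝓝[≠] (f z), DifferentiableAt ℂ g v := by
    have h1 : Tendsto g (𝓝[≠] (f z)) (𝓝[≠] z) := by
      refine tendsto_nhdsWithin_iff.2 ⟨?_, ?_⟩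
      · have := (hgc z hz).tendsto
        rw [hgf z hz] at this
        exact this.mono_left nhdsWithin_le_nhds
      · filter_upwards [mem_nhdsWithin_of_mem_nhds (hfg z hz), self_mem_nhdsWithin] with v hv hne h
        exact hne (by rw [← hv.2, Set.mem_singleton_iff.1 h]; rfl)
    filter_upwards [h1.eventually hcrit, mem_nhdsWithin_of_mem_nhds (hfg z hz)] with v hv hv'
    have := hgd _ hv'.1 hv
    rwa [hv'.2] at this
  have hga := (Complex.analyticAt_of_differentiable_on_punctured_nhds_of_continuousAt hgp
    (hgc z hz)).differentiableAt
  have hcomp := hga.hasDerivAt.comp z (hf.differentiableAt (hU.mem_nhds hz)).hasDerivAt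
  have hid : HasDerivAt (g ∘ f) 1 z := (hasDerivAt_id z).congr_of_eventuallyEq (by
    filter_upwards [hU.mem_nhds hz] with y hy
    exact hgf y hy)
  intro h
  have := hcomp.unique hid
  rw [h, mul_zero] at this
  exact zero_ne_one this

open Metric in
/-- A nonvanishing holomorphic function on a disk has a holomorphic logarithm. -/
theorem exists_differentiableOn_exp_eq {q : ℂ → ℂ} (hq : DifferentiableOn ℂ q (ball 0 1))
    (hq0 : ∀ z ∈ ball (0 : ℂ) 1, q z ≠ 0) :
    ∃ L : ℂ → ℂ, DifferentiableOn ℂ L (ball 0 1) ∧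
      ∀ z ∈ ball (0 : ℂ) 1, Complex.exp (L z) = q z := by
  have hdq : DifferentiableOn ℂ (fun z => deriv q z / q z) (ball 0 1) :=
    (hq.deriv isOpen_ball).div hq hq0
  obtain ⟨L, hL0, hL⟩ := hdq.isExactOn_ball.with_val_at 0 (Complex.log (q 0))
  have hLd : DifferentiableOn ℂ L (ball 0 1) :=
    fun z hz => (hL z hz).differentiableAt.differentiableWithinAt
  refine ⟨L, hLd, fun z hz => ?_⟩
  have hder : ∀ x ∈ ball (0 : ℂ) 1,
      HasDerivAt (fun y => Complex.exp (-L y) * q y) 0 x := by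
    intro x hx
    have h1 := ((hL x hx).neg.cexp).mul (hq.differentiableAt (isOpen_ball.mem_nhds hx)).hasDerivAt
    refine h1.congr_deriv ?_
    have := hq0 x hx
    field_simp
    ring
  have hconst := (convex_ball (0 : ℂ) 1).is_const_of_fderivWithin_eq_zero (𝕜 := ℂ)
    (f := fun y => Complex.exp (-L y) * q y)
    (fun x hx => (hder x hx).differentiableAt.differentiableWithinAt)
    (fun x hx => by
      rw [fderivWithin_of_isOpen isOpen_ball hx]
      ext
      simp [(hder x hx).deriv]) hz (mem_ball_self one_pos)
  simp only [hL0] at hconst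
  rw [Complex.exp_neg, Complex.exp_neg, Complex.exp_log (hq0 0 (mem_ball_self one_pos)),
    inv_mul_cancel₀ (hq0 0 (mem_ball_self one_pos)),
    inv_mul_eq_one₀ (Complex.exp_ne_zero _)] at hconst
  exact hconst

open Metric in
/-- Harnack-type inequality for holomorphic functions whose modulus is bounded below. -/
theorem norm_le_of_forall_le_norm {q : ℂ → ℂ} (hq : DifferentiableOn ℂ q (ball 0 1))
    {k : ℝ} (hk : 0 < k) (hkq : ∀ z ∈ ball (0 : ℂ) 1, k ≤ ‖q z‖) {z₀ : ℂ} (hz₀ : ‖z₀‖ = 1 / 4)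
    (hqz₀ : ‖q z₀‖ = 8 * k) {R : ℝ} (hR : R < 1) {z : ℂ} (hz : ‖z‖ ≤ R) :
    ‖q z‖ ≤ k * Real.exp (2 * Real.log 8 + 4 * Real.log 8 * R / (1 - R)) := by
  have hq0 : ∀ z ∈ ball (0 : ℂ) 1, q z ≠ 0 := fun z hz h => by
    have := hkq z hz
    rw [h, norm_zero] at this
    linarith
  obtain ⟨L, hL, hexp⟩ := exists_differentiableOn_exp_eq hq hq0
  have hre : ∀ z ∈ ball (0 : ℂ) 1, Real.exp (L z).re = ‖q z‖ := fun z hz => by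
    rw [← hexp z hz, Complex.norm_exp]
  have hlow : ∀ z ∈ ball (0 : ℂ) 1, Real.log k ≤ (L z).re := fun z hz => by
    rw [Real.log_le_iff_le_exp hk, hre z hz]
    exact hkq z hz
  have hz₀b : z₀ ∈ ball (0 : ℂ) 1 := by
    rw [mem_ball_zero_iff, hz₀]; norm_num
  have h8 : 0 < Real.log 8 := Real.log_pos (by norm_num)
  have hz₀re : (L z₀).re = Real.log 8 + Real.log k := by
    rw [← Real.log_mul (by norm_num) hk.ne', ← hqz₀, ← hre z₀ hz₀b, Real.log_exp]
  have hsub : ∀ w ∈ ball (0 : ℂ) (3 / 4), z₀ + w ∈ ball (0 : ℂ) 1 := fun w hw => by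
    rw [mem_ball_zero_iff] at hw ⊢
    linarith [norm_add_le z₀ w]
  have hb1 := Complex.borelCaratheodory_zero (f := fun w => L z₀ - L (z₀ + w)) (M := Real.log 8)
    (R := 3 / 4) (z := -z₀) h8
    ((differentiableOn_const _).sub (hL.comp (by fun_prop) hsub))
    (fun w hw => by
      have := hlow _ (hsub w hw)
      simp only [Set.mem_ofPred_eq, Complex.sub_re]
      linarith) (by norm_num) (by rw [mem_ball_zero_iff, norm_neg, hz₀]; norm_num) (by simp)
  rw [norm_neg, hz₀, add_neg_cancel] at hb1
  have hb1' : (L 0).re ≤ 2 * Real.log 8 + Real.log k := by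
    have := (abs_le.1 ((Complex.abs_re_le_norm _).trans hb1)).1
    rw [Complex.sub_re] at this
    ring_nf at this
    linarith
  have hzb : z ∈ ball (0 : ℂ) 1 := by
    rw [mem_ball_zero_iff]; linarith
  have hb2 := Complex.borelCaratheodory_zero (f := fun w => L 0 - L w) (M := 2 * Real.log 8)
    (R := 1) (z := z) (by positivity) ((differentiableOn_const _).sub hL)
    (fun w hw => by
      have := hlow _ hw
      simp only [Set.mem_ofPred_eq, Complex.sub_re]
      linarith) one_pos hzb (by simp)
  have hb3 : 2 * (2 * Real.log 8) * ‖z‖ / (1 - ‖z‖) ≤ 4 * Real.log 8 * R / (1 - R) := by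
    have h1 : 0 < 1 - R := by linarith
    have hR0 : 0 ≤ R := (norm_nonneg z).trans hz
    rw [show 2 * (2 * Real.log 8) = 4 * Real.log 8 by ring]
    gcongr
  have hb4 : (L z).re ≤ Real.log k + (2 * Real.log 8 + 4 * Real.log 8 * R / (1 - R)) := by
    have := (abs_le.1 ((Complex.abs_re_le_norm _).trans (hb2.trans hb3))).1
    rw [Complex.sub_re] at this
    linarith
  rw [← hre z hzb]
  calc Real.exp (L z).re ≤ _ := Real.exp_le_exp.2 hb4
    _ = _ := by rw [Real.exp_add, Real.exp_log hk]

open Metric in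
/-- A weak growth theorem: a univalent function on the unit disk vanishing at the origin is
bounded on smaller disks in terms of a single value. -/
theorem norm_le_of_injOn {f : ℂ → ℂ} (hf : DifferentiableOn ℂ f (ball 0 1))
    (hinj : Set.InjOn f (ball 0 1)) (hf0 : f 0 = 0) {R : ℝ} (hR : R < 1) {z : ℂ} (hz : ‖z‖ ≤ R) :
    ‖f z‖ ≤ ‖f (1 / 4)‖ * Real.exp (2 * Real.log 8 + 4 * Real.log 8 * R / (1 - R)) := by
  have hsph : sphere (0 : ℂ) (1 / 4) ⊆ ball 0 1 := fun w hw => by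
    rw [mem_sphere_zero_iff_norm] at hw
    rw [mem_ball_zero_iff, hw]; norm_num
  have hcb : closedBall (0 : ℂ) (1 / 4) ⊆ ball 0 1 := closedBall_subset_ball (by norm_num)
  have h0b : (0 : ℂ) ∈ ball (0 : ℂ) 1 := mem_ball_self one_pos
  have hne : ∀ w ∈ ball (0 : ℂ) 1, w ≠ 0 → f w ≠ 0 := fun w hw hw0 h =>
    hw0 (hinj hw h0b (h.trans hf0.symm))
  have hquart : (1 / 4 : ℂ) ∈ sphere (0 : ℂ) (1 / 4) := by simp
  obtain ⟨z₀, hz₀, hmin⟩ := (isCompact_sphere (0 : ℂ) (1 / 4)).exists_isMinOn ⟨_, hquart⟩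
    ((hf.continuousOn.mono hsph).norm)
  have hz₀n : ‖z₀‖ = 1 / 4 := mem_sphere_zero_iff_norm.1 hz₀
  have hz₀0 : z₀ ≠ 0 := norm_pos_iff.1 (by rw [hz₀n]; norm_num)
  set m := ‖f z₀‖ with hm
  have hmpos : 0 < m := norm_pos_iff.2 (hne z₀ (hsph hz₀) hz₀0)
  have hmle : ∀ w ∈ sphere (0 : ℂ) (1 / 4), m ≤ ‖f w‖ := fun w hw => hmin hw
  have himg : ball (f 0) (m / 2) ⊆ f '' closedBall 0 (1 / 4) := by
    refine DiffContOnCl.ball_subset_image_closedBall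
      (hf.diffContOnCl_ball hcb) (by norm_num)
      (fun w hw => by rw [hf0, sub_zero]; exact hmle w hw) ?_
    have h1 : ∀ᶠ w in nhdsWithin (0 : ℂ) {0}ᶜ, f w ≠ f 0 := by
      filter_upwards [self_mem_nhdsWithin,
        mem_nhdsWithin_of_mem_nhds (isOpen_ball.mem_nhds h0b)] with w hw0 hw
      rw [hf0]
      exact hne w hw hw0
    exact h1.frequently.filter_mono nhdsWithin_le_nhds
  have hout : ∀ w ∈ ball (0 : ℂ) 1, 1 / 4 ≤ ‖w‖ → m / 2 ≤ ‖f w‖ := by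
    intro w hw hw4
    by_contra! hlt
    obtain ⟨w', hw', hww'⟩ := himg (show f w ∈ ball (f 0) (m / 2) by
      rwa [hf0, mem_ball_zero_iff])
    have heq := hinj (hcb hw') hw hww'
    rw [heq, mem_closedBall_zero_iff] at hw'
    have := hmle w (mem_sphere_zero_iff_norm.2 (le_antisymm hw' hw4))
    linarith
  set q := dslope f 0 with hqdef
  have hq : DifferentiableOn ℂ q (ball 0 1) :=
    (Complex.differentiableOn_dslope (isOpen_ball.mem_nhds h0b)).2 hf
  have hfq : ∀ w, f w = w * q w := fun w => by
    have := sub_smul_dslope f 0 w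
    simpa [hf0] using this.symm
  have hqout : ∀ w ∈ ball (0 : ℂ) 1, 1 / 4 ≤ ‖w‖ → m / 2 ≤ ‖q w‖ := fun w hw hw4 => by
    have h1 := hout w hw hw4
    rw [hfq, norm_mul] at h1
    have h2 : ‖w‖ ≤ 1 := (mem_ball_zero_iff.1 hw).le
    nlinarith [norm_nonneg (q w)]
  have hq0 : ∀ w ∈ ball (0 : ℂ) 1, q w ≠ 0 := by
    intro w hw h
    by_cases hw0 : w = 0
    · subst hw0
      rw [hqdef, dslope_same] at h
      exact deriv_ne_zero_of_injOn isOpen_ball hf hinj hw h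
    · exact hne w hw hw0 (by rw [hfq, h, mul_zero])
  have hkq : ∀ w ∈ ball (0 : ℂ) 1, m / 2 ≤ ‖q w‖ := by
    intro w hw
    rcases le_total (1 / 4) ‖w‖ with h | h
    · exact hqout w hw h
    have h1 := Complex.norm_le_of_forall_mem_frontier_norm_le (U := ball (0 : ℂ) (1 / 4))
      (f := fun w => (q w)⁻¹) (C := (m / 2)⁻¹) isBounded_ball
      ((hq.inv hq0).diffContOnCl_ball hcb)
      (fun x hx => by
        rw [frontier_ball _ (by norm_num)] at hx
        rw [norm_inv]
        exact inv_anti₀ (by positivity)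
          (hqout x (hsph hx) (mem_sphere_zero_iff_norm.1 hx).ge))
      (show w ∈ closure (ball (0 : ℂ) (1 / 4)) by
        rwa [closure_ball _ (by norm_num), mem_closedBall_zero_iff])
    rw [norm_inv] at h1
    exact (inv_le_inv₀ (norm_pos_iff.2 (hq0 w hw)) (by positivity)).1 h1
  have hqz₀ : ‖q z₀‖ = 8 * (m / 2) := by
    have : m = ‖z₀‖ * ‖q z₀‖ := by rw [hm, hfq z₀, norm_mul]
    rw [hz₀n] at this
    linarith
  have hfin := norm_le_of_forall_le_norm hq (half_pos hmpos) hkq hz₀n hqz₀ hR hz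
  rw [hfq z, norm_mul]
  have hm4 := hmle _ hquart
  calc ‖z‖ * ‖q z‖ ≤ 1 * ‖q z‖ := by gcongr; linarith
    _ ≤ m / 2 * _ := by rw [one_mul]; exact hfin
    _ ≤ _ := by gcongr; linarith

/-- A time-dependent family of functions on the unit disk is bounded on smaller disks, uniformly
for times in `S`. -/
def BddOnSubdisks (S : Set ℝ) (g : ℂ → ℝ → ℂ) : Prop :=
  ∀ R < (1 : ℝ), ∃ C : ℝ, ∀ z : ℂ, ‖z‖ ≤ R → ∀ t ∈ S, ‖g z t‖ ≤ C

namespace BddOnSubdisks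

variable {S : Set ℝ} {g h : ℂ → ℝ → ℂ}

theorem add (hg : BddOnSubdisks S g) (hh : BddOnSubdisks S h) :
    BddOnSubdisks S fun z t => g z t + h z t := fun R hR => by
  obtain ⟨C, hC⟩ := hg R hR
  obtain ⟨D, hD⟩ := hh R hR
  exact ⟨C + D, fun z hz t ht => norm_add_le_of_le (hC z hz t ht) (hD z hz t ht)⟩

theorem mul (hg : BddOnSubdisks S g) (hh : BddOnSubdisks S h) :
    BddOnSubdisks S fun z t => g z t * h z t := fun R hR => by
  obtain ⟨C, hC⟩ := hg R hR
  obtain ⟨D, hD⟩ := hh R hR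
  exact ⟨C * D, fun z hz t ht => norm_mul_le_of_le (hC z hz t ht) (hD z hz t ht)⟩

theorem neg (hg : BddOnSubdisks S g) : BddOnSubdisks S fun z t => -g z t := fun R hR => by
  obtain ⟨C, hC⟩ := hg R hR
  exact ⟨C, fun z hz t ht => by rw [norm_neg]; exact hC z hz t ht⟩

theorem of_forall_norm_le {C : ℝ} (hg : ∀ z ∈ Metric.ball (0 : ℂ) 1, ∀ t ∈ S, ‖g z t‖ ≤ C) :
    BddOnSubdisks S g := fun R hR =>
  ⟨C, fun z hz t ht => hg z (by rw [mem_ball_zero_iff]; linarith) t ht⟩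

theorem fst : BddOnSubdisks S fun z _ => z :=
  of_forall_norm_le fun _ hz _ _ => (mem_ball_zero_iff.1 hz).le

theorem congr (hg : BddOnSubdisks S g)
    (hgh : ∀ z ∈ Metric.ball (0 : ℂ) 1, ∀ t ∈ S, h z t = g z t) : BddOnSubdisks S h :=
  fun R hR => by
  obtain ⟨C, hC⟩ := hg R hR
  exact ⟨C, fun z hz t ht => by
    rw [hgh z (by rw [mem_ball_zero_iff]; linarith) t ht]; exact hC z hz t ht⟩

/-- Cauchy's estimate: boundedness on smaller disks passes to the derivative. -/
theorem deriv (hg : BddOnSubdisks S g)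
    (hol : ∀ t ∈ S, DifferentiableOn ℂ (fun z => g z t) (Metric.ball 0 1)) :
    BddOnSubdisks S fun z t => deriv (fun x => g x t) z := fun R hR => by
  obtain ⟨C, hC⟩ := hg ((1 + R) / 2) (by linarith)
  refine ⟨C / ((1 - R) / 2), fun z hz t ht => ?_⟩
  have hsub : ∀ w ∈ Metric.closedBall z ((1 - R) / 2), ‖w‖ ≤ (1 + R) / 2 := fun w hw => by
    have h1 := mem_closedBall_iff_norm.1 hw
    have h2 := norm_le_norm_sub_add w z
    linarith
  refine Complex.norm_deriv_le_of_forall_mem_sphere_norm_le (by linarith)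
    ((hol t ht).diffContOnCl_ball fun w hw => ?_)
    fun w hw => hC w (hsub w (Metric.sphere_subset_closedBall hw)) t ht
  rw [mem_ball_zero_iff]
  linarith [hsub w hw]

end BddOnSubdisks

open Metric Filter Topology in
/-- Time derivatives commute with space derivatives for families of holomorphic functions whose
time derivative is bounded on smaller disks. -/
theorem hasDerivWithinAt_deriv_of_bddOnSubdisks {S : Set ℝ} (hS : Convex ℝ S)
    {g g' : ℂ → ℝ → ℂ}
    (hg : ∀ t ∈ S, DifferentiableOn ℂ (fun z => g z t) (ball 0 1))
    (hg' : ∀ t ∈ S, DifferentiableOn ℂ (fun z => g' z t) (ball 0 1))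
    (hd : ∀ z ∈ ball (0 : ℂ) 1, ∀ t ∈ S, HasDerivWithinAt (g z) (g' z t) S t)
    (hb : BddOnSubdisks S g') {z : ℂ} (hz : z ∈ ball (0 : ℂ) 1) {t : ℝ} (ht : t ∈ S) :
    HasDerivWithinAt (fun u => deriv (fun x => g x u) z) (deriv (fun x => g' x t) z) S t := by
  have hz1 := mem_ball_zero_iff.1 hz
  set R := (1 + ‖z‖) / 2 with hR
  have hR1 : R < 1 := by linarith
  have hR0 : 0 ≤ R := by positivity
  obtain ⟨C, hC⟩ := hb R hR1
  have hcb : closedBall (0 : ℂ) R ⊆ ball 0 1 := closedBall_subset_ball hR1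
  have hzR : z ∈ ball (0 : ℂ) R := by rw [mem_ball_zero_iff]; linarith
  have hcm : ∀ θ, circleMap 0 R θ ∈ closedBall (0 : ℂ) R := fun θ =>
    circleMap_mem_closedBall 0 hR0 θ
  have hform : ∀ {F : ℂ → ℂ}, DifferentiableOn ℂ F (ball 0 1) →
      deriv F z = ((2 * Real.pi * Complex.I : ℂ)⁻¹ • ∮ w in C(0, R), ((w - z) ^ 2)⁻¹ • F w) :=
    fun hF => (Complex.two_pi_I_inv_smul_circleIntegral_sub_sq_inv_smul_of_differentiable
      isOpen_ball hcb hF hzR).symm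
  have hslope : ∀ u ∈ S, DifferentiableOn ℂ (fun x => slope (g x) t u) (ball 0 1) := fun u hu => by
    simp only [slope_def_module]
    exact ((hg u hu).sub (hg t ht)).const_smul _
  have hne : ∀ θ, (circleMap 0 R θ - z) ^ 2 ≠ 0 := fun θ => pow_ne_zero 2 (sub_ne_zero.2 fun h => by
    have h1 := circleMap_mem_sphere (0 : ℂ) hR0 θ
    rw [h, mem_sphere_zero_iff_norm] at h1
    linarith)
  have hcontk : Continuous fun θ => deriv (circleMap 0 R) θ * ((circleMap 0 R θ - z) ^ 2)⁻¹ := by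
    simp only [deriv_circleMap]
    exact ((continuous_circleMap 0 R).mul continuous_const).mul
      ((((continuous_circleMap 0 R).sub continuous_const).pow 2).inv₀ hne)
  rw [hasDerivWithinAt_iff_tendsto_slope]
  have hev : ∀ᶠ u in 𝓝[S \ {t}] t, u ∈ S := by
    filter_upwards [self_mem_nhdsWithin] with u hu using hu.1
  have heq : (fun u => (2 * Real.pi * Complex.I : ℂ)⁻¹ •
      ∮ w in C(0, R), ((w - z) ^ 2)⁻¹ • slope (g w) t u) =ᶠ[𝓝[S \ {t}] t]
      slope (fun u => deriv (fun x => g x u) z) t := by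
    filter_upwards [hev] with u hu
    rw [← hform (hslope u hu)]
    have hdu := (hg u hu).differentiableAt (isOpen_ball.mem_nhds hz)
    have hdt := (hg t ht).differentiableAt (isOpen_ball.mem_nhds hz)
    simp only [slope_def_module]
    exact ((hdu.hasDerivAt.sub hdt.hasDerivAt).const_smul ((u - t)⁻¹)).deriv
  refine Tendsto.congr' heq ?_
  rw [hform (hg' t ht)]
  refine Tendsto.const_smul ?_ _
  simp only [circleIntegral]
  refine intervalIntegral.tendsto_integral_filter_of_dominated_convergence
    (fun θ => ‖deriv (circleMap 0 R) θ * ((circleMap 0 R θ - z) ^ 2)⁻¹‖ * C) ?_ ?_ ?_ ?_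
  · filter_upwards [hev] with u hu
    refine Continuous.aestronglyMeasurable ?_
    have h1 : Continuous fun θ => slope (g (circleMap 0 R θ)) t u :=
      (hslope u hu).continuousOn.comp_continuous (continuous_circleMap 0 R) fun θ => hcb (hcm θ)
    exact (hcontk.mul h1).congr fun θ => by simp [mul_assoc]
  · filter_upwards [self_mem_nhdsWithin] with u hu
    refine Eventually.of_forall fun θ _ => ?_
    have hθ := hcm θ
    have hlip := hS.norm_image_sub_le_of_norm_hasDerivWithin_le (f := g (circleMap 0 R θ))
      (fun x hx => hd _ (hcb hθ) x hx) (fun x hx => hC _ (mem_closedBall_zero_iff.1 hθ) x hx)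
      ht hu.1
    rw [← smul_assoc, norm_smul, smul_eq_mul]
    gcongr
    rw [slope_def_module, norm_smul, norm_inv]
    have hpos : 0 < ‖u - t‖ := norm_pos_iff.2 (sub_ne_zero.2 hu.2)
    rw [inv_mul_le_iff₀ hpos, mul_comm]
    exact hlip
  · exact (hcontk.norm.mul continuous_const).intervalIntegrable _ _
  · refine Eventually.of_forall fun θ _ => ?_
    have := hasDerivWithinAt_iff_tendsto_slope.1 (hd _ (hcb (hcm θ)) t ht)
    exact (this.const_smul _).const_smul _

open Metric in
/-- A family of holomorphic functions whose time derivative is bounded on smaller disks is jointly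
continuous. -/
theorem continuousOn_prod_of_bddOnSubdisks {S : Set ℝ} (hS : Convex ℝ S)
    {g g' : ℂ → ℝ → ℂ}
    (hg : ∀ t ∈ S, ContinuousOn (fun z => g z t) (ball 0 1))
    (hd : ∀ z ∈ ball (0 : ℂ) 1, ∀ t ∈ S, HasDerivWithinAt (g z) (g' z t) S t)
    (hb : BddOnSubdisks S g') {R : ℝ} (hR : R < 1) :
    ContinuousOn (fun x : ℂ × ℝ => g x.1 x.2) (closedBall 0 R ×ˢ S) := by
  obtain ⟨C, hC⟩ := hb R hR
  have hcb : closedBall (0 : ℂ) R ⊆ ball 0 1 := closedBall_subset_ball hR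
  refine continuousOn_prod_of_continuousOn_lipschitzOnWith' _ C.toNNReal
    (fun z hz => ?_) (fun t ht => (hg t ht).mono hcb)
  refine hS.lipschitzOnWith_of_nnnorm_hasDerivWithin_le
    (fun t ht => hd z (hcb hz) t ht) fun t ht => ?_
  rw [← NNReal.coe_le_coe, coe_nnnorm]
  exact (hC z (mem_closedBall_zero_iff.1 hz) t ht).trans (Real.le_coe_toNNReal C)

/-- One-sided Fermat condition at the left endpoint. -/
theorem HasDerivWithinAt.nonpos_of_isMaxOn_Icc_left {h : ℝ → ℝ} {h' a b : ℝ} (hab : a < b)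
    (hd : HasDerivWithinAt h h' (Set.Icc a b) a) (hmax : IsMaxOn h (Set.Icc a b) a) : h' ≤ 0 := by
  have h1 := hmax.localize.hasFDerivWithinAt_nonpos hd.hasFDerivWithinAt
    (sub_mem_posTangentConeAt_of_segment_subset (segment_eq_Icc hab.le).le)
  rw [ContinuousLinearMap.toSpanSingleton_apply, smul_eq_mul] at h1
  nlinarith

/-- One-sided Fermat condition at a point different from the left endpoint. -/
theorem HasDerivWithinAt.nonneg_of_isMaxOn_Icc {h : ℝ → ℝ} {h' a b c : ℝ} (hac : a < c)
    (hcb : c ≤ b) (hd : HasDerivWithinAt h h' (Set.Icc a b) c)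
    (hmax : IsMaxOn h (Set.Icc a b) c) : 0 ≤ h' := by
  have hsub : segment ℝ c a ⊆ Set.Icc a b := by
    rw [segment_symm, segment_eq_Icc hac.le]
    exact Set.Icc_subset_Icc_right hcb
  have h1 := hmax.localize.hasFDerivWithinAt_nonpos hd.hasFDerivWithinAt
    (sub_mem_posTangentConeAt_of_segment_subset hsub)
  rw [ContinuousLinearMap.toSpanSingleton_apply, smul_eq_mul] at h1
  nlinarith

open Metric in
/-- If `‖g‖` is maximal on a closed disk at `z`, it does not increase in the inward directions
`-(z * p)` with `0 < p.re`. -/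
theorem inner_neg_mul_deriv_nonpos_of_isMaxOn {g : ℂ → ℂ} {z p : ℂ} {R : ℝ}
    (hz : ‖z‖ ≤ R) (hp : 0 < p.re) (hg : DifferentiableAt ℂ g z)
    (hmax : IsMaxOn (fun w => ‖g w‖ ^ 2) (closedBall 0 R) z) :
    inner ℝ (g z) (-(z * p * deriv g z)) ≤ 0 := by
  have hp0 : p ≠ 0 := fun h => by simp [h] at hp
  have hpn : 0 < ‖p‖ ^ 2 := by positivity
  set e := p.re / ‖p‖ ^ 2 with he
  have he0 : 0 < e := by positivity
  have hcurve : ∀ s ∈ Set.Icc 0 e, z - (s : ℂ) * (z * p) ∈ closedBall (0 : ℂ) R := by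
    intro s hs
    rw [mem_closedBall_zero_iff, show z - (s : ℂ) * (z * p) = z * (1 - s * p) by ring, norm_mul]
    have h1 : ‖(1 - s * p : ℂ)‖ ≤ 1 := by
      rw [← sq_le_one_iff₀ (norm_nonneg _), ← Complex.normSq_eq_norm_sq, Complex.normSq_apply]
      have h2 : ‖p‖ ^ 2 = p.re * p.re + p.im * p.im := by
        rw [← Complex.normSq_eq_norm_sq, Complex.normSq_apply]
      have h3 : s * ‖p‖ ^ 2 ≤ p.re := by
        have := hs.2
        rwa [he, le_div_iff₀ hpn] at this
      rw [h2] at h3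
      simp
      nlinarith [hs.1, mul_nonneg hs.1 (sub_nonneg.2 h3), mul_nonneg hs.1 hp.le]
    calc ‖z‖ * ‖(1 - s * p : ℂ)‖ ≤ R * 1 := by
          gcongr
          exact (norm_nonneg z).trans hz
      _ = R := mul_one R
  have hcd : HasDerivAt (fun s : ℝ => z - (s : ℂ) * (z * p)) (-(z * p)) 0 := by
    simpa using ((Complex.ofRealCLM.hasDerivAt (x := 0)).mul_const (z * p)).const_sub z
  have hgd : HasDerivAt g (deriv g z) (z - ((0 : ℝ) : ℂ) * (z * p)) := by
    simpa using hg.hasDerivAt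
  have hcomp := ((hgd.comp (0 : ℝ) hcd).norm_sq).hasDerivWithinAt (s := Set.Icc 0 e)
  have h0 : z - ((0 : ℝ) : ℂ) * (z * p) = z := by simp
  have hres := hcomp.nonpos_of_isMaxOn_Icc_left he0 (fun s hs => by
    have := hmax (hcurve s hs)
    simpa [Function.comp_def, h0] using this)
  rw [Function.comp_apply, h0] at hres
  rw [show -(z * p * deriv g z) = deriv g z * -(z * p) by ring]
  linarith

open Metric in
/-- A maximum principle for linear transport equations on the disk with inward drift. -/
theorem norm_le_of_transport {τ : ℝ} (hτ : 0 < τ) {g a b p : ℂ → ℝ → ℂ} {A B : ℝ}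
    (hg : ∀ t ∈ Set.Icc 0 τ, DifferentiableOn ℂ (fun z => g z t) (ball 0 1))
    (hd : ∀ z ∈ ball (0 : ℂ) 1, ∀ t ∈ Set.Icc 0 τ, HasDerivWithinAt (g z)
      (-(z * p z t * deriv (fun x => g x t) z) + a z t * g z t + b z t) (Set.Icc 0 τ) t)
    (hb : BddOnSubdisks (Set.Icc 0 τ)
      fun z t => -(z * p z t * deriv (fun x => g x t) z) + a z t * g z t + b z t)
    (hp : ∀ z ∈ ball (0 : ℂ) 1, ∀ t ∈ Set.Icc 0 τ, 0 < (p z t).re)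
    (hA : ∀ z ∈ ball (0 : ℂ) 1, ∀ t ∈ Set.Icc 0 τ, ‖a z t‖ ≤ A)
    (hB : ∀ z ∈ ball (0 : ℂ) 1, ∀ t ∈ Set.Icc 0 τ, ‖b z t‖ ≤ B)
    (h0 : ∀ z ∈ ball (0 : ℂ) 1, g z 0 = 0) {z : ℂ} (hz : z ∈ ball (0 : ℂ) 1) :
    ‖g z τ‖ ≤ Real.exp (A * τ + 1 / 2) * B * τ := by
  have hτmem : τ ∈ Set.Icc 0 τ := Set.right_mem_Icc.2 hτ.le
  have hB0 : 0 ≤ B := (norm_nonneg _).trans (hB z hz τ hτmem)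
  set c := 2 * A + 1 / τ with hc
  have key : ∀ ε > 0, ‖g z τ‖ ^ 2 ≤ Real.exp (c * τ) * (B ^ 2 * τ + ε) * τ := by
    intro ε hε
    set Q : ℂ × ℝ → ℝ :=
      fun x => Real.exp (-(c * x.2)) * ‖g x.1 x.2‖ ^ 2 - (B ^ 2 * τ + ε) * x.2 with hQ
    have hzR := mem_ball_zero_iff.1 hz
    have hcont := continuousOn_prod_of_bddOnSubdisks (convex_Icc 0 τ)
      (fun t ht => (hg t ht).continuousOn) hd hb hzR
    have hQc : ContinuousOn Q (closedBall 0 ‖z‖ ×ˢ Set.Icc 0 τ) := by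
      refine ContinuousOn.sub (ContinuousOn.mul ?_ (hcont.norm.pow 2)) ?_ <;> fun_prop
    have hzmem : (z, τ) ∈ closedBall (0 : ℂ) ‖z‖ ×ˢ Set.Icc 0 τ :=
      ⟨mem_closedBall_zero_iff.2 le_rfl, hτmem⟩
    obtain ⟨⟨z₀, t₀⟩, ⟨hz₀, ht₀⟩, hmax⟩ :=
      ((isCompact_closedBall (0 : ℂ) ‖z‖).prod isCompact_Icc).exists_isMaxOn ⟨_, hzmem⟩ hQc
    simp only at hz₀ ht₀
    have hz₀n := mem_closedBall_zero_iff.1 hz₀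
    have hz₀b : z₀ ∈ ball (0 : ℂ) 1 := mem_ball_zero_iff.2 (hz₀n.trans_lt hzR)
    have ht₀0 : t₀ = 0 := by
      by_contra hne
      have ht₀pos : 0 < t₀ := lt_of_le_of_ne ht₀.1 (Ne.symm hne)
      have hspace := inner_neg_mul_deriv_nonpos_of_isMaxOn (g := fun x => g x t₀) hz₀n
        (hp z₀ hz₀b t₀ ht₀) ((hg t₀ ht₀).differentiableAt (isOpen_ball.mem_nhds hz₀b))
        (fun w hw => by
          have h1 := hmax (show (w, t₀) ∈ closedBall (0 : ℂ) ‖z‖ ×ˢ Set.Icc 0 τ from ⟨hw, ht₀⟩)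
          simp only [hQ, Set.mem_ofPred_eq, sub_le_sub_iff_right] at h1
          exact le_of_mul_le_mul_left h1 (Real.exp_pos _))
      have hexp : HasDerivWithinAt (fun t : ℝ => Real.exp (-(c * t)))
          (Real.exp (-(c * t₀)) * -c) (Set.Icc 0 τ) t₀ := by
        simpa using (((hasDerivAt_id t₀).const_mul c).neg.exp).hasDerivWithinAt
      have hQd := (hexp.mul (hd z₀ hz₀b t₀ ht₀).norm_sq).sub
        ((hasDerivWithinAt_id t₀ (Set.Icc 0 τ)).const_mul (B ^ 2 * τ + ε))
      have htime := hQd.nonneg_of_isMaxOn_Icc ht₀pos ht₀.2 (fun t ht =>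
        hmax (show (z₀, t) ∈ closedBall (0 : ℂ) ‖z‖ ×ˢ Set.Icc 0 τ from ⟨hz₀, ht⟩))
      set G := ‖g z₀ t₀‖ with hG
      have hG0 : 0 ≤ G := norm_nonneg _
      have ha : inner ℝ (g z₀ t₀) (a z₀ t₀ * g z₀ t₀) ≤ A * G ^ 2 := by
        refine (real_inner_le_norm _ _).trans ?_
        rw [norm_mul, ← hG]
        nlinarith [hA z₀ hz₀b t₀ ht₀, mul_nonneg hG0 hG0]
      have hbb : inner ℝ (g z₀ t₀) (b z₀ t₀) ≤ B * G := by
        refine (real_inner_le_norm _ _).trans ?_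
        rw [← hG]
        nlinarith [hB z₀ hz₀b t₀ ht₀]
      rw [inner_add_right, inner_add_right] at htime
      have hyoung : 2 * (B * G) ≤ B ^ 2 * τ + 1 / τ * G ^ 2 := by
        have h2 : 0 ≤ (B * τ - G) ^ 2 / τ := by positivity
        have h3 : (B * τ - G) ^ 2 / τ = B ^ 2 * τ + 1 / τ * G ^ 2 - 2 * (B * G) := by
          field_simp
          ring
        linarith
      have hE1 : Real.exp (-(c * t₀)) * (B ^ 2 * τ) ≤ B ^ 2 * τ := by
        have hc0 : 0 ≤ c := by
          have := (norm_nonneg _).trans (hA z₀ hz₀b t₀ ht₀)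
          positivity
        have h4 : Real.exp (-(c * t₀)) ≤ 1 := Real.exp_le_one_iff.2 (by
          have := mul_nonneg hc0 ht₀.1
          linarith)
        have h5 : 0 ≤ B ^ 2 * τ := by positivity
        nlinarith
      have hE : 0 < Real.exp (-(c * t₀)) := Real.exp_pos _
      set E := Real.exp (-(c * t₀))
      set I1 := inner ℝ (g z₀ t₀) (-(z₀ * p z₀ t₀ * deriv (fun x => g x t₀) z₀))
      set I2 := inner ℝ (g z₀ t₀) (a z₀ t₀ * g z₀ t₀)
      set I3 := inner ℝ (g z₀ t₀) (b z₀ t₀)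
      have hsum : E * (-c * G ^ 2 + 2 * (I1 + I2 + I3)) ≤ E * (B ^ 2 * τ) := by
        gcongr
        rw [hc]
        linarith
      simp only [mul_one] at htime
      nlinarith
    have h1 := hmax hzmem
    simp only [hQ, Set.mem_ofPred_eq, ht₀0, h0 z₀ hz₀b, mul_zero, norm_zero, ne_eq,
      OfNat.ofNat_ne_zero, not_false_eq_true, zero_pow, sub_zero, sub_nonpos] at h1
    rw [Real.exp_neg, inv_mul_le_iff₀ (Real.exp_pos _)] at h1
    linarith
  have hlim : ‖g z τ‖ ^ 2 ≤ Real.exp (c * τ) * (B ^ 2 * τ) * τ := by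
    refine le_of_forall_pos_le_add fun η hη => ?_
    have hpos : 0 < Real.exp (c * τ) * τ := by positivity
    have := key (η / (Real.exp (c * τ) * τ)) (by positivity)
    calc _ ≤ _ := this
      _ = _ := by field_simp
  have hsq : (Real.exp (A * τ + 1 / 2) * B * τ) ^ 2 = Real.exp (c * τ) * (B ^ 2 * τ) * τ := by
    have : c * τ = (A * τ + 1 / 2) + (A * τ + 1 / 2) := by
      rw [hc]; field_simp; ring
    rw [this, Real.exp_add (A * τ + 1 / 2) (A * τ + 1 / 2)]
    ring
  rw [← hsq] at hlim
  exact (pow_le_pow_iff_left₀ (norm_nonneg _) (by positivity) two_ne_zero).1 hlim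

open Metric in
/-- Short-time estimates for solutions of the Löwner–Kufarev equation on the open disk. -/
theorem loewner_kufarev_interior_estimates
    {T : ℝ} {p p' p'' : ℂ → ℝ → ℂ}
    (hp_re : ∀ t ∈ Set.Ico (0:ℝ) T, ∀ z ∈ ball (0:ℂ) 1, 0 < (p z t).re)
    (hp' : ∀ t ∈ Set.Ico (0:ℝ) T, ∀ z ∈ ball (0:ℂ) 1,
      HasDerivAt (fun x => p x t) (p' z t) z)
    (hp'' : ∀ t ∈ Set.Ico (0:ℝ) T, ∀ z ∈ ball (0:ℂ) 1,
      HasDerivAt (fun x => p' x t) (p'' z t) z)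
    {M M' M'' : ℝ} (hM : 0 ≤ M) (hM' : 0 ≤ M') (hM'' : 0 ≤ M'')
    (hp_bdd : ∀ z ∈ ball (0:ℂ) 1, ∀ t ∈ Set.Ico (0:ℝ) T, ‖p z t‖ ≤ M)
    (hp'_bdd : ∀ z ∈ ball (0:ℂ) 1, ∀ t ∈ Set.Ico (0:ℝ) T, ‖p' z t‖ ≤ M')
    (hp''_bdd : ∀ z ∈ ball (0:ℂ) 1, ∀ t ∈ Set.Ico (0:ℝ) T, ‖p'' z t‖ ≤ M'')
    {f fz fzz : ℂ → ℝ → ℂ}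
    (hf_init : ∀ z ∈ ball (0:ℂ) 1, f z 0 = z)
    (hf_inj : ∀ t ∈ Set.Ico (0:ℝ) T, Set.InjOn (fun z => f z t) (ball (0:ℂ) 1))
    (hfz : ∀ t ∈ Set.Ico (0:ℝ) T, ∀ z ∈ ball (0:ℂ) 1,
      HasDerivAt (fun x => f x t) (fz z t) z)
    (hfzz : ∀ t ∈ Set.Ico (0:ℝ) T, ∀ z ∈ ball (0:ℂ) 1,
      HasDerivAt (fun x => fz x t) (fzz z t) z)
    (hf_pde : ∀ z ∈ ball (0:ℂ) 1, ∀ t ∈ Set.Ico (0:ℝ) T,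
      HasDerivWithinAt (fun u => f z u) (-(z * fz z t * p z t)) (Set.Ico 0 T) t) :
    ∃ C > 0, ∀ t ∈ Set.Ioo (0:ℝ) T, ∀ z ∈ ball (0:ℂ) 1,
      ‖f z t - z‖ ≤ C * t ∧ ‖fz z t - 1‖ ≤ C * t ∧ ‖fzz z t‖ ≤ C * t := by
  set K := M + M' with hK
  have hK0 : 0 ≤ K := by positivity
  set C₁ := Real.exp (1 / 2) * M with hC₁
  set C₂ := Real.exp (K * T + 1 / 2) * K with hC₂
  set C₃ := Real.exp (2 * K * T + 1 / 2) * ((2 * M' + M'') * (1 + C₂ * T)) with hC₃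
  have hC₁0 : 0 ≤ C₁ := by positivity
  have hC₂0 : 0 ≤ C₂ := by positivity
  suffices H : ∀ τ ∈ Set.Ioo (0:ℝ) T, ∀ z ∈ ball (0:ℂ) 1,
      ‖f z τ - z‖ ≤ C₁ * τ ∧ ‖fz z τ - 1‖ ≤ C₂ * τ ∧ ‖fzz z τ‖ ≤ C₃ * τ by
    refine ⟨C₁ + C₂ + |C₃| + 1, by positivity, fun t ht z hz => ?_⟩
    obtain ⟨h1, h2, h3⟩ := H t ht z hz
    have ht0 : 0 ≤ t := ht.1.le
    have h4 := abs_nonneg C₃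
    have h5 := le_abs_self C₃
    refine ⟨h1.trans ?_, h2.trans ?_, h3.trans ?_⟩ <;> gcongr <;> linarith
  have h0b : (0 : ℂ) ∈ ball (0 : ℂ) 1 := mem_ball_self one_pos
  intro τ hτ
  have hτ0 : 0 < τ := hτ.1
  have hT0 : 0 < T := hτ.1.trans hτ.2
  have hC₃0 : 0 ≤ C₃ := by positivity
  have hST : Set.Icc 0 τ ⊆ Set.Ico 0 T := fun t ht => ⟨ht.1, ht.2.trans_lt hτ.2⟩
  have hS : Convex ℝ (Set.Icc 0 τ) := convex_Icc 0 τ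
  have hnb : ∀ z ∈ ball (0 : ℂ) 1, ball (0 : ℂ) 1 ∈ nhds z := fun z hz => isOpen_ball.mem_nhds hz
  have hol : ∀ {g g' : ℂ → ℝ → ℂ}, (∀ t ∈ Set.Ico (0:ℝ) T, ∀ z ∈ ball (0:ℂ) 1,
      HasDerivAt (fun x => g x t) (g' z t) z) →
      ∀ t ∈ Set.Icc 0 τ, DifferentiableOn ℂ (fun z => g z t) (ball 0 1) :=
    fun h t ht z hz => (h t (hST ht) z hz).differentiableAt.differentiableWithinAt
  have hfzz' : ∀ t ∈ Set.Icc 0 τ, DifferentiableOn ℂ (fun z => fzz z t) (ball 0 1) := by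
    intro t ht
    refine ((hol hfzz t ht).deriv isOpen_ball).congr fun z hz => ?_
    exact (hfzz t (hST ht) z hz).deriv.symm
  have hfzzz : ∀ t ∈ Set.Icc 0 τ, ∀ z ∈ ball (0:ℂ) 1,
      HasDerivAt (fun x => fzz x t) (deriv (fun x => fzz x t) z) z := fun t ht z hz =>
    ((hfzz' t ht).differentiableAt (hnb z hz)).hasDerivAt
  have hf_t : ∀ z ∈ ball (0:ℂ) 1, ∀ t ∈ Set.Icc 0 τ,
      HasDerivWithinAt (f z) (-(z * fz z t * p z t)) (Set.Icc 0 τ) t := fun z hz t ht =>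
    (hf_pde z hz t (hST ht)).mono hST
  have bp : BddOnSubdisks (Set.Icc 0 τ) p := .of_forall_norm_le fun z hz t ht =>
    hp_bdd z hz t (hST ht)
  have bp' : BddOnSubdisks (Set.Icc 0 τ) p' := .of_forall_norm_le fun z hz t ht =>
    hp'_bdd z hz t (hST ht)
  have bp'' : BddOnSubdisks (Set.Icc 0 τ) p'' := .of_forall_norm_le fun z hz t ht =>
    hp''_bdd z hz t (hST ht)
  have hf0 : ∀ t ∈ Set.Icc 0 τ, f 0 t = 0 := by
    intro t ht
    have := hS.norm_image_sub_le_of_norm_hasDerivWithin_le (f := f 0) (C := 0)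
      (fun x hx => hf_t 0 h0b x hx) (fun x _ => by simp) (Set.left_mem_Icc.2 hτ0.le) ht
    rw [zero_mul, hf_init 0 h0b, sub_zero] at this
    exact norm_le_zero_iff.1 this
  have bf : BddOnSubdisks (Set.Icc 0 τ) f := by
    intro R hR
    have hq : (1 / 4 : ℂ) ∈ ball (0 : ℂ) 1 := by
      rw [mem_ball_zero_iff]; norm_num
    obtain ⟨C, hC⟩ := isCompact_Icc.exists_bound_of_continuousOn
      (fun t ht => (hf_t _ hq t ht).continuousWithinAt)
    refine ⟨C * Real.exp (2 * Real.log 8 + 4 * Real.log 8 * R / (1 - R)), fun z hz t ht => ?_⟩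
    refine (norm_le_of_injOn (hol hfz t ht) (hf_inj t (hST ht)) (hf0 t ht) hR hz).trans ?_
    gcongr
    exact hC t ht
  have bfz : BddOnSubdisks (Set.Icc 0 τ) fz := (bf.deriv (hol hfz)).congr fun z hz t ht =>
    (hfz t (hST ht) z hz).deriv.symm
  have bfzz : BddOnSubdisks (Set.Icc 0 τ) fzz := (bfz.deriv (hol hfzz)).congr fun z hz t ht =>
    (hfzz t (hST ht) z hz).deriv.symm
  have bfzzz := bfzz.deriv hfzz'
  have hd1 : ∀ t ∈ Set.Icc 0 τ, ∀ z ∈ ball (0:ℂ) 1,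
      HasDerivAt (fun x => -(x * fz x t * p x t))
        (-(fz z t * p z t + z * fzz z t * p z t + z * fz z t * p' z t)) z := fun t ht z hz =>
    ((((hasDerivAt_id z).mul (hfzz t (hST ht) z hz)).mul (hp' t (hST ht) z hz)).neg).congr_deriv
      (by simp; ring)
  have hd2 : ∀ t ∈ Set.Icc 0 τ, ∀ z ∈ ball (0:ℂ) 1,
      HasDerivAt (fun x => -(fz x t * p x t + x * fzz x t * p x t + x * fz x t * p' x t))
        (-(2 * fzz z t * p z t + 2 * fz z t * p' z t + z * deriv (fun x => fzz x t) z * p z t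
          + 2 * z * fzz z t * p' z t + z * fz z t * p'' z t)) z := fun t ht z hz =>
    (((((hfzz t (hST ht) z hz).mul (hp' t (hST ht) z hz)).add
      (((hasDerivAt_id z).mul (hfzzz t ht z hz)).mul (hp' t (hST ht) z hz))).add
      (((hasDerivAt_id z).mul (hfzz t (hST ht) z hz)).mul (hp'' t (hST ht) z hz))).neg).congr_deriv
      (by simp; ring)
  have bd0 : BddOnSubdisks (Set.Icc 0 τ) fun z t => -(z * fz z t * p z t) :=
    ((BddOnSubdisks.fst.mul bfz).mul bp).neg
  have bd1 : BddOnSubdisks (Set.Icc 0 τ)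
      fun z t => -(fz z t * p z t + z * fzz z t * p z t + z * fz z t * p' z t) :=
    (((bfz.mul bp).add ((BddOnSubdisks.fst.mul bfzz).mul bp)).add
      ((BddOnSubdisks.fst.mul bfz).mul bp')).neg
  have b2 : BddOnSubdisks (Set.Icc 0 τ) fun _ _ => (2 : ℂ) :=
    .of_forall_norm_le (C := 2) fun _ _ _ _ => by simp
  have bd2 : BddOnSubdisks (Set.Icc 0 τ) fun z t =>
      -(2 * fzz z t * p z t + 2 * fz z t * p' z t + z * deriv (fun x => fzz x t) z * p z t
          + 2 * z * fzz z t * p' z t + z * fz z t * p'' z t) :=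
    (((((b2.mul bfzz).mul bp).add ((b2.mul bfz).mul bp')).add
      ((BddOnSubdisks.fst.mul bfzzz).mul bp)).add
      (((b2.mul .fst).mul bfzz).mul bp') |>.add
      ((BddOnSubdisks.fst.mul bfz).mul bp'')).neg
  have hfz_t : ∀ z ∈ ball (0:ℂ) 1, ∀ t ∈ Set.Icc 0 τ, HasDerivWithinAt (fz z)
      (-(fz z t * p z t + z * fzz z t * p z t + z * fz z t * p' z t)) (Set.Icc 0 τ) t := by
    intro z hz t ht
    have h1 := hasDerivWithinAt_deriv_of_bddOnSubdisks hS (hol hfz)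
      (fun t ht z hz => (hd1 t ht z hz).differentiableAt.differentiableWithinAt) hf_t bd0 hz ht
    rw [(hd1 t ht z hz).deriv] at h1
    exact h1.congr_of_mem (fun u hu => (hfz u (hST hu) z hz).deriv.symm) ht
  have hfzz_t : ∀ z ∈ ball (0:ℂ) 1, ∀ t ∈ Set.Icc 0 τ, HasDerivWithinAt (fzz z)
      (-(2 * fzz z t * p z t + 2 * fz z t * p' z t + z * deriv (fun x => fzz x t) z * p z t
          + 2 * z * fzz z t * p' z t + z * fz z t * p'' z t)) (Set.Icc 0 τ) t := by
    intro z hz t ht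
    have h1 := hasDerivWithinAt_deriv_of_bddOnSubdisks hS (hol hfzz)
      (fun t ht z hz => (hd2 t ht z hz).differentiableAt.differentiableWithinAt) hfz_t bd1 hz ht
    rw [(hd2 t ht z hz).deriv] at h1
    exact h1.congr_of_mem (fun u hu => (hfzz u (hST hu) z hz).deriv.symm) ht
  have h0T : (0 : ℝ) ∈ Set.Ico 0 T := ⟨le_rfl, hT0⟩
  have hfz0 : ∀ z ∈ ball (0:ℂ) 1, fz z 0 = 1 := fun z hz => by
    have h1 : HasDerivAt (fun x => f x 0) 1 z := (hasDerivAt_id z).congr_of_eventuallyEq (by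
      filter_upwards [hnb z hz] with x hx using hf_init x hx)
    exact (hfz 0 h0T z hz).unique h1
  have hfzz0 : ∀ z ∈ ball (0:ℂ) 1, fzz z 0 = 0 := fun z hz => by
    have h1 : HasDerivAt (fun x => fz x 0) 0 z :=
      (hasDerivAt_const z (1 : ℂ)).congr_of_eventuallyEq (by
        filter_upwards [hnb z hz] with x hx using hfz0 x hx)
    exact (hfzz 0 h0T z hz).unique h1
  have hpS : ∀ z ∈ ball (0 : ℂ) 1, ∀ t ∈ Set.Icc 0 τ, 0 < (p z t).re := fun z hz t ht =>
    hp_re t (hST ht) z hz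
  have hzp : ∀ z ∈ ball (0 : ℂ) 1, ∀ w : ℂ, ‖z * w‖ ≤ ‖w‖ := fun z hz w => by
    rw [norm_mul]
    exact mul_le_of_le_one_left (norm_nonneg w) (mem_ball_zero_iff.1 hz).le
  have hpzp : ∀ z ∈ ball (0 : ℂ) 1, ∀ t ∈ Set.Icc 0 τ, ‖p z t + z * p' z t‖ ≤ K :=
    fun z hz t ht => norm_add_le_of_le (hp_bdd z hz t (hST ht))
      ((hzp z hz _).trans (hp'_bdd z hz t (hST ht)))
  have E1 : ∀ z ∈ ball (0 : ℂ) 1, ‖f z τ - z‖ ≤ C₁ * τ := by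
    have hde : ∀ z ∈ ball (0 : ℂ) 1, ∀ t ∈ Set.Icc 0 τ,
        -(z * p z t * deriv (fun x => f x t - x) z) + 0 * (f z t - z) + -(z * p z t) =
        -(z * fz z t * p z t) := fun z hz t ht => by
      rw [((hfz t (hST ht) z hz).fun_sub (hasDerivAt_id' z)).deriv]
      ring
    intro z hz
    refine (norm_le_of_transport (g := fun z t => f z t - z) (a := fun _ _ => 0)
      (b := fun z t => -(z * p z t)) (p := p) (A := 0) (B := M) hτ0
      (fun t ht => (hol hfz t ht).sub differentiableOn_id)
      (fun z hz t ht => ((hf_t z hz t ht).sub_const z).congr_deriv (hde z hz t ht).symm)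
      (bd0.congr hde) hpS (by simp)
      (fun z hz t ht => by
        rw [norm_neg]; exact (hzp z hz _).trans (hp_bdd z hz t (hST ht)))
      (fun z hz => by rw [hf_init z hz, sub_self]) hz).trans_eq ?_
    rw [zero_mul, zero_add]
  have E2 : ∀ t ∈ Set.Ioc 0 τ, ∀ z ∈ ball (0 : ℂ) 1, ‖fz z t - 1‖ ≤ C₂ * t := by
    intro t₁ ht₁
    have hsub : Set.Icc 0 t₁ ⊆ Set.Icc 0 τ := Set.Icc_subset_Icc_right ht₁.2
    have hde : ∀ z ∈ ball (0 : ℂ) 1, ∀ t ∈ Set.Icc 0 τ,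
        -(z * p z t * deriv (fun x => fz x t - 1) z)
          + -(p z t + z * p' z t) * (fz z t - 1) + -(p z t + z * p' z t) =
        -(fz z t * p z t + z * fzz z t * p z t + z * fz z t * p' z t) := fun z hz t ht => by
      rw [((hfzz t (hST ht) z hz).sub_const 1).deriv]
      ring
    intro z hz
    have hmono : BddOnSubdisks (Set.Icc 0 t₁)
        fun z t => -(fz z t * p z t + z * fzz z t * p z t + z * fz z t * p' z t) := fun R hR => by
      obtain ⟨C, hC⟩ := bd1 R hR
      exact ⟨C, fun z hz t ht => hC z hz t (hsub ht)⟩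
    refine (norm_le_of_transport (g := fun z t => fz z t - 1)
      (a := fun z t => -(p z t + z * p' z t))
      (b := fun z t => -(p z t + z * p' z t)) (p := p) (A := K) (B := K) ht₁.1
      (fun t ht => (hol hfzz t (hsub ht)).sub_const 1)
      (fun z hz t ht => (((hfz_t z hz t (hsub ht)).mono hsub).sub_const 1).congr_deriv
        (hde z hz t (hsub ht)).symm)
      (hmono.congr fun z hz t ht => hde z hz t (hsub ht)) (fun z hz t ht => hpS z hz t (hsub ht))
      (fun z hz t ht => by rw [norm_neg]; exact hpzp z hz t (hsub ht))
      (fun z hz t ht => by rw [norm_neg]; exact hpzp z hz t (hsub ht))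
      (fun z hz => by rw [hfz0 z hz, sub_self]) hz).trans ?_
    rw [hC₂]
    have := ht₁.2.trans hτ.2.le
    have := ht₁.1.le
    gcongr
  have hfzN : ∀ z ∈ ball (0 : ℂ) 1, ∀ t ∈ Set.Icc 0 τ, ‖fz z t‖ ≤ 1 + C₂ * T := by
    intro z hz t ht
    rcases ht.1.eq_or_lt with rfl | h
    · rw [hfz0 z hz, norm_one]
      linarith [mul_nonneg hC₂0 hT0.le]
    · have h1 := E2 t ⟨h, ht.2⟩ z hz
      have h2 : C₂ * t ≤ C₂ * T := by
        gcongr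
        exact (hST ht).2.le
      have h3 := norm_le_norm_sub_add (fz z t) 1
      rw [norm_one] at h3
      linarith
  have E3 : ∀ z ∈ ball (0 : ℂ) 1, ‖fzz z τ‖ ≤ C₃ * τ := by
    have hde : ∀ z ∈ ball (0 : ℂ) 1, ∀ t ∈ Set.Icc 0 τ,
        -(z * p z t * deriv (fun x => fzz x t) z)
          + -(2 * (p z t + z * p' z t)) * fzz z t + -((2 * p' z t + z * p'' z t) * fz z t) =
        -(2 * fzz z t * p z t + 2 * fz z t * p' z t + z * deriv (fun x => fzz x t) z * p z t
          + 2 * z * fzz z t * p' z t + z * fz z t * p'' z t) := fun z hz t ht => by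
      ring
    intro z hz
    refine (norm_le_of_transport (g := fzz)
      (a := fun z t => -(2 * (p z t + z * p' z t)))
      (b := fun z t => -((2 * p' z t + z * p'' z t) * fz z t)) (p := p) (A := 2 * K)
      (B := (2 * M' + M'') * (1 + C₂ * T)) hτ0 hfzz'
      (fun z hz t ht => (hfzz_t z hz t ht).congr_deriv (hde z hz t ht).symm)
      (bd2.congr hde) hpS
      (fun z hz t ht => by
        rw [norm_neg, norm_mul, Complex.norm_ofNat]
        gcongr
        exact hpzp z hz t ht)
      (fun z hz t ht => by
        rw [norm_neg, norm_mul]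
        have h1 : ‖2 * p' z t + z * p'' z t‖ ≤ 2 * M' + M'' := by
          refine norm_add_le_of_le ?_ ((hzp z hz _).trans (hp''_bdd z hz t (hST ht)))
          rw [norm_mul, Complex.norm_ofNat]
          gcongr
          exact hp'_bdd z hz t (hST ht)
        exact mul_le_mul h1 (hfzN z hz t ht) (norm_nonneg _) (by positivity))
      hfzz0 hz).trans ?_
    rw [hC₃]
    have := hτ.2.le
    gcongr
  exact fun z hz => ⟨E1 z hz, E2 τ ⟨hτ0, le_rfl⟩ z hz, E3 z hz⟩

/-- If `g` and its complex derivative extend continuously to the closed disk, then the extension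
of `g` is differentiable along the unit circle with the expected derivative. -/
theorem hasDerivAt_comp_exp_I_mul {g g' : ℂ → ℂ}
    (hg : ∀ z ∈ Metric.ball (0 : ℂ) 1, HasDerivAt g (g' z) z)
    (hgc : ContinuousOn g (Metric.closedBall 0 1)) (hgc' : ContinuousOn g' (Metric.closedBall 0 1))
    (φ : ℝ) :
    HasDerivAt (fun φ : ℝ => g (Complex.exp (Complex.I * φ)))
      (Complex.I * Complex.exp (Complex.I * φ) * g' (Complex.exp (Complex.I * φ))) φ := by
  have hmem : ∀ φ : ℝ, Complex.exp (Complex.I * φ) ∈ Metric.closedBall (0 : ℂ) 1 := fun φ => by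
    simp [mul_comm Complex.I, Complex.norm_exp_ofReal_mul_I]
  have hcl : closure (Metric.ball (0 : ℂ) 1) = Metric.closedBall 0 1 := closure_ball _ one_ne_zero
  set x := Complex.exp (Complex.I * φ) with hx
  have hF : HasFDerivWithinAt g (g' x • (1 : ℂ →L[ℝ] ℂ)) (Metric.closedBall 0 1) x := by
    rw [← hcl]
    refine hasFDerivWithinAt_closure_of_tendsto_fderiv
      (fun z hz => (hg z hz).complexToReal_fderiv.differentiableAt.differentiableWithinAt)
      (convex_ball _ _) Metric.isOpen_ball
      (fun y hy => (hgc y (hcl ▸ hy)).mono Metric.ball_subset_closedBall) ?_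
    have h1 : Filter.Tendsto g' (nhdsWithin x (Metric.ball 0 1)) (nhds (g' x)) :=
      (hgc' x (hmem φ)).mono Metric.ball_subset_closedBall
    refine (h1.smul_const (1 : ℂ →L[ℝ] ℂ)).congr' ?_
    filter_upwards [self_mem_nhdsWithin] with z hz
    exact (hg z hz).complexToReal_fderiv.fderiv.symm
  have hE : HasDerivAt (fun φ : ℝ => Complex.exp (Complex.I * φ)) (x * (Complex.I * 1)) φ :=
    ((Complex.ofRealCLM.hasDerivAt (x := φ)).const_mul Complex.I).cexp
  have := hF.comp_hasDerivAt φ hE (Filter.Eventually.of_forall hmem)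
  refine this.congr_deriv ?_
  simp
  ring

/-- If a nonvanishing curve is written in polar form with continuous angle and radius, then the
angle is differentiable wherever the curve is. -/
theorem hasDerivAt_angle_of_polar {F : ℝ → ℂ} {F' : ℂ} {ρ ψ : ℝ → ℝ} {a : ℝ}
    (hρ : Continuous ρ) (hψ : Continuous ψ)
    (hF : ∀ φ, F φ = (ρ (ψ φ) : ℂ) * Complex.exp (Complex.I * (ψ φ : ℂ)))
    (ha : F a ≠ 0) (hF' : HasDerivAt F F' a) :
    HasDerivAt ψ ((F' / F a).im) a := by
  have hρa : ρ (ψ a) ≠ 0 := by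
    intro h; apply ha; rw [hF, h]; simp
  have hd : HasDerivAt (fun φ => F φ / F a) (F' / F a) a := hF'.div_const _
  have hl : HasDerivAt (fun φ => Complex.log (F φ / F a)) (F' / F a) a := by
    have := hd.clog_real (by rw [div_self ha]; exact Complex.one_mem_slitPlane)
    simpa [div_self ha] using this
  have hi : HasDerivAt (fun φ => ψ a + (Complex.log (F φ / F a)).im) ((F' / F a).im) a :=
    (Complex.imCLM.hasFDerivAt.comp_hasDerivAt a hl).const_add (ψ a)
  refine hi.congr_of_eventuallyEq ?_
  have e1 : ∀ᶠ φ in nhds a, 0 < ρ (ψ φ) / ρ (ψ a) := by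
    have hc : ContinuousAt (fun φ => ρ (ψ φ) / ρ (ψ a)) a := by fun_prop
    exact hc.eventually (lt_mem_nhds (by simp [div_self hρa]))
  have e2 : ∀ᶠ φ in nhds a, ψ φ - ψ a ∈ Set.Ioo (-Real.pi) Real.pi := by
    have hc : ContinuousAt (fun φ => ψ φ - ψ a) a := by fun_prop
    exact hc.eventually (Ioo_mem_nhds (by simp [Real.pi_pos]) (by simp [Real.pi_pos]))
  filter_upwards [e1, e2] with φ h1 h2
  have h3 : F φ / F a =
      ((ρ (ψ φ) / ρ (ψ a) : ℝ) : ℂ) * Complex.exp (((ψ φ - ψ a : ℝ) : ℂ) * Complex.I) := by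
    have : ((ψ φ - ψ a : ℝ) : ℂ) * Complex.I
        = Complex.I * (ψ φ : ℂ) - Complex.I * (ψ a : ℂ) := by push_cast; ring
    rw [this, Complex.exp_sub, hF φ, hF a]
    push_cast
    rw [mul_div_mul_comm]
  have h4 : (Complex.log (Complex.exp (((ψ φ - ψ a : ℝ) : ℂ) * Complex.I))).im = ψ φ - ψ a := by
    rw [Complex.log_exp (by simpa using h2.1) (by simpa using h2.2.le)]
    simp
  rw [h3, Complex.log_im, Complex.arg_real_mul _ h1, ← Complex.log_im, h4]
  ring

/-- A differentiable function on the line whose derivative is at least `1 / 2` is onto. -/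
theorem surjective_of_half_le_deriv {ψ ψ' : ℝ → ℝ} (hψ : ∀ x, HasDerivAt ψ (ψ' x) x)
    (hψ' : ∀ x, 1 / 2 ≤ ψ' x) : Function.Surjective ψ := by
  have hmono : Monotone (fun x => ψ x - 1 / 2 * x) := by
    have hd : ∀ x, HasDerivAt (fun x => ψ x - 1 / 2 * x) (ψ' x - 1 / 2 * 1) x := fun x =>
      (hψ x).sub ((hasDerivAt_id x).const_mul (1 / 2))
    refine monotone_of_deriv_nonneg (fun x => (hd x).differentiableAt) fun x => ?_
    rw [(hd x).deriv]
    linarith [hψ' x]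
  refine Continuous.surjective (continuous_iff_continuousAt.2 fun x => (hψ x).continuousAt) ?_ ?_
  · refine Filter.tendsto_atTop_mono' _ ?_ (Filter.tendsto_atTop_add_const_left _ (ψ 0)
      (Filter.tendsto_id.const_mul_atTop (show (0 : ℝ) < 1 / 2 by norm_num)))
    filter_upwards [Filter.eventually_ge_atTop 0] with x hx
    have := hmono hx
    simp only [id]
    simp only at this
    linarith
  · refine Filter.tendsto_atBot_mono' _ ?_ (Filter.tendsto_atBot_add_const_left _ (ψ 0)
      (Filter.tendsto_id.const_mul_atBot (show (0 : ℝ) < 1 / 2 by norm_num)))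
    filter_upwards [Filter.eventually_le_atBot 0] with x hx
    have := hmono hx
    simp only [id]
    simp only at this
    linarith

/-- A curve `F = (1 - δ(ψ)) e^{iψ}` whose logarithmic derivative `q` is close to `i` and slowly
varying has a polar defect `δ` with small second derivative. -/
theorem abs_polar_second_deriv_le {F q q' : ℝ → ℂ} {ψ δ δ' δ'' : ℝ → ℝ} {ε : ℝ}
    (hε : ε ≤ 1 / 100) (hψ : Continuous ψ)
    (hF : ∀ φ, F φ = ((1 - δ (ψ φ) : ℝ) : ℂ) * Complex.exp (Complex.I * (ψ φ : ℂ)))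
    (hδ' : ∀ x, HasDerivAt δ (δ' x) x) (hδ'' : ∀ x, HasDerivAt δ' (δ'' x) x)
    (hF' : ∀ φ, HasDerivAt F (q φ * F φ) φ) (hq' : ∀ φ, HasDerivAt q (q' φ) φ)
    (hF0 : ∀ φ, F φ ≠ 0) (hF2 : ∀ φ, ‖F φ‖ ≤ 2)
    (hqI : ∀ φ, ‖q φ - Complex.I‖ ≤ 4 * ε) (hq'I : ∀ φ, ‖q' φ‖ ≤ 24 * ε) (x : ℝ) :
    |δ'' x| ≤ 212 * ε := by
  have hψ' : ∀ φ, HasDerivAt ψ (q φ).im φ := fun φ => by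
    have := hasDerivAt_angle_of_polar (ρ := fun x => 1 - δ x)
      (continuous_const.sub (continuous_iff_continuousAt.2 fun x => (hδ' x).continuousAt))
      hψ hF (hF0 φ) (hF' φ)
    rwa [mul_div_cancel_right₀ _ (hF0 φ)] at this
  have hre : ∀ φ, |(q φ).re| ≤ 4 * ε := fun φ => by
    simpa using (Complex.abs_re_le_norm _).trans (hqI φ)
  have him : ∀ φ, |(q φ).im - 1| ≤ 4 * ε := fun φ => by
    simpa using (Complex.abs_im_le_norm _).trans (hqI φ)
  have him' : ∀ φ, 24 / 25 ≤ (q φ).im ∧ (q φ).im ≤ 26 / 25 := fun φ => by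
    have := abs_le.1 (him φ)
    constructor <;> linarith
  obtain ⟨φ, rfl⟩ := surjective_of_half_le_deriv hψ' (fun φ => by linarith [(him' φ).1]) x
  have hρ : ∀ φ, HasDerivAt (fun φ => 1 - δ (ψ φ)) (-(δ' (ψ φ) * (q φ).im)) φ := fun φ =>
    ((hδ' (ψ φ)).comp φ (hψ' φ)).const_sub 1
  have key : ∀ φ, δ' (ψ φ) * (q φ).im = -((q φ).re * (1 - δ (ψ φ))) := fun φ => by
    have h1 := (hF' φ).unique <| HasDerivAt.congr_of_eventuallyEq
      ((hρ φ).ofReal_comp.mul (((hψ' φ).ofReal_comp.const_mul Complex.I).cexp))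
      (Filter.Eventually.of_forall hF)
    rw [hF φ] at h1
    have h2 : q φ * ((1 - δ (ψ φ) : ℝ) : ℂ) = ((-(δ' (ψ φ) * (q φ).im) : ℝ) : ℂ)
        + ((1 - δ (ψ φ) : ℝ) : ℂ) * (Complex.I * ((q φ).im : ℂ)) := by
      apply mul_right_cancel₀ (Complex.exp_ne_zero (Complex.I * (ψ φ : ℂ)))
      linear_combination h1
    have h3 := congrArg Complex.re h2
    simp only [Complex.re_mul_ofReal, Complex.add_re, Complex.ofReal_re, Complex.re_ofReal_mul,
      Complex.I_re, zero_mul, mul_zero] at h3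
    linarith
  have hre' : HasDerivAt (fun φ => (q φ).re) (q' φ).re φ :=
    Complex.reCLM.hasFDerivAt.comp_hasDerivAt φ (hq' φ)
  have hqi' : HasDerivAt (fun φ => (q φ).im) (q' φ).im φ :=
    Complex.imCLM.hasFDerivAt.comp_hasDerivAt φ (hq' φ)
  have hL := ((hδ'' (ψ φ)).comp φ (hψ' φ)).mul hqi'
  have hR := (hre'.mul (hρ φ)).neg
  have hE := hL.unique (hR.congr_of_eventuallyEq (Filter.Eventually.of_forall key))
  simp only [Function.comp] at hE
  have hρ2 : |1 - δ (ψ φ)| ≤ 2 := by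
    have := hF2 φ
    rwa [hF φ, norm_mul, mul_comm Complex.I, Complex.norm_exp_ofReal_mul_I, mul_one,
      Complex.norm_real] at this
  have hr := hre φ
  have hr' : |(q' φ).re| ≤ 24 * ε := (Complex.abs_re_le_norm _).trans (hq'I φ)
  have hi' : |(q' φ).im| ≤ 24 * ε := (Complex.abs_im_le_norm _).trans (hq'I φ)
  obtain ⟨hi1, hi2⟩ := him' φ
  have hk := key φ
  generalize (q φ).re = a at *
  generalize (q φ).im = b at *
  generalize (q' φ).re = a' at *
  generalize (q' φ).im = b' at *
  generalize 1 - δ (ψ φ) = ρ at *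
  generalize δ' (ψ φ) = d at *
  generalize δ'' (ψ φ) = e at *
  have hε0 : 0 ≤ ε := by linarith [abs_nonneg a]
  have hd : |d| ≤ 16 * ε := by
    have h1 : |d| * b = |a| * |ρ| := by
      have hb : |b| = b := abs_of_pos (by linarith)
      rw [← abs_mul a, ← abs_neg (a * ρ), ← hk, abs_mul, hb]
    have h2 : |a| * |ρ| ≤ 4 * ε * 2 := by gcongr
    nlinarith [abs_nonneg d]
  have h1 : e * (b * b) = -(a' * ρ) + a * (d * b) - d * b' := by linarith
  have h2 : |e| * (b * b) ≤ 24 * ε * 2 + 4 * ε * (16 * ε * (26 / 25)) + 16 * ε * (24 * ε) := by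
    calc |e| * (b * b) = |e * (b * b)| := by rw [abs_mul, abs_of_nonneg (mul_self_nonneg b)]
      _ ≤ |a'| * |ρ| + |a| * (|d| * |b|) + |d| * |b'| := by
          rw [h1]
          refine (abs_sub _ _).trans ?_
          rw [abs_mul d]
          gcongr
          refine (abs_add_le _ _).trans ?_
          rw [abs_neg, abs_mul, abs_mul, abs_mul]
      _ ≤ _ := by
          have : |b| ≤ 26 / 25 := abs_le.2 ⟨by linarith, hi2⟩
          gcongr
  have h3 : 1 / 2 ≤ b * b := by nlinarith
  have h4 : |e| * (1 / 2) ≤ |e| * (b * b) := by gcongr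
  nlinarith

/-- Logarithmic derivative of a curve close to the unit circle in the `C²` sense. -/
theorem norm_logDeriv_sub_I_le {w a b c : ℂ} {ε : ℝ} (hε : ε ≤ 1 / 100) (hw : ‖w‖ = 1)
    (ha : ‖a - w‖ ≤ ε) (hb : ‖b - 1‖ ≤ ε) (hc : ‖c‖ ≤ ε) :
    (1 / 2 ≤ ‖a‖ ∧ ‖a‖ ≤ 2) ∧ ‖Complex.I * w * b / a - Complex.I‖ ≤ 4 * ε ∧
      ‖((Complex.I * (Complex.I * w) * b + Complex.I * w * (Complex.I * w * c)) * a
        - Complex.I * w * b * (Complex.I * w * b)) / a ^ 2‖ ≤ 24 * ε := by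
  have hε0 : 0 ≤ ε := (norm_nonneg _).trans ha
  have ha1 : 99 / 100 ≤ ‖a‖ := by
    have := norm_sub_norm_le w a
    rw [norm_sub_rev, hw] at this
    linarith
  have ha2 : ‖a‖ ≤ 101 / 100 := by
    have := norm_sub_norm_le a w
    rw [hw] at this
    linarith
  have hb2 : ‖b‖ ≤ 101 / 100 := by
    have := norm_sub_norm_le b 1
    rw [norm_one] at this
    linarith
  have ha0 : a ≠ 0 := norm_pos_iff.1 (by linarith)
  have hd : ‖w * b - a‖ ≤ 2 * ε := by
    calc ‖w * b - a‖ = ‖w * (b - 1) - (a - w)‖ := by ring_nf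
      _ ≤ ‖w * (b - 1)‖ + ‖a - w‖ := norm_sub_le _ _
      _ ≤ 1 * ε + ε := by rw [norm_mul, hw]; gcongr
      _ = 2 * ε := by ring
  refine ⟨⟨by linarith, by linarith⟩, ?_, ?_⟩
  · have : Complex.I * w * b / a - Complex.I = Complex.I * (w * b - a) / a := by
      field_simp
    rw [this, norm_div, norm_mul, Complex.norm_I, one_mul, div_le_iff₀ (by linarith)]
    nlinarith
  · have : (Complex.I * (Complex.I * w) * b + Complex.I * w * (Complex.I * w * c)) * a
        - Complex.I * w * b * (Complex.I * w * b) = w * (b * (w * b - a)) - w * (w * (c * a)) := by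
      linear_combination (w * b * a + w * w * c * a - w * w * b * b) * Complex.I_mul_I
    rw [this, norm_div, norm_pow, div_le_iff₀ (by positivity)]
    have h1 : ‖w * (b * (w * b - a)) - w * (w * (c * a))‖
        ≤ 101 / 100 * (2 * ε) + ε * (101 / 100) := by
      refine (norm_sub_le _ _).trans ?_
      rw [norm_mul, norm_mul w (w * _), norm_mul w (c * a), hw, norm_mul, norm_mul c]
      simp only [one_mul]
      gcongr
    have h2 : (99 / 100) ^ 2 ≤ ‖a‖ ^ 2 := by gcongr
    nlinarith

/- STATEMENT 14 (Lemma 6): Under C² hypotheses on the Carathéodory driving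
function `p` (with `p`, `p'`, `p''` bounded), if the boundary curve
Γ(t) = f(∂𝔻,t) has polar equation r = 1 - δ_t(ψ), i.e.
`f(e^{iφ},t) = (1 - δ_t(ψ_t(φ)))·e^{iψ_t(φ)}` with ψ_t(φ) = arg f(e^{iφ},t)
(continuous increasing branch) and δ_t twice differentiable, then there exist
c₄ > 0 and t₀ > 0 such that |δ_t''(ψ)| < c₄·t for all 0 < t < t₀ and all ψ. -/
theorem loewner_kufarev_polar_second_derivative_bound
    (T : ℝ) (hT : 0 < T) (p p' p'' : ℂ → ℝ → ℂ)
    -- Carathéodory class driving function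
    (hp_hol : ∀ t ∈ Set.Ico (0:ℝ) T,
      DifferentiableOn ℂ (fun z => p z t) (Metric.ball (0:ℂ) 1))
    (hp_cont : ∀ t ∈ Set.Ico (0:ℝ) T,
      ContinuousOn (fun z => p z t) (Metric.closedBall (0:ℂ) 1))
    (hp_one : ∀ t ∈ Set.Ico (0:ℝ) T, p 0 t = 1)
    (hp_re : ∀ t ∈ Set.Ico (0:ℝ) T, ∀ z ∈ Metric.ball (0:ℂ) 1, 0 < (p z t).re)
    -- p(·,t) is C² on 𝔻̄, continuous in t, with p, p', p'' bounded
    (hp' : ∀ t ∈ Set.Ico (0:ℝ) T, ∀ z ∈ Metric.ball (0:ℂ) 1,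
      HasDerivAt (fun x => p x t) (p' z t) z)
    (hp'' : ∀ t ∈ Set.Ico (0:ℝ) T, ∀ z ∈ Metric.ball (0:ℂ) 1,
      HasDerivAt (fun x => p' x t) (p'' z t) z)
    (hp'_cont : ∀ t ∈ Set.Ico (0:ℝ) T,
      ContinuousOn (fun z => p' z t) (Metric.closedBall (0:ℂ) 1))
    (hp''_cont : ∀ t ∈ Set.Ico (0:ℝ) T,
      ContinuousOn (fun z => p'' z t) (Metric.closedBall (0:ℂ) 1))
    (hp_t : ∀ z ∈ Metric.closedBall (0:ℂ) 1, ContinuousOn (fun t => p z t) (Set.Ico 0 T))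
    (M M' M'' : ℝ)
    (hp_bdd : ∀ z ∈ Metric.closedBall (0:ℂ) 1, ∀ t ∈ Set.Ico (0:ℝ) T, ‖p z t‖ ≤ M)
    (hp'_bdd : ∀ z ∈ Metric.closedBall (0:ℂ) 1, ∀ t ∈ Set.Ico (0:ℝ) T, ‖p' z t‖ ≤ M')
    (hp''_bdd : ∀ z ∈ Metric.closedBall (0:ℂ) 1, ∀ t ∈ Set.Ico (0:ℝ) T, ‖p'' z t‖ ≤ M'')
    -- f solves the Löwner–Kufarev PDE; f, f', f'' extend continuously to 𝔻̄
    (f fz fzz : ℂ → ℝ → ℂ)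
    (hf_init : ∀ z ∈ Metric.ball (0:ℂ) 1, f z 0 = z)
    (hf_hol : ∀ t ∈ Set.Ico (0:ℝ) T,
      DifferentiableOn ℂ (fun z => f z t) (Metric.ball (0:ℂ) 1))
    (hf_inj : ∀ t ∈ Set.Ico (0:ℝ) T,
      Set.InjOn (fun z => f z t) (Metric.ball (0:ℂ) 1))
    (hf_cl : ∀ t ∈ Set.Ico (0:ℝ) T,
      ContinuousOn (fun z => f z t) (Metric.closedBall (0:ℂ) 1))
    (hfz : ∀ t ∈ Set.Ico (0:ℝ) T, ∀ z ∈ Metric.ball (0:ℂ) 1,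
      HasDerivAt (fun x => f x t) (fz z t) z)
    (hfzz : ∀ t ∈ Set.Ico (0:ℝ) T, ∀ z ∈ Metric.ball (0:ℂ) 1,
      HasDerivAt (fun x => fz x t) (fzz z t) z)
    (hfz_cl : ∀ t ∈ Set.Ico (0:ℝ) T,
      ContinuousOn (fun z => fz z t) (Metric.closedBall (0:ℂ) 1))
    (hfzz_cl : ∀ t ∈ Set.Ico (0:ℝ) T,
      ContinuousOn (fun z => fzz z t) (Metric.closedBall (0:ℂ) 1))
    (hf_pde : ∀ z ∈ Metric.ball (0:ℂ) 1, ∀ t ∈ Set.Ico (0:ℝ) T,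
      HasDerivWithinAt (fun u => f z u) (-(z * fz z t * p z t)) (Set.Ico 0 T) t)
    -- polar representation of Γ(t) = f(∂𝔻,t): for each t the angle function
    -- ψ t (a continuous increasing branch of arg f(e^{iφ},t)) and the twice
    -- differentiable polar defect δ t with derivatives δ' t, δ'' t
    (ψ δ δ' δ'' : ℝ → ℝ → ℝ)
    (hψ_cont : ∀ t ∈ Set.Ico (0:ℝ) T, Continuous (ψ t))
    (hψ_mono : ∀ t ∈ Set.Ico (0:ℝ) T, StrictMono (ψ t))
    (hpolar : ∀ t ∈ Set.Ico (0:ℝ) T, ∀ φ : ℝ,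
      f (Complex.exp (Complex.I * (φ:ℂ))) t =
        ((1 - δ t (ψ t φ) : ℝ) : ℂ) * Complex.exp (Complex.I * ((ψ t φ : ℝ) : ℂ)))
    (hδ' : ∀ t ∈ Set.Ico (0:ℝ) T, ∀ x : ℝ, HasDerivAt (δ t) (δ' t x) x)
    (hδ'' : ∀ t ∈ Set.Ico (0:ℝ) T, ∀ x : ℝ, HasDerivAt (δ' t) (δ'' t x) x) :
    ∃ c₄ > (0:ℝ), ∃ t₀ > (0:ℝ), t₀ ≤ T ∧ ∀ t, 0 < t → t < t₀ →
      ∀ x : ℝ, |δ'' t x| < c₄ * t := by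
  have hsub : Metric.ball (0 : ℂ) 1 ⊆ Metric.closedBall 0 1 := Metric.ball_subset_closedBall
  have h00 : (0 : ℂ) ∈ Metric.closedBall (0 : ℂ) 1 := Metric.mem_closedBall_self zero_le_one
  have h0T : (0 : ℝ) ∈ Set.Ico 0 T := ⟨le_rfl, hT⟩
  obtain ⟨C, hC, hest⟩ := loewner_kufarev_interior_estimates hp_re hp' hp''
    ((norm_nonneg _).trans (hp_bdd 0 h00 0 h0T)) ((norm_nonneg _).trans (hp'_bdd 0 h00 0 h0T))
    ((norm_nonneg _).trans (hp''_bdd 0 h00 0 h0T)) (fun z hz => hp_bdd z (hsub hz))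
    (fun z hz => hp'_bdd z (hsub hz)) (fun z hz => hp''_bdd z (hsub hz)) hf_init hf_inj hfz hfzz
    hf_pde
  refine ⟨213 * C, by positivity, min T (1 / (100 * C)), lt_min hT (by positivity),
    min_le_left _ _, fun t ht0 ht x => ?_⟩
  have htT : t < T := ht.trans_le (min_le_left _ _)
  have htC : C * t ≤ 1 / 100 := by
    have := (lt_div_iff₀ (by positivity)).1 (ht.trans_le (min_le_right _ _))
    linarith
  have htI : t ∈ Set.Ico 0 T := ⟨ht0.le, htT⟩
  have hcl : closure (Metric.ball (0 : ℂ) 1) = Metric.closedBall 0 1 := closure_ball _ one_ne_zero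
  have hbd : ∀ g : ℂ → ℂ, ContinuousOn g (Metric.closedBall 0 1) →
      (∀ z ∈ Metric.ball (0 : ℂ) 1, ‖g z‖ ≤ C * t) → ∀ φ : ℝ,
        ‖g (Complex.exp (Complex.I * φ))‖ ≤ C * t := fun g hg hgb φ => by
    rw [← hcl] at hg
    refine le_on_closure (f := fun z => ‖g z‖) hgb hg.norm continuousOn_const ?_
    rw [hcl]
    simp [mul_comm Complex.I, Complex.norm_exp_ofReal_mul_I]
  have hF := hbd (fun z => f z t - z) ((hf_cl t htI).sub continuousOn_id)
    fun z hz => (hest t ⟨ht0, htT⟩ z hz).1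
  have hG := hbd (fun z => fz z t - 1) ((hfz_cl t htI).sub continuousOn_const)
    fun z hz => (hest t ⟨ht0, htT⟩ z hz).2.1
  have hH := hbd (fun z => fzz z t) (hfzz_cl t htI) fun z hz => (hest t ⟨ht0, htT⟩ z hz).2.2
  have hlog := fun φ : ℝ => norm_logDeriv_sub_I_le htC
    (by simp [mul_comm Complex.I, Complex.norm_exp_ofReal_mul_I]) (hF φ) (hG φ) (hH φ)
  have hne : ∀ φ : ℝ, f (Complex.exp (Complex.I * φ)) t ≠ 0 := fun φ =>
    norm_pos_iff.1 (by linarith [(hlog φ).1.1])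
  have hdF := hasDerivAt_comp_exp_I_mul (hfz t htI) (hf_cl t htI) (hfz_cl t htI)
  have hdG := hasDerivAt_comp_exp_I_mul (hfzz t htI) (hfz_cl t htI) (hfzz_cl t htI)
  have hdE : ∀ φ : ℝ, HasDerivAt (fun φ : ℝ => Complex.I * Complex.exp (Complex.I * φ))
      (Complex.I * (Complex.I * Complex.exp (Complex.I * φ))) φ := fun φ => by
    refine (((Complex.ofRealCLM.hasDerivAt (x := φ)).const_mul
      Complex.I).cexp.const_mul Complex.I).congr_deriv ?_
    simp
    ring
  have := abs_polar_second_deriv_le htC (hψ_cont t htI) (hpolar t htI) (hδ' t htI) (hδ'' t htI)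
    (fun φ => (hdF φ).congr_deriv (div_mul_cancel₀ _ (hne φ)).symm)
    (fun φ => ((hdE φ).mul (hdG φ)).div (hdF φ) (hne φ))
    hne (fun φ => (hlog φ).1.2) (fun φ => (hlog φ).2.1) (fun φ => (hlog φ).2.2) x
  nlinarith [mul_pos hC ht0]
end

section
/- Let p be a driving function from the Carathéodory class, C¹ on 𝔻̄ for each t, with p(z,·) continuous on [0,T) uniformly in z ∈ 𝔻̄ and p, p' = ∂p/∂z bounded on 𝔻̄ × [0,T). Let f(z,t) solve the Löwner–Kufarev PDE ∂f/∂t = -z·(∂f/∂z)·p(z,t), f(z,0) = z, each f(·,t) univalent on 𝔻 and extended continuously to 𝔻̄. Then the boundary values satisfy the uniform first-order expansion f(e^{iφ},t) = e^{iφ}·(1 - p(e^{iφ},0)·t) + o(t) as t → 0+, uniformly in φ ∈ [0,2π]; that is, sup_{φ∈[0,2π]} |f(e^{iφ},t) - e^{iφ} + e^{iφ}·p(e^{iφ},0)·t| / t → 0 as t → 0+. In particular |f(e^{iφ},t)| = 1 - Re p(e^{iφ},0)·t + o(t) and arg f(e^{iφ},t) = φ - Im p(e^{iφ},0)·t + o(t),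 uniformly in φ. -/
open Set Filter Topology Metric

/-- Pointwise bounded families of continuous functions on an open set are uniformly bounded on some
ball. -/
theorem exists_ball_forall_norm_le_of_pointwise_bounded {ι E F : Type*} [MetricSpace E]
    [CompleteSpace E] [NormedAddCommGroup F] {U : Set E} (hU : IsOpen U) (hne : U.Nonempty)
    {g : ι → E → F} (hg : ∀ i, ContinuousOn (g i) U) (hb : ∀ z ∈ U, ∃ C : ℝ, ∀ i, ‖g i z‖ ≤ C) :
    ∃ z₀, ∃ r > 0, ∃ C : ℝ, ball z₀ r ⊆ U ∧ ∀ i, ∀ z ∈ ball z₀ r, ‖g i z‖ ≤ C := by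
  obtain ⟨a, ha⟩ := hne
  obtain ⟨R, hR, hRU⟩ := nhds_basis_closedBall.mem_iff.1 (hU.mem_nhds ha)
  set G : ℕ → Set E := fun n =>
    (⋂ i, closedBall a R ∩ g i ⁻¹' closedBall 0 n) ∪ (ball a R)ᶜ with hG
  have hclosed : ∀ n, IsClosed (G n) := fun n =>
    (isClosed_iInter fun i => ((hg i).mono hRU).preimage_isClosed_of_isClosed
      isClosed_closedBall isClosed_closedBall).union isOpen_ball.isClosed_compl
  have hcover : ⋃ n, G n = univ := by
    refine eq_univ_of_forall fun z => ?_
    by_cases hz : z ∈ ball a R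
    · obtain ⟨C, hC⟩ := hb z (hRU (ball_subset_closedBall hz))
      obtain ⟨n, hn⟩ := exists_nat_ge C
      refine mem_iUnion.2 ⟨n, Or.inl (mem_iInter.2 fun i => ⟨ball_subset_closedBall hz, ?_⟩)⟩
      simpa using (hC i).trans hn
    · exact mem_iUnion.2 ⟨0, Or.inr hz⟩
  obtain ⟨z₀, hz₀, hz₀'⟩ := (dense_iUnion_interior_of_closed hclosed hcover).inter_open_nonempty
    (ball a R) isOpen_ball ⟨a, mem_ball_self hR⟩
  obtain ⟨n, hn⟩ := mem_iUnion.1 hz₀'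
  obtain ⟨r, hr, hrsub⟩ := Metric.mem_nhds_iff.1
    (inter_mem (isOpen_ball.mem_nhds hz₀) (isOpen_interior.mem_nhds hn))
  refine ⟨z₀, r, hr, n, fun z hz => hRU (ball_subset_closedBall (hrsub hz).1), fun i z hz => ?_⟩
  rcases interior_subset (hrsub hz).2 with h | h
  · simpa using (mem_iInter.1 h i).2
  · exact absurd (hrsub hz).1 h

/-- A bounded holomorphic function has bounded derivative on smaller balls. -/
theorem norm_deriv_le_of_norm_le_ball {g : ℂ → ℂ} {c z : ℂ} {R r C : ℝ} (hr : r < R)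
    (hg : DifferentiableOn ℂ g (ball c R)) (hC : ∀ x ∈ ball c R, ‖g x‖ ≤ C) (hz : z ∈ ball c r) :
    ‖deriv g z‖ ≤ C / (R - r) := by
  have hsub : closedBall z (R - r) ⊆ ball c R := fun x hx => by
    rw [mem_ball] at hz ⊢
    rw [mem_closedBall] at hx
    linarith [dist_triangle x z c]
  refine Complex.norm_deriv_le_of_forall_mem_sphere_norm_le (sub_pos.2 hr) ?_
    fun x hx => hC x (hsub (sphere_subset_closedBall hx))
  exact (hg.mono (closure_ball_subset_closedBall.trans hsub)).diffContOnCl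

theorem norm_sub_le_of_norm_le_ball {g : ℂ → ℂ} {c x y : ℂ} {R r C : ℝ} (hr : r < R)
    (hg : DifferentiableOn ℂ g (ball c R)) (hC : ∀ x ∈ ball c R, ‖g x‖ ≤ C)
    (hx : x ∈ ball c r) (hy : y ∈ ball c r) :
    ‖g x - g y‖ ≤ C / (R - r) * ‖x - y‖ :=
  (convex_ball c r).norm_image_sub_le_of_norm_deriv_le (𝕜 := ℂ)
    (fun _ hw => hg.differentiableAt (isOpen_ball.mem_nhds (ball_subset_ball hr.le hw)))
    (fun _ hw => norm_deriv_le_of_norm_le_ball hr hg hC hw) hy hx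

/-- Holomorphy of a parametric integral whose integrand is bounded, holomorphic in the parameter
and continuous in the variable of integration. -/
theorem differentiableOn_intervalIntegral_of_norm_le {U : Set ℂ} (hU : IsOpen U) {K : ℂ → ℝ → ℂ}
    {M : ℝ} (hK : ∀ σ, DifferentiableOn ℂ (fun z => K z σ) U) (hKc : ∀ z ∈ U, Continuous (K z))
    (hM : ∀ z ∈ U, ∀ σ, ‖K z σ‖ ≤ M) (a b : ℝ) :
    DifferentiableOn ℂ (fun z => ∫ σ in a..b, K z σ) U := by
  intro z hz
  obtain ⟨R, hR, hRU⟩ := Metric.mem_nhds_iff.1 (hU.mem_nhds hz)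
  have hderiv : ∀ x ∈ ball z (R / 2), ∀ σ,
      HasDerivAt (fun z => K z σ) (deriv (fun z => K z σ) x) x := fun x hx σ =>
    ((hK σ).differentiableAt (hU.mem_nhds
      (hRU (ball_subset_ball (by linarith) hx)))).hasDerivAt
  have hnhds : ball z (R / 2) ∈ 𝓝 z := ball_mem_nhds _ (by linarith)
  refine (intervalIntegral.hasDerivAt_integral_of_dominated_loc_of_deriv_le
    (F' := fun x σ => deriv (fun z => K z σ) x) (bound := fun _ => M / (R - R / 2)) hnhds ?_
    ((hKc z hz).intervalIntegrable _ _) ?_ ?_ intervalIntegrable_const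
    ?_).2.differentiableAt.differentiableWithinAt
  · filter_upwards [hU.mem_nhds hz] with x hx using (hKc x hx).aestronglyMeasurable
  · set x : ℕ → ℂ := fun n => z + ((R / 2 / (n + 1) : ℝ) : ℂ) with hx
    have hxz : ∀ n, x n ≠ z := fun n => by
      have : (0:ℝ) < R / 2 / (n + 1) := by positivity
      simp only [hx, ne_eq, add_eq_left, Complex.ofReal_eq_zero]
      exact this.ne'
    have hxU : ∀ n, x n ∈ U := fun n => hRU <| by
      have : (0:ℝ) < R / 2 / (n + 1) := by positivity
      rw [mem_ball, dist_eq_norm, hx, add_sub_cancel_left, Complex.norm_real, Real.norm_eq_abs,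
        abs_of_pos this]
      calc R / 2 / (n + 1) ≤ R / 2 :=
            div_le_self (by linarith) (by linarith [n.cast_nonneg (α := ℝ)])
        _ < R := by linarith
    have hlim : Tendsto x atTop (𝓝[≠] z) := by
      refine tendsto_nhdsWithin_iff.2 ⟨?_, Eventually.of_forall hxz⟩
      have h0 : Tendsto (fun n : ℕ => R / 2 / ((n : ℝ) + 1)) atTop (𝓝 0) :=
        tendsto_const_nhds.div_atTop (tendsto_atTop_add_const_right _ _ tendsto_natCast_atTop_atTop)
      simpa [hx] using ((Complex.continuous_ofReal.tendsto 0).comp h0).const_add z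
    refine aestronglyMeasurable_of_tendsto_ae atTop
      (f := fun n σ => slope (fun w => K w σ) z (x n)) (fun n => ?_)
      (MeasureTheory.ae_of_all _ fun σ => (hasDerivAt_iff_tendsto_slope.1
        (hderiv z (mem_ball_self (by linarith)) σ)).comp hlim)
    simp only [slope_def_field]
    exact (((hKc _ (hxU n)).sub (hKc z hz)).div_const _).aestronglyMeasurable
  · exact MeasureTheory.ae_of_all _ fun σ _ x hx => norm_deriv_le_of_norm_le_ball (by linarith)
      ((hK σ).mono hRU) (fun y hy => hM y (hRU hy) σ) hx
  · exact MeasureTheory.ae_of_all _ fun σ _ x hx => hderiv x hx σ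

theorem Complex.norm_exp_sub_exp_le_of_re_nonpos {a b : ℂ} (ha : a.re ≤ 0) (hb : b.re ≤ 0) :
    ‖Complex.exp a - Complex.exp b‖ ≤ ‖a - b‖ := by
  have h := (convex_halfSpace_re_le 0).norm_image_sub_le_of_norm_deriv_le (𝕜 := ℂ) (f := Complex.exp)
    (C := 1) (fun _ _ => Complex.differentiableAt_exp) (fun x hx => ?_) hb ha
  · simpa using h
  · rw [Complex.deriv_exp, Complex.norm_exp]
    exact Real.exp_le_one_iff.2 hx

theorem continuous_comp_of_lipschitz {Q : ℂ → ℝ → ℂ} {U : Set ℂ} {L : ℝ}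
    (hQc : ∀ z ∈ U, Continuous (Q z))
    (hlip : ∀ σ, ∀ x ∈ U, ∀ y ∈ U, ‖Q x σ - Q y σ‖ ≤ L * ‖x - y‖)
    {w : ℝ → ℂ} (hw : Continuous w) (hwU : ∀ σ, w σ ∈ U) : Continuous fun σ => Q (w σ) σ := by
  have h : ContinuousOn (fun x : ℂ × ℝ => Q x.1 x.2) (U ×ˢ univ) := by
    refine continuousOn_prod_of_continuousOn_lipschitzOnWith _ L.toNNReal
      (fun z hz => (hQc z hz).continuousOn) fun σ _ => ?_
    refine LipschitzOnWith.of_dist_le_mul fun x hx y hy => ?_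
    rw [dist_eq_norm, dist_eq_norm]
    exact (hlip σ x hx y hy).trans (by gcongr; exact Real.le_coe_toNNReal L)
  exact h.comp_continuous (hw.prodMk continuous_id) fun σ => ⟨hwU σ, mem_univ _⟩

/-- Picard iterates, in exponential form, of the Löwner ordinary differential equation
`w' = -w Q(w, s)`, `w(0) = z` on `[0, t]`. -/
noncomputable def loewnerPicard (Q : ℂ → ℝ → ℂ) (t : ℝ) : ℕ → ℂ → ℝ → ℂ
  | 0, z, _ => z
  | n + 1, z, s =>
    z * Complex.exp (-∫ σ in (0:ℝ)..max 0 (min s t), Q (loewnerPicard Q t n z σ) σ)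

section LoewnerFlow

variable {Q : ℂ → ℝ → ℂ} {L M t : ℝ}

theorem re_neg_integral_nonpos {k : ℝ → ℂ} {a : ℝ} (ha : 0 ≤ a) (hk : Continuous k)
    (hre : ∀ σ, 0 ≤ (k σ).re) : (-∫ σ in (0:ℝ)..a, k σ).re ≤ 0 := by
  rw [Complex.neg_re, ← Complex.reCLM_apply, ← Complex.reCLM.intervalIntegral_comp_comm
    (hk.intervalIntegrable (μ := MeasureTheory.volume) 0 a), neg_nonpos]
  exact intervalIntegral.integral_nonneg ha fun σ _ => hre σ

theorem norm_mul_exp_neg_integral_le {k : ℝ → ℂ} {a : ℝ} (ha : 0 ≤ a) (hk : Continuous k)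
    (hre : ∀ σ, 0 ≤ (k σ).re) (z : ℂ) : ‖z * Complex.exp (-∫ σ in (0:ℝ)..a, k σ)‖ ≤ ‖z‖ := by
  rw [norm_mul, Complex.norm_exp]
  exact mul_le_of_le_one_right (norm_nonneg z) 
    (Real.exp_le_one_iff.2 (re_neg_integral_nonpos ha hk hre))

theorem norm_mul_exp_neg_integral_sub_le {k l : ℝ → ℂ} {a D : ℝ} (ha : 0 ≤ a) (hk : Continuous k)
    (hl : Continuous l) (hkre : ∀ σ, 0 ≤ (k σ).re) (hlre : ∀ σ, 0 ≤ (l σ).re)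
    (hD : ∀ σ, ‖k σ - l σ‖ ≤ D) {z : ℂ} (hz : z ∈ ball (0:ℂ) 1) :
    ‖z * Complex.exp (-∫ σ in (0:ℝ)..a, k σ) - z * Complex.exp (-∫ σ in (0:ℝ)..a, l σ)‖
      ≤ D * a := by
  have hint : ‖∫ σ in (0:ℝ)..a, (l σ - k σ)‖ ≤ D * |a - 0| :=
    intervalIntegral.norm_integral_le_of_norm_le_const fun σ _ => by
      rw [norm_sub_rev]; exact hD σ
  rw [sub_zero, abs_of_nonneg ha, intervalIntegral.integral_sub (hl.intervalIntegrable _ _)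
    (hk.intervalIntegrable _ _)] at hint
  have hexp := Complex.norm_exp_sub_exp_le_of_re_nonpos (re_neg_integral_nonpos ha hk hkre)
    (re_neg_integral_nonpos ha hl hlre)
  rw [show (-∫ σ in (0:ℝ)..a, k σ) - (-∫ σ in (0:ℝ)..a, l σ)
    = (∫ σ in (0:ℝ)..a, l σ) - ∫ σ in (0:ℝ)..a, k σ by ring] at hexp
  rw [← mul_sub, norm_mul]
  have hz1 : ‖z‖ ≤ 1 := (mem_ball_zero_iff.1 hz).le
  calc _ ≤ 1 * _ := by gcongr
    _ ≤ D * a := by rw [one_mul]; exact hexp.trans hint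

theorem loewnerPicard_spec (hQc : ∀ z ∈ ball (0:ℂ) 1, Continuous (Q z))
    (hre : ∀ z ∈ ball (0:ℂ) 1, ∀ σ, 0 ≤ (Q z σ).re)
    (hlip : ∀ σ, ∀ x ∈ ball (0:ℂ) 1, ∀ y ∈ ball (0:ℂ) 1, ‖Q x σ - Q y σ‖ ≤ L * ‖x - y‖)
    (n : ℕ) {z : ℂ} (hz : z ∈ ball (0:ℂ) 1) :
    Continuous (loewnerPicard Q t n z) ∧ ∀ s, ‖loewnerPicard Q t n z s‖ ≤ ‖z‖ := by
  induction n with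
  | zero => exact ⟨continuous_const, fun s => le_rfl⟩
  | succ n ih =>
    have hball : ∀ σ, loewnerPicard Q t n z σ ∈ ball (0:ℂ) 1 := fun σ =>
      mem_ball_zero_iff.2 ((ih.2 σ).trans_lt (mem_ball_zero_iff.1 hz))
    have hc := continuous_comp_of_lipschitz hQc hlip ih.1 hball
    refine ⟨?_, fun s => norm_mul_exp_neg_integral_le (le_max_left _ _) hc
      (fun σ => hre _ (hball σ) σ) z⟩
    have hprim : Continuous fun b => ∫ σ in (0:ℝ)..b, Q (loewnerPicard Q t n z σ) σ :=
      intervalIntegral.continuous_primitive (fun a b => hc.intervalIntegrable a b) 0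
    exact continuous_const.mul (Complex.continuous_exp.comp
      (hprim.comp (by fun_prop : Continuous fun s : ℝ => max 0 (min s t))).neg)

theorem differentiableOn_loewnerPicard
    (hQ : ∀ σ, DifferentiableOn ℂ (fun z => Q z σ) (ball 0 1))
    (hQc : ∀ z ∈ ball (0:ℂ) 1, Continuous (Q z))
    (hM : ∀ z ∈ ball (0:ℂ) 1, ∀ σ, ‖Q z σ‖ ≤ M)
    (hre : ∀ z ∈ ball (0:ℂ) 1, ∀ σ, 0 ≤ (Q z σ).re)
    (hlip : ∀ σ, ∀ x ∈ ball (0:ℂ) 1, ∀ y ∈ ball (0:ℂ) 1, ‖Q x σ - Q y σ‖ ≤ L * ‖x - y‖)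
    (n : ℕ) (s : ℝ) : DifferentiableOn ℂ (fun z => loewnerPicard Q t n z s) (ball 0 1) := by
  induction n generalizing s with
  | zero => exact differentiableOn_id
  | succ n ih =>
    have hball : ∀ z ∈ ball (0:ℂ) 1, ∀ σ, loewnerPicard Q t n z σ ∈ ball (0:ℂ) 1 := fun z hz σ =>
      mem_ball_zero_iff.2 (((loewnerPicard_spec hQc hre hlip n hz).2 σ).trans_lt
        (mem_ball_zero_iff.1 hz))
    have hint := differentiableOn_intervalIntegral_of_norm_le isOpen_ball
      (K := fun z σ => Q (loewnerPicard Q t n z σ) σ)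
      (fun σ => (hQ σ).comp (ih σ) fun z hz => hball z hz σ)
      (fun z hz => continuous_comp_of_lipschitz hQc hlip (loewnerPicard_spec hQc hre hlip n hz).1
        (hball z hz)) (fun z hz σ => hM _ (hball z hz σ) σ) 0 (max 0 (min s t))
    exact differentiableOn_id.mul hint.neg.cexp

theorem dist_loewnerPicard_succ_le (ht : 0 ≤ t) (hL : 0 ≤ L) (hLt : L * t ≤ 1 / 2)
    (hQc : ∀ z ∈ ball (0:ℂ) 1, Continuous (Q z))
    (hre : ∀ z ∈ ball (0:ℂ) 1, ∀ σ, 0 ≤ (Q z σ).re)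
    (hlip : ∀ σ, ∀ x ∈ ball (0:ℂ) 1, ∀ y ∈ ball (0:ℂ) 1, ‖Q x σ - Q y σ‖ ≤ L * ‖x - y‖)
    (n : ℕ) {z : ℂ} (hz : z ∈ ball (0:ℂ) 1) (s : ℝ) :
    dist (loewnerPicard Q t n z s) (loewnerPicard Q t (n + 1) z s) ≤ 2 * (1 / 2) ^ n := by
  have hspec := fun n => loewnerPicard_spec (t := t) hQc hre hlip n hz
  have hball : ∀ n σ, loewnerPicard Q t n z σ ∈ ball (0:ℂ) 1 := fun n σ =>
    mem_ball_zero_iff.2 (((hspec n).2 σ).trans_lt (mem_ball_zero_iff.1 hz))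
  induction n generalizing s with
  | zero =>
    have h1 := hball 0 s
    have h2 := hball 1 s
    rw [mem_ball_zero_iff] at h1 h2
    rw [dist_eq_norm]
    linarith [norm_sub_le (loewnerPicard Q t 0 z s) (loewnerPicard Q t 1 z s)]
  | succ n ih =>
    rw [dist_eq_norm]
    refine (norm_mul_exp_neg_integral_sub_le (D := L * (2 * (1 / 2) ^ n)) (le_max_left _ _)
      (continuous_comp_of_lipschitz hQc hlip (hspec n).1 (hball n))
      (continuous_comp_of_lipschitz hQc hlip (hspec (n + 1)).1 (hball (n + 1)))
      (fun σ => hre _ (hball n σ) σ) (fun σ => hre _ (hball (n + 1) σ) σ)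
      (fun σ => (hlip σ _ (hball n σ) _ (hball (n + 1) σ)).trans ?_) hz).trans ?_
    · rw [← dist_eq_norm]
      exact mul_le_mul_of_nonneg_left (ih σ) hL
    · have : max 0 (min s t) ≤ t := max_le ht (min_le_right _ _)
      calc L * (2 * (1 / 2) ^ n) * max 0 (min s t) ≤ L * (2 * (1 / 2) ^ n) * t := by gcongr
        _ = L * t * (2 * (1 / 2) ^ n) := by ring
        _ ≤ 1 / 2 * (2 * (1 / 2) ^ n) := by gcongr
        _ = 2 * (1 / 2) ^ (n + 1) := by ring

/-- Existence, for short time, of the flow of the Löwner ordinary differential equation, and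
its holomorphic dependence on the initial value. -/
theorem exists_loewner_flow (ht : 0 ≤ t) (hL : 0 ≤ L) (hLt : L * t ≤ 1 / 2)
    (hQ : ∀ σ, DifferentiableOn ℂ (fun z => Q z σ) (ball 0 1))
    (hQc : ∀ z ∈ ball (0:ℂ) 1, Continuous (Q z))
    (hM : ∀ z ∈ ball (0:ℂ) 1, ∀ σ, ‖Q z σ‖ ≤ M)
    (hre : ∀ z ∈ ball (0:ℂ) 1, ∀ σ, 0 ≤ (Q z σ).re)
    (hlip : ∀ σ, ∀ x ∈ ball (0:ℂ) 1, ∀ y ∈ ball (0:ℂ) 1, ‖Q x σ - Q y σ‖ ≤ L * ‖x - y‖) :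
    ∃ W : ℂ → ℝ → ℂ, (∀ s, DifferentiableOn ℂ (fun z => W z s) (ball 0 1)) ∧
      ∀ z ∈ ball (0:ℂ) 1, W z 0 = z ∧ (∀ s, W z s ∈ ball (0:ℂ) 1) ∧
        ∀ s ∈ Icc 0 t, HasDerivWithinAt (W z) (-(W z s * Q (W z s) s)) (Icc 0 t) s := by
  have hspec := fun n z hz => loewnerPicard_spec (t := t) (z := z) hQc hre hlip n hz
  have hgeom := fun z hz s n =>
    dist_loewnerPicard_succ_le (z := z) ht hL hLt hQc hre hlip n hz s
  have hhalf : (1 / 2 : ℝ) < 1 := by norm_num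
  have hex : ∀ z s, ∃ l, z ∈ ball (0:ℂ) 1 →
      Tendsto (fun n => loewnerPicard Q t n z s) atTop (𝓝 l) := fun z s => by
    by_cases hz : z ∈ ball (0:ℂ) 1
    · obtain ⟨l, hl⟩ := cauchySeq_tendsto_of_complete
        (cauchySeq_of_le_geometric _ _ hhalf (hgeom z hz s))
      exact ⟨l, fun _ => hl⟩
    · exact ⟨0, fun h => absurd h hz⟩
  choose W hW using hex
  have hdist : ∀ z ∈ ball (0:ℂ) 1, ∀ s n,
      dist (loewnerPicard Q t n z s) (W z s) ≤ 2 * (1 / 2) ^ n / (1 - 1 / 2) := fun z hz s n =>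
    dist_le_of_le_geometric_of_tendsto _ _ hhalf (hgeom z hz s) (hW z s hz) n
  have hzero : Tendsto (fun n : ℕ => (2 * (1 / 2) ^ n / (1 - 1 / 2) : ℝ)) atTop (𝓝 0) := by
    simpa using ((tendsto_pow_atTop_nhds_zero_of_lt_one (by norm_num) hhalf).const_mul
      (2:ℝ)).div_const (1 - 1 / 2)
  have hcont : ∀ z ∈ ball (0:ℂ) 1, Continuous (W z) := fun z hz => by
    refine TendstoUniformly.continuous (F := fun n => loewnerPicard Q t n z) (p := atTop) ?_
      (Frequently.of_forall fun n => (hspec n z hz).1)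
    refine Metric.tendstoUniformly_iff.2 fun ε hε => ?_
    filter_upwards [hzero.eventually (gt_mem_nhds hε)] with n hn s
    rw [dist_comm]
    exact (hdist z hz s n).trans_lt hn
  have hball : ∀ z ∈ ball (0:ℂ) 1, ∀ s, W z s ∈ ball (0:ℂ) 1 := fun z hz s =>
    mem_ball_zero_iff.2 ((le_of_tendsto (hW z s hz).norm (Eventually.of_forall fun n =>
      (hspec n z hz).2 s)).trans_lt (mem_ball_zero_iff.1 hz))
  have hfix : ∀ z ∈ ball (0:ℂ) 1, ∀ s,
      W z s = z * Complex.exp (-∫ σ in (0:ℝ)..max 0 (min s t), Q (W z σ) σ) := fun z hz s => by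
    refine tendsto_nhds_unique ((tendsto_add_atTop_iff_nat 1).2 (hW z s hz)) ?_
    rw [tendsto_iff_norm_sub_tendsto_zero]
    have hlim := (hzero.const_mul L).mul_const (max 0 (min s t))
    rw [mul_zero, zero_mul] at hlim
    refine squeeze_zero (fun n => norm_nonneg _) (fun n => ?_) hlim
    have hb : ∀ σ, loewnerPicard Q t n z σ ∈ ball (0:ℂ) 1 := fun σ =>
      mem_ball_zero_iff.2 (((hspec n z hz).2 σ).trans_lt (mem_ball_zero_iff.1 hz))
    refine norm_mul_exp_neg_integral_sub_le (le_max_left _ _)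
      (continuous_comp_of_lipschitz hQc hlip (hspec n z hz).1 hb)
      (continuous_comp_of_lipschitz hQc hlip (hcont z hz) (hball z hz))
      (fun σ => hre _ (hb σ) σ) (fun σ => hre _ (hball z hz σ) σ)
      (fun σ => (hlip σ _ (hb σ) _ (hball z hz σ)).trans ?_) hz
    rw [← dist_eq_norm]
    exact mul_le_mul_of_nonneg_left (hdist z hz σ n) hL
  refine ⟨W, fun s => ?_, fun z hz => ⟨?_, hball z hz, fun s hs => ?_⟩⟩
  · refine TendstoLocallyUniformlyOn.differentiableOn
      (F := fun n z => loewnerPicard Q t n z s) (φ := atTop) ?_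
      (Eventually.of_forall fun n => differentiableOn_loewnerPicard hQ hQc hM hre hlip n s)
      isOpen_ball
    refine TendstoUniformlyOn.tendstoLocallyUniformlyOn (Metric.tendstoUniformlyOn_iff.2
      fun ε hε => ?_)
    filter_upwards [hzero.eventually (gt_mem_nhds hε)] with n hn z hz
    rw [dist_comm]
    exact (hdist z hz s n).trans_lt hn
  · rw [hfix z hz, min_eq_left ht, max_self, intervalIntegral.integral_same, neg_zero,
      Complex.exp_zero, mul_one]
  · have hc := continuous_comp_of_lipschitz hQc hlip (hcont z hz) (hball z hz)
    have heq : ∀ x ∈ Icc 0 t, W z x = z * Complex.exp (-∫ σ in (0:ℝ)..x, Q (W z σ) σ) :=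
      fun x hx => by
        conv_lhs => rw [hfix z hz x, min_eq_left hx.2, max_eq_right hx.1]
    have hd := ((hc.integral_hasStrictDerivAt 0 s).hasDerivAt.neg.cexp.const_mul
      z).hasDerivWithinAt (s := Icc 0 t)
    refine (hd.congr heq (heq s hs)).congr_deriv ?_
    linear_combination Q (W z s) s * heq s hs

end LoewnerFlow

/-- Solutions of `∂f/∂t = -z f' p` that are bounded near `c` are constant along the reversed
characteristics, as long as these stay near `c`. -/
theorem eq_of_characteristic_of_norm_le {f fz p : ℂ → ℝ → ℂ} {c : ℂ} {R C M T τ t : ℝ}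
    (hR : 0 < R) (hcR : ball c R ⊆ ball 0 1) (hτ : τ < T) (ht : 0 ≤ t) (htτ : t ≤ τ)
    (hfz : ∀ σ ∈ Ico 0 T, ∀ z ∈ ball c R, HasDerivAt (fun x => f x σ) (fz z σ) z)
    (hpde : ∀ z ∈ ball c R, ∀ σ ∈ Ico 0 T,
      HasDerivWithinAt (f z) (-(z * fz z σ * p z σ)) (Ico 0 T) σ)
    (hp : ∀ z ∈ ball c R, ∀ σ ∈ Ico 0 T, ‖p z σ‖ ≤ M)
    (hC : ∀ σ ∈ Icc 0 τ, ∀ z ∈ ball c R, ‖f z σ‖ ≤ C) {w : ℝ → ℂ}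
    (hw : ∀ s ∈ Icc 0 t, HasDerivWithinAt w (-(w s * p (w s) (t - s))) (Icc 0 t) s)
    (hwc : ∀ s ∈ Icc 0 t, w s ∈ ball c (R / 2)) : f (w 0) t = f (w t) 0 := by
  have hτT : Icc 0 τ ⊆ Ico 0 T := fun σ hσ => ⟨hσ.1, hσ.2.trans_lt hτ⟩
  have hC0 : 0 ≤ C := (norm_nonneg _).trans (hC t ⟨ht, htτ⟩ c (mem_ball_self hR))
  have hdiff : ∀ σ ∈ Icc 0 τ, DifferentiableOn ℂ (fun x => f x σ) (ball c R) := fun σ hσ z hz =>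
    (hfz σ (hτT hσ) z hz).differentiableAt.differentiableWithinAt
  have hsub : ball c (3 * R / 4) ⊆ ball c R := ball_subset_ball (by linarith)
  set K : ℝ := C / (R / 4) * M with hK
  have htime : ∀ z ∈ ball c (3 * R / 4), ∀ σ ∈ Icc 0 τ, ∀ σ' ∈ Icc 0 τ,
      ‖f z σ' - f z σ‖ ≤ K * ‖σ' - σ‖ := fun z hz σ hσ σ' hσ' => by
    refine (convex_Icc 0 τ).norm_image_sub_le_of_norm_hasDerivWithin_le
      (fun x hx => (hpde z (hsub hz) x (hτT hx)).mono hτT) (fun x hx => ?_) hσ hσ'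
    have h1 : ‖fz z x‖ ≤ C / (R - 3 * R / 4) := by
      rw [← (hfz x (hτT hx) z (hsub hz)).deriv]
      exact norm_deriv_le_of_norm_le_ball (by linarith) (hdiff x hx) (hC x hx) hz
    rw [show R - 3 * R / 4 = R / 4 by ring] at h1
    have h2 : ‖z‖ ≤ 1 := (mem_ball_zero_iff.1 (hcR (hsub hz))).le
    have h3 := hp z (hsub hz) x (hτT hx)
    rw [norm_neg, norm_mul, norm_mul]
    calc ‖z‖ * ‖fz z x‖ * ‖p z x‖ ≤ 1 * (C / (R / 4)) * M := by gcongr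
      _ = K := by rw [one_mul]
  have hmixed : ∀ x ∈ ball c (R / 2), ∀ y ∈ ball c (R / 2), ∀ σ ∈ Icc 0 τ, ∀ σ' ∈ Icc 0 τ,
      ‖(f x σ' - f x σ) - (f y σ' - f y σ)‖ ≤ K * ‖σ' - σ‖ / (R / 4) * ‖x - y‖ :=
    fun x hx y hy σ hσ σ' hσ' => by
      have h := norm_sub_le_of_norm_le_ball (g := fun x => f x σ' - f x σ) (R := 3 * R / 4)
        (r := R / 2) (by linarith) (((hdiff σ' hσ').sub (hdiff σ hσ)).mono hsub)
        (fun z hz => htime z hz σ hσ σ' hσ') hx hy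
      rwa [show 3 * R / 4 - R / 2 = R / 4 by ring] at h
  have hmaps : MapsTo (fun s => t - s) (Icc 0 t) (Icc 0 τ) := fun s hs =>
    ⟨by linarith [hs.2], by linarith [hs.1]⟩
  have hderiv : ∀ s ∈ Icc 0 t, HasDerivWithinAt (fun s => f (w s) (t - s)) 0 (Icc 0 t) s :=
      fun s hs => by
    have hws : w s ∈ ball c R := ball_subset_ball (by linarith) (hwc s hs)
    have hA : HasDerivWithinAt (fun h => f (w h) (t - s))
        (fz (w s) (t - s) * -(w s * p (w s) (t - s))) (Icc 0 t) s :=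
      (hfz _ (hτT (hmaps hs)) _ hws).comp_hasDerivWithinAt s (hw s hs)
    have hB : HasDerivWithinAt (fun h => f (w s) (t - h))
        ((-1 : ℝ) • -(w s * fz (w s) (t - s) * p (w s) (t - s))) (Icc 0 t) s :=
      (hpde _ hws _ (hτT (hmaps hs))).scomp s
        ((hasDerivAt_id s).const_sub t).hasDerivWithinAt fun h hh => hτT (hmaps hh)
    have hE : HasDerivWithinAt
        (fun h => (f (w h) (t - h) - f (w h) (t - s)) - (f (w s) (t - h) - f (w s) (t - s)))
        0 (Icc 0 t) s := by
      rw [hasDerivWithinAt_iff_isLittleO, Asymptotics.isLittleO_iff]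
      intro ε hε
      have hlim : Tendsto (fun h => K / (R / 4) * ‖w h - w s‖) (𝓝[Icc 0 t] s) (𝓝 0) := by
        simpa using (((hw s hs).continuousWithinAt.tendsto.sub_const (w s)).norm).const_mul
          (K / (R / 4))
      filter_upwards [hlim.eventually (gt_mem_nhds hε), self_mem_nhdsWithin] with h hh hht
      have h1 := hmixed _ (hwc h hht) _ (hwc s hs) _ (hmaps hs) _ (hmaps hht)
      rw [show t - h - (t - s) = -(h - s) by ring, norm_neg] at h1
      simp only [sub_self, smul_zero, sub_zero]
      calc _ ≤ _ := h1
        _ = K / (R / 4) * ‖w h - w s‖ * ‖h - s‖ := by ring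
        _ ≤ ε * ‖h - s‖ := by gcongr
    refine (((hA.add hB).add hE).sub_const (f (w s) (t - s))).congr_deriv ?_ |>.congr ?_ ?_
    · simp only [neg_smul, one_smul]
      ring
    · intro h _
      simp only [Pi.add_apply]
      ring
    · simp only [Pi.add_apply]
      ring
  have h := (convex_Icc 0 t).norm_image_sub_le_of_norm_hasDerivWithin_le (C := 0) hderiv
    (fun s _ => by simp) (left_mem_Icc.2 ht) (right_mem_Icc.2 ht)
  rw [zero_mul, norm_le_zero_iff, sub_self, sub_zero] at h
  exact (sub_eq_zero.1 h).symm

/-- First-order expansion in time of solutions of the Löwner–Kufarev equation, uniform on the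
open unit disk. -/
theorem loewner_kufarev_uniform_expansion_ball {T M L : ℝ} {p f fz : ℂ → ℝ → ℂ} (hT : 0 < T)
    (hp : ∀ σ ∈ Ico 0 T, DifferentiableOn ℂ (fun z => p z σ) (ball 0 1))
    (hre : ∀ σ ∈ Ico 0 T, ∀ z ∈ ball (0:ℂ) 1, 0 ≤ (p z σ).re)
    (hunif : ∀ ε > 0, ∃ η > 0, ∀ σ ∈ Ico 0 T, ∀ σ' ∈ Ico 0 T, |σ - σ'| < η →
      ∀ z ∈ ball (0:ℂ) 1, ‖p z σ - p z σ'‖ ≤ ε)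
    (hpM : ∀ z ∈ ball (0:ℂ) 1, ∀ σ ∈ Ico 0 T, ‖p z σ‖ ≤ M) (hL : 0 ≤ L)
    (hlip : ∀ σ ∈ Ico 0 T, ∀ x ∈ ball (0:ℂ) 1, ∀ y ∈ ball (0:ℂ) 1,
      ‖p x σ - p y σ‖ ≤ L * ‖x - y‖)
    (hinit : ∀ z ∈ ball (0:ℂ) 1, f z 0 = z)
    (hfz : ∀ σ ∈ Ico 0 T, ∀ z ∈ ball (0:ℂ) 1, HasDerivAt (fun x => f x σ) (fz z σ) z)
    (hpde : ∀ z ∈ ball (0:ℂ) 1, ∀ σ ∈ Ico 0 T,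
      HasDerivWithinAt (f z) (-(z * fz z σ * p z σ)) (Ico 0 T) σ) {ε : ℝ} (hε : 0 < ε) :
    ∃ t₀ > 0, t₀ < T ∧ ∀ t ∈ Ioo 0 t₀, ∀ z ∈ ball (0:ℂ) 1,
      ‖f z t - z * (1 - p z 0 * t)‖ ≤ ε * t := by
  have hM : 0 ≤ M := (norm_nonneg _).trans (hpM 0 (mem_ball_self one_pos) 0 ⟨le_rfl, hT⟩)
  have hdiff : ∀ σ ∈ Ico 0 T, DifferentiableOn ℂ (fun x => f x σ) (ball 0 1) := fun σ hσ z hz =>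
    (hfz σ hσ z hz).differentiableAt.differentiableWithinAt
  have hpc : ∀ z ∈ ball (0:ℂ) 1, ContinuousOn (p z) (Ico 0 T) := fun z hz => by
    refine Metric.continuousOn_iff.2 fun b hb δ hδ => ?_
    obtain ⟨η, hη, h⟩ := hunif (δ / 2) (half_pos hδ)
    refine ⟨η, hη, fun a ha hab => ?_⟩
    rw [dist_eq_norm]
    exact (h a ha b hb hab z hz).trans_lt (half_lt_self hδ)
  have hτT : Icc 0 (T / 2) ⊆ Ico 0 T := fun σ hσ => ⟨hσ.1, hσ.2.trans_lt (half_lt_self hT)⟩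
  obtain ⟨c, R, hR, C, hcR, hC⟩ := exists_ball_forall_norm_le_of_pointwise_bounded
    (ι := Icc 0 (T / 2)) (g := fun σ z => f z σ) (isOpen_ball (x := (0:ℂ)) (ε := 1))
    ⟨0, mem_ball_self one_pos⟩ (fun σ => (hdiff σ (hτT σ.2)).continuousOn) fun z hz => by
      obtain ⟨C, hC⟩ := isCompact_Icc.exists_bound_of_continuousOn
        (fun σ hσ => ((hpde z hz σ (hτT hσ)).continuousWithinAt).mono hτT)
      exact ⟨C, fun σ => hC σ σ.2⟩
  obtain ⟨η, hη, hpη⟩ := hunif (ε / 2) (half_pos hε)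
  have hsmall : ∀ᶠ t : ℝ in 𝓝 0, t < T / 2 ∧ L * t < 1 / 2 ∧ M * t < R / 4 ∧ t < η ∧
      M * t * M + L * (M * t) < ε / 2 := by
    have h : ∀ {u : ℝ → ℝ} {a : ℝ}, Continuous u → u 0 < a → ∀ᶠ t in 𝓝 0, u t < a :=
      fun hu ha => hu.continuousAt.eventually (gt_mem_nhds ha)
    refine (h continuous_id (by simpa)).and ((h (by fun_prop) (by simp)).and
      ((h (by fun_prop) (by simpa)).and ((h continuous_id hη).and (h (by fun_prop) (by simpa)))))
  obtain ⟨t₁, ht₁, hsmall⟩ := Metric.eventually_nhds_iff.1 hsmall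
  refine ⟨min t₁ (T / 2), lt_min ht₁ (half_pos hT), (min_le_right _ _).trans_lt (half_lt_self hT),
    fun t ht => ?_⟩
  obtain ⟨ht0, htt₁⟩ := ht
  obtain ⟨htT, htL, htM, htη, htε⟩ := hsmall (y := t) (by
    rw [Real.dist_0_eq_abs, abs_of_pos ht0]
    exact htt₁.trans_le (min_le_left _ _))
  have hclamp : ∀ s, t - max 0 (min s t) ∈ Icc 0 t := fun s =>
    ⟨by linarith [max_le ht0.le (min_le_right s t)], by linarith [le_max_left 0 (min s t)]⟩
  have htIco : Icc 0 t ⊆ Ico 0 T := fun s hs => ⟨hs.1, by linarith [hs.2]⟩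
  have hclamp' := fun s => htIco (hclamp s)
  obtain ⟨W, hWd, hW⟩ := exists_loewner_flow (Q := fun z s => p z (t - max 0 (min s t)))
    ht0.le hL htL.le (fun σ => hp _ (hclamp' σ))
    (fun z hz => (hpc z hz).comp_continuous (by fun_prop) hclamp')
    (fun z hz σ => hpM z hz _ (hclamp' σ)) (fun z hz σ => hre _ (hclamp' σ) z hz)
    fun σ => hlip _ (hclamp' σ)
  have hWderiv : ∀ z ∈ ball (0:ℂ) 1, ∀ s ∈ Icc 0 t,
      HasDerivWithinAt (W z) (-(W z s * p (W z s) (t - s))) (Icc 0 t) s := fun z hz s hs => by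
    have h := (hW z hz).2.2 s hs
    rwa [min_eq_left hs.2, max_eq_right hs.1] at h
  have hrev : ∀ s ∈ Icc 0 t, t - s ∈ Ico 0 T := fun s hs =>
    htIco ⟨by linarith [hs.2], by linarith [hs.1]⟩
  have hWnear : ∀ z ∈ ball (0:ℂ) 1, ∀ s ∈ Icc 0 t, ‖W z s - z‖ ≤ M * t := fun z hz s hs => by
    have h := (convex_Icc 0 t).norm_image_sub_le_of_norm_hasDerivWithin_le (C := M)
      (hWderiv z hz) (fun x hx => ?_) (left_mem_Icc.2 ht0.le) hs
    · rw [(hW z hz).1, sub_zero, Real.norm_eq_abs, abs_of_nonneg hs.1] at h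
      exact h.trans (by gcongr; exact hs.2)
    · rw [norm_neg, norm_mul]
      have h1 := (mem_ball_zero_iff.1 ((hW z hz).2.1 x)).le
      have h2 := hpM _ ((hW z hz).2.1 x) _ (hrev x hx)
      calc _ ≤ 1 * M := by gcongr
        _ = M := one_mul M
  have hlocal : ∀ z ∈ ball c (R / 4), f z t = W z t := fun z hz => by
    have hz1 : z ∈ ball (0:ℂ) 1 := hcR (ball_subset_ball (by linarith) hz)
    have h := eq_of_characteristic_of_norm_le hR hcR (half_lt_self hT) ht0.le htT.le
      (fun σ hσ z hz => hfz σ hσ z (hcR hz)) (fun z hz => hpde z (hcR hz))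
      (fun z hz => hpM z (hcR hz)) (fun σ hσ => hC ⟨σ, hσ⟩) (hWderiv z hz1) fun s hs => by
        have h1 := hWnear z hz1 s hs
        rw [← dist_eq_norm] at h1
        rw [mem_ball] at hz ⊢
        linarith [dist_triangle (W z s) z c]
    rw [(hW z hz1).1, hinit _ ((hW z hz1).2.1 t)] at h
    exact h
  have hglobal : EqOn (fun z => f z t) (fun z => W z t) (ball 0 1) := by
    refine ((hdiff t (htIco (right_mem_Icc.2 ht0.le))).analyticOnNhd
      isOpen_ball).eqOn_of_preconnected_of_eventuallyEq ((hWd t).analyticOnNhd isOpen_ball)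
      (convex_ball 0 1).isPreconnected (hcR (mem_ball_self hR)) ?_
    filter_upwards [ball_mem_nhds c (by linarith : 0 < R / 4)] with z hz using hlocal z hz
  intro z hz
  have h := (convex_Icc 0 t).norm_image_sub_le_of_norm_hasDerivWithin_le (C := ε)
    (f := fun s => W z s + z * p z 0 * s)
    (fun s hs => (hWderiv z hz s hs).add
      (((hasDerivAt_id s).ofReal_comp.const_mul (z * p z 0)).hasDerivWithinAt))
    (fun s hs => ?_) (left_mem_Icc.2 ht0.le) (right_mem_Icc.2 ht0.le)
  · rw [sub_zero, Real.norm_eq_abs, abs_of_pos ht0, (hW z hz).1] at h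
    rw [show f z t = W z t from hglobal hz]
    rwa [show W z t - z * (1 - p z 0 * t) = W z t + z * p z 0 * t - (z + z * p z 0 * (0:ℝ)) by
      push_cast; ring]
  · have hWs := (hW z hz).2.1 s
    have h0 : (0:ℝ) ∈ Ico 0 T := ⟨le_rfl, hT⟩
    have h1 := hWnear z hz s hs
    have h2 := hpM _ hWs _ (hrev s hs)
    have h3 := hlip 0 h0 z hz _ hWs
    have h4 := hpη 0 h0 _ (hrev s hs) (by
      rw [zero_sub, abs_neg, abs_of_nonneg (hrev s hs).1]; linarith [hs.1]) _ hWs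
    have h5 := (mem_ball_zero_iff.1 hz).le
    rw [norm_sub_rev] at h1
    calc _ = ‖(z - W z s) * p (W z s) (t - s)
          + z * ((p z 0 - p (W z s) 0) + (p (W z s) 0 - p (W z s) (t - s)))‖ := by
          congr 1
          simp only [Complex.ofReal_one]
          ring
      _ ≤ ‖z - W z s‖ * ‖p (W z s) (t - s)‖ + ‖z‖ * (‖p z 0 - p (W z s) 0‖ +
          ‖p (W z s) 0 - p (W z s) (t - s)‖) := by
        refine (norm_add_le _ _).trans ?_
        rw [norm_mul, norm_mul]
        gcongr
        exact norm_add_le _ _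
      _ ≤ M * t * M + 1 * (L * (M * t) + ε / 2) := by
        gcongr
        exact h3.trans (by gcongr)
      _ ≤ ε := by linarith

theorem Complex.abs_norm_one_add_sub_le {x : ℂ} (hx : ‖x‖ ≤ 1 / 2) :
    |‖1 + x‖ - (1 + x.re)| ≤ ‖x‖ ^ 2 := by
  have hn : ‖1 + x‖ ^ 2 = (1 + x.re) ^ 2 + x.im ^ 2 := by
    rw [Complex.sq_norm, Complex.normSq_apply]
    simp only [Complex.add_re, Complex.one_re, Complex.add_im, Complex.one_im, zero_add]
    ring
  have hxn : ‖x‖ ^ 2 = x.re ^ 2 + x.im ^ 2 := by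
    rw [Complex.sq_norm, Complex.normSq_apply]
    ring
  have hre : 1 + x.re ≤ ‖1 + x‖ := by simpa using Complex.re_le_norm (1 + x)
  have hlow : -(1 / 2) ≤ x.re := by linarith [(abs_le.1 (Complex.abs_re_le_norm x)).1]
  rw [abs_of_nonneg (by linarith)]
  nlinarith [sq_nonneg x.re]

theorem Complex.abs_arg_one_add_sub_im_le {x : ℂ} (hx : ‖x‖ ≤ 1 / 2) :
    |Complex.arg (1 + x) - x.im| ≤ ‖x‖ ^ 2 := by
  have h := Complex.norm_log_one_add_sub_self_le (z := x) (by linarith)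
  have h1 := Complex.abs_im_le_norm (Complex.log (1 + x) - x)
  rw [Complex.sub_im, Complex.log_im] at h1
  refine (h1.trans h).trans ?_
  have h2 : (1 - ‖x‖)⁻¹ ≤ 2 := by
    rw [inv_le_comm₀ (by linarith) two_pos]
    linarith
  nlinarith [mul_le_mul_of_nonneg_left h2 (sq_nonneg ‖x‖)]

/-- A continuous branch of the argument starting at `0` along a path near `1` is the principal
argument. -/
theorem eq_arg_of_continuousOn {t : ℝ} (ht : 0 ≤ t) {δ ρ : ℝ → ℝ} {y : ℝ → ℂ}
    (hδ : ContinuousOn δ (Icc 0 t)) (hδ0 : δ 0 = 0) (hy : ∀ s ∈ Ioc 0 t, 0 < (y s).re)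
    (hρ : 0 < ρ t)
    (hyδ : ∀ s ∈ Icc 0 t, y s = ρ s * Complex.exp (Complex.I * δ s)) :
    δ t = Complex.arg (y t) := by
  have hlt : |δ t| < Real.pi := by
    by_contra! hge
    obtain ⟨s, hs, hsπ⟩ := intermediate_value_Icc ht hδ.abs
      (show Real.pi / 2 ∈ Icc |δ 0| |δ t| by
        rw [hδ0, abs_zero]
        exact ⟨by positivity, by linarith [Real.pi_pos]⟩)
    have hs0 : s ≠ 0 := by
      rintro rfl
      simp only [hδ0, abs_zero] at hsπ
      linarith [Real.pi_pos]
    have hpos := hy s ⟨lt_of_le_of_ne hs.1 hs0.symm, hs.2⟩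
    rw [hyδ s hs, Complex.re_ofReal_mul, mul_comm Complex.I, Complex.exp_ofReal_mul_I_re,
      ← Real.cos_abs, show |δ s| = Real.pi / 2 from hsπ, Real.cos_pi_div_two, mul_zero] at hpos
    exact hpos.false
  rw [hyδ t (right_mem_Icc.2 ht), Complex.arg_real_mul _ hρ, mul_comm, Complex.exp_mul_I,
    Complex.arg_cos_add_sin_mul_I ⟨(abs_lt.1 hlt).1, (abs_lt.1 hlt).2.le⟩]

/- STATEMENT 15: Uniform first-order boundary expansion for the
Löwner–Kufarev solution:
`f(e^{iφ},t) = e^{iφ}(1 - p(e^{iφ},0)t) + o(t)`, t → 0+, uniformly in φ;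
in particular `|f(e^{iφ},t)| = 1 - Re p(e^{iφ},0)·t + o(t)` and
`arg f(e^{iφ},t) = φ - Im p(e^{iφ},0)·t + o(t)`, uniformly in φ. -/
theorem loewner_kufarev_uniform_boundary_expansion
    (T : ℝ) (hT : 0 < T) (p p' : ℂ → ℝ → ℂ)
    -- Carathéodory class driving function
    (hp_hol : ∀ t ∈ Set.Ico (0:ℝ) T,
      DifferentiableOn ℂ (fun z => p z t) (Metric.ball (0:ℂ) 1))
    (hp_cont : ∀ t ∈ Set.Ico (0:ℝ) T,
      ContinuousOn (fun z => p z t) (Metric.closedBall (0:ℂ) 1))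
    (hp_one : ∀ t ∈ Set.Ico (0:ℝ) T, p 0 t = 1)
    (hp_re : ∀ t ∈ Set.Ico (0:ℝ) T, ∀ z ∈ Metric.ball (0:ℂ) 1, 0 < (p z t).re)
    -- p(·,t) is C¹ on 𝔻̄; p(z,·) is continuous on [0,T) uniformly in z ∈ 𝔻̄;
    -- p, p' are bounded on 𝔻̄ × [0,T)
    (hp' : ∀ t ∈ Set.Ico (0:ℝ) T, ∀ z ∈ Metric.ball (0:ℂ) 1,
      HasDerivAt (fun x => p x t) (p' z t) z)
    (hp'_cont : ∀ t ∈ Set.Ico (0:ℝ) T,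
      ContinuousOn (fun z => p' z t) (Metric.closedBall (0:ℂ) 1))
    (hp_t_unif : ∀ ε > (0:ℝ), ∃ η > (0:ℝ), ∀ t ∈ Set.Ico (0:ℝ) T,
      ∀ t' ∈ Set.Ico (0:ℝ) T, |t - t'| < η →
        ∀ z ∈ Metric.closedBall (0:ℂ) 1, ‖p z t - p z t'‖ ≤ ε)
    (M M' : ℝ)
    (hp_bdd : ∀ z ∈ Metric.closedBall (0:ℂ) 1, ∀ t ∈ Set.Ico (0:ℝ) T, ‖p z t‖ ≤ M)
    (hp'_bdd : ∀ z ∈ Metric.closedBall (0:ℂ) 1, ∀ t ∈ Set.Ico (0:ℝ) T, ‖p' z t‖ ≤ M')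
    -- f solves the Löwner–Kufarev PDE, univalent on 𝔻, continuous on 𝔻̄
    (f fz : ℂ → ℝ → ℂ)
    (hf_init : ∀ z ∈ Metric.ball (0:ℂ) 1, f z 0 = z)
    (hf_hol : ∀ t ∈ Set.Ico (0:ℝ) T,
      DifferentiableOn ℂ (fun z => f z t) (Metric.ball (0:ℂ) 1))
    (hf_inj : ∀ t ∈ Set.Ico (0:ℝ) T,
      Set.InjOn (fun z => f z t) (Metric.ball (0:ℂ) 1))
    (hf_cl : ∀ t ∈ Set.Ico (0:ℝ) T,
      ContinuousOn (fun z => f z t) (Metric.closedBall (0:ℂ) 1))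
    (hfz : ∀ t ∈ Set.Ico (0:ℝ) T, ∀ z ∈ Metric.ball (0:ℂ) 1,
      HasDerivAt (fun x => f x t) (fz z t) z)
    (hf_pde : ∀ z ∈ Metric.ball (0:ℂ) 1, ∀ t ∈ Set.Ico (0:ℝ) T,
      HasDerivWithinAt (fun u => f z u) (-(z * fz z t * p z t)) (Set.Ico 0 T) t)
    -- Θ(t,φ) is the continuous branch of arg f(e^{iφ},t) with Θ(0,φ) = φ
    (Θ : ℝ → ℝ → ℝ)
    (hΘ_init : ∀ φ : ℝ, Θ 0 φ = φ)
    (hΘ_cont : ∀ φ : ℝ, ContinuousOn (fun t => Θ t φ) (Set.Ico 0 T))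
    (hΘ_arg : ∀ t ∈ Set.Ico (0:ℝ) T, ∀ φ : ℝ,
      f (Complex.exp (Complex.I * (φ:ℂ))) t =
        (‖f (Complex.exp (Complex.I * (φ:ℂ))) t‖ : ℂ) *
          Complex.exp (Complex.I * ((Θ t φ : ℝ) : ℂ))) :
    ∀ ε > (0:ℝ), ∃ t₀ > (0:ℝ), ∀ t, 0 < t → t < t₀ → t < T →
      ∀ φ ∈ Set.Icc (0:ℝ) (2 * Real.pi),
        ‖f (Complex.exp (Complex.I * (φ:ℂ))) t -
            Complex.exp (Complex.I * (φ:ℂ)) *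
              (1 - p (Complex.exp (Complex.I * (φ:ℂ))) 0 * (t:ℂ))‖ ≤ ε * t ∧
        |‖f (Complex.exp (Complex.I * (φ:ℂ))) t‖ -
            (1 - (p (Complex.exp (Complex.I * (φ:ℂ))) 0).re * t)| ≤ ε * t ∧
        |Θ t φ - (φ - (p (Complex.exp (Complex.I * (φ:ℂ))) 0).im * t)| ≤ ε * t := by
  intro ε hε
  have hsub : ball (0:ℂ) 1 ⊆ closedBall 0 1 := ball_subset_closedBall
  have h0T : (0:ℝ) ∈ Ico 0 T := ⟨le_rfl, hT⟩
  have hM : 0 ≤ M :=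
    (norm_nonneg _).trans (hp_bdd 0 (mem_closedBall_self zero_le_one) 0 h0T)
  have hM' : 0 ≤ M' :=
    (norm_nonneg _).trans (hp'_bdd 0 (mem_closedBall_self zero_le_one) 0 h0T)
  obtain ⟨t₁, ht₁, ht₁T, hball⟩ := loewner_kufarev_uniform_expansion_ball hT hp_hol
    (fun σ hσ z hz => (hp_re σ hσ z hz).le)
    (fun ε hε => (hp_t_unif ε hε).imp fun η h => ⟨h.1, fun σ hσ σ' hσ' hd z hz =>
      h.2 σ hσ σ' hσ' hd z (hsub hz)⟩)
    (fun z hz => hp_bdd z (hsub hz)) hM'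
    (fun σ hσ x hx y hy => (convex_ball (0:ℂ) 1).norm_image_sub_le_of_norm_hasDerivWithin_le
      (fun z hz => (hp' σ hσ z hz).hasDerivWithinAt) (fun z hz => hp'_bdd z (hsub hz) σ hσ) hy hx)
    hf_init hfz hf_pde (half_pos hε)
  have hclosed : ∀ t ∈ Ioo 0 t₁, ∀ z ∈ closedBall (0:ℂ) 1,
      ‖f z t - z * (1 - p z 0 * t)‖ ≤ ε / 2 * t := fun t ht z hz => by
    have hcl : closure (ball (0:ℂ) 1) = closedBall 0 1 := closure_ball 0 one_ne_zero
    have hfc := hf_cl t ⟨ht.1.le, ht.2.trans ht₁T⟩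
    have hpc := hp_cont 0 h0T
    have hmaps := MapsTo.closure_of_continuousOn
      (f := fun z => ‖f z t - z * (1 - p z 0 * t)‖) (t := Iic (ε / 2 * t))
      (fun z hz => hball t ht z hz) (by rw [hcl]; fun_prop)
    rw [hcl, isClosed_Iic.closure_eq] at hmaps
    exact hmaps hz
  set A : ℝ := M + ε / 2 with hA
  have hA0 : 0 < A := by positivity
  refine ⟨min t₁ (min (1 / (2 * A)) (ε / (2 * A ^ 2))), by positivity, ?_⟩
  intro t ht htt₀ htT φ _
  obtain ⟨htt₁, htA, htA2⟩ := by simpa only [lt_min_iff] using htt₀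
  rw [lt_div_iff₀ (by positivity)] at htA htA2
  set e : ℂ := Complex.exp (Complex.I * φ) with he
  have he1 : ‖e‖ = 1 := by rw [he, mul_comm, Complex.norm_exp_ofReal_mul_I]
  have he0 : e ≠ 0 := Complex.exp_ne_zero _
  have heball : e ∈ closedBall (0:ℂ) 1 := by simp [he1]
  set x : ℝ → ℂ := fun s => e⁻¹ * f e s - 1 with hx
  have hfx : ∀ s, f e s = e * (1 + x s) := fun s => by
    rw [hx]
    field_simp
    ring
  have hxp : ∀ s ∈ Ioc 0 t, ‖x s + p e 0 * s‖ ≤ ε / 2 * s := fun s hs => by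
    have h := hclosed s ⟨hs.1, hs.2.trans_lt htt₁⟩ e heball
    rwa [hfx, ← mul_sub, norm_mul, he1, one_mul, show 1 + x s - (1 - p e 0 * s)
      = x s + p e 0 * s by ring] at h
  have hxA : ∀ s ∈ Ioc 0 t, ‖x s‖ ≤ A * s := fun s hs => by
    have h1 := hp_bdd e heball 0 h0T
    calc ‖x s‖ = ‖(x s + p e 0 * s) - p e 0 * s‖ := by rw [add_sub_cancel_right]
      _ ≤ ‖x s + p e 0 * s‖ + ‖p e 0 * s‖ := norm_sub_le _ _
      _ ≤ ε / 2 * s + M * s := by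
        rw [norm_mul, Complex.norm_real, Real.norm_eq_abs, abs_of_pos hs.1]
        have := hs.1
        gcongr
        exact hxp s hs
      _ = A * s := by ring
  have hxhalf : ∀ s ∈ Ioc 0 t, ‖x s‖ ≤ 1 / 2 := fun s hs => by
    nlinarith [hxA s hs, hs.2, mul_le_mul_of_nonneg_left hs.2 hA0.le]
  have htm : t ∈ Ioc 0 t := ⟨ht, le_rfl⟩
  have hpos : ∀ s ∈ Ioc 0 t, 0 < (1 + x s).re := fun s hs => by
    have h1 := (abs_le.1 (Complex.abs_re_le_norm (x s))).1
    rw [Complex.add_re, Complex.one_re]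
    linarith [hxhalf s hs]
  have hxsq : ‖x t‖ ^ 2 ≤ ε / 2 * t := by
    calc ‖x t‖ ^ 2 ≤ (A * t) ^ 2 := by
          gcongr
          exact hxA t htm
      _ = t * (2 * A ^ 2) / 2 * t := by ring
      _ ≤ ε / 2 * t := by gcongr
  have hfn : ∀ s, ‖f e s‖ = ‖1 + x s‖ := fun s => by rw [hfx, norm_mul, he1, one_mul]
  refine ⟨?_, ?_, ?_⟩
  · refine (hclosed t ⟨ht, htt₁⟩ e heball).trans ?_
    gcongr
    linarith
  · have h1 := Complex.abs_norm_one_add_sub_le (hxhalf t htm)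
    have h2 := (Complex.abs_re_le_norm _).trans (hxp t htm)
    rw [Complex.add_re, Complex.re_mul_ofReal] at h2
    rw [hfn, show ‖1 + x t‖ - (1 - (p e 0).re * t) = (‖1 + x t‖ - (1 + (x t).re))
      + ((x t).re + (p e 0).re * t) by ring]
    linarith [abs_add_le (‖1 + x t‖ - (1 + (x t).re)) ((x t).re + (p e 0).re * t)]
  · have harg := eq_arg_of_continuousOn ht.le (δ := fun s => Θ s φ - φ) (ρ := fun s => ‖f e s‖)
      (y := fun s => 1 + x s)
      (((hΘ_cont φ).mono fun s hs => ⟨hs.1, hs.2.trans_lt htT⟩).sub continuousOn_const)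
      (by simp [hΘ_init]) hpos (by
        rw [hfn]
        exact (hpos t htm).trans_le (Complex.re_le_norm _)) fun s hs => by
      have h := hΘ_arg s ⟨hs.1, hs.2.trans_lt htT⟩ φ
      rw [← he] at h
      rw [Complex.ofReal_sub, mul_sub, Complex.exp_sub, ← he, mul_div_assoc', ← h, hfx,
        mul_div_cancel_left₀ _ he0]
    have h1 := Complex.abs_arg_one_add_sub_im_le (hxhalf t htm)
    rw [← harg] at h1
    have h2 := (Complex.abs_im_le_norm _).trans (hxp t htm)
    rw [Complex.add_im, Complex.im_mul_ofReal] at h2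
    rw [show Θ t φ - (φ - (p e 0).im * t) = (Θ t φ - φ - (x t).im)
      + ((x t).im + (p e 0).im * t) by ring]
    linarith [abs_add_le (Θ t φ - φ - (x t).im) ((x t).im + (p e 0).im * t)]
end
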